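/- Reduction of maximal estimates to multiplier estimates. Let d ≥ 1, 1 < p < ∞ and ε > 0. There is a constant C = C(d,p,ε) > 0 with the following property. Let λ ≥ 2, let m : ℝ^d → ℂ be smooth and supported in the annulus {1 ≤ |ξ| ≤ 2}, set ṁ(ξ) := ξ·∇m(ξ) and m̃ := λ⁻¹ṁ, and let A, B > 0. Assume that both m and m̃ satisfy: (i) ‖T_m f‖_{L^p(ℝ^d)} ≤ A‖f‖_{L^p(ℝ^d)} for all Schwartz f (and the same with m̃ in place of m), and (ii) ∫_{|x|>r} |ℱ⁻¹m(x)| dx ≤ B(1+r)^{−ε} for all r > 0 (and the same with m̃ in place of m). Then the maximal operator 𝓜_m f(x) := sup_{t>0} |T_{m(t·)} f(x)| satisfies ‖𝓜_m f‖_{L^p(ℝ^d)} ≤ C λ^{1/p} A (log(2 + B/A))^{|1/p − 1/2|} ‖f‖_{L^p(ℝ^d)} for all Schwartz f. -/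

import Mathlib

open MeasureTheory Real
open scoped BigOperators ENNReal RealInnerProductSpace

noncomputable section

variable {d : ℕ}

/-- The Fourier transform `f̂(ξ) = ∫ f(x) e^{-i x·ξ} dx` on `ℝ^d`. -/
def fourierTd (f : EuclideanSpace ℝ (Fin d) → ℂ) (ξ : EuclideanSpace ℝ (Fin d)) : ℂ :=
  ∫ x : EuclideanSpace ℝ (Fin d), Complex.exp (-(Complex.I * (⟪x, ξ⟫ : ℂ))) * f x

/-- The inverse Fourier transform on `ℝ^d`. -/
def invFourierTd (g : EuclideanSpace ℝ (Fin d) → ℂ) (x : EuclideanSpace ℝ (Fin d)) : ℂ :=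
  ((((2 * Real.pi) ^ d)⁻¹ : ℝ) : ℂ) *
    ∫ ξ : EuclideanSpace ℝ (Fin d), Complex.exp (Complex.I * (⟪x, ξ⟫ : ℂ)) * g ξ

/-- The Fourier multiplier operator `T_m` on `ℝ^d`. -/
def Tmultd (m f : EuclideanSpace ℝ (Fin d) → ℂ) : EuclideanSpace ℝ (Fin d) → ℂ :=
  invFourierTd fun ξ => m ξ * fourierTd f ξ

/-- The radial derivative `ṁ(ξ) = ξ·∇m(ξ)`. -/
def radialDeriv (m : EuclideanSpace ℝ (Fin d) → ℂ) (ξ : EuclideanSpace ℝ (Fin d)) : ℂ :=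
  fderiv ℝ m ξ ξ

local notation "𝔼" => EuclideanSpace ℝ (Fin d)

section

theorem lintegral_Lp_finset_sum_le {α ι : Type*} [MeasurableSpace α] (μ : Measure α) {p : ℝ}
    (hp : 1 ≤ p) (s : Finset ι) (F : ι → α → ℝ≥0∞) (hF : ∀ i ∈ s, AEMeasurable (F i) μ) :
    (∫⁻ a, (∑ i ∈ s, F i a) ^ p ∂μ) ^ (1 / p) ≤ ∑ i ∈ s, (∫⁻ a, F i a ^ p ∂μ) ^ (1 / p) := by
  classical
  induction s using Finset.induction_on with
  | empty =>
    have h0 : (0 : ℝ) < p := by linarith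
    simp [ENNReal.zero_rpow_of_pos h0, ENNReal.zero_rpow_of_pos (inv_pos.mpr h0)]
  | insert i s his ih =>
    simp only [Finset.sum_insert his]
    refine (ENNReal.lintegral_Lp_add_le (f := F i) (g := fun a => ∑ i ∈ s, F i a)
      (hF i (Finset.mem_insert_self i s))
      (Finset.aemeasurable_fun_sum s fun j hj => hF j (Finset.mem_insert_of_mem hj)) hp).trans ?_
    gcongr
    exact ih fun j hj => hF j (Finset.mem_insert_of_mem hj)

theorem finset_sum_rpow_le_rpow_sum {ι : Type*} {p : ℝ} (hp : 1 ≤ p) (s : Finset ι)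
    (x : ι → ℝ≥0∞) : ∑ k ∈ s, x k ^ p ≤ (∑ k ∈ s, x k) ^ p := by
  classical
  induction s using Finset.induction_on with
  | empty => simp
  | insert i s his ih =>
    simp only [Finset.sum_insert his]
    exact (by gcongr : _ ≤ x i ^ p + (∑ k ∈ s, x k) ^ p).trans
      (ENNReal.add_rpow_le_rpow_add _ _ hp)

theorem tsum_rpow_le_rpow_tsum {ι : Type*} {p : ℝ} (hp : 1 ≤ p) (x : ι → ℝ≥0∞) :
    ∑' k, x k ^ p ≤ (∑' k, x k) ^ p := by
  rw [ENNReal.tsum_eq_iSup_sum]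
  refine iSup_le fun s => (finset_sum_rpow_le_rpow_sum hp s x).trans ?_
  gcongr
  exact ENNReal.sum_le_tsum s

theorem rpow_lintegral_mul_le {α : Type*} [MeasurableSpace α] (μ : Measure α) {p : ℝ}
    (hp : 1 < p) {k h : α → ℝ≥0∞} (hk : AEMeasurable k μ) (hh : AEMeasurable h μ) :
    (∫⁻ a, k a * h a ∂μ) ^ p ≤ (∫⁻ a, k a ∂μ) ^ (p - 1) * ∫⁻ a, k a * h a ^ p ∂μ := by
  have hp0 : 0 < p := by linarith
  obtain ⟨q, hq⟩ : ∃ q, p.HolderConjugate q := ⟨_, Real.HolderConjugate.conjExponent hp⟩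
  have hsum : 1 / p + 1 / q = 1 := by simpa using hq.inv_add_inv_eq_one
  have hq0 : 0 < q := hq.symm.pos
  have key := ENNReal.lintegral_mul_le_Lp_mul_Lq μ hq
    (f := fun a => k a ^ (1 / p) * h a) (g := fun a => k a ^ (1 / q))
    ((hk.pow_const _).mul hh) (hk.pow_const _)
  have e1 : ∀ a, (fun a => k a ^ (1 / p) * h a) a * (fun a => k a ^ (1 / q)) a = k a * h a := by
    intro a
    have : k a = k a ^ (1 / p) * k a ^ (1 / q) := by
      rw [← ENNReal.rpow_add_of_nonneg _ _ (by positivity) (by positivity), hsum,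
        ENNReal.rpow_one]
    calc _ = k a ^ (1 / p) * k a ^ (1 / q) * h a := by simp only []; ring
      _ = _ := by rw [← this]
  have e2 : ∀ a, (k a ^ (1 / p) * h a) ^ p = k a * h a ^ p := by
    intro a
    rw [ENNReal.mul_rpow_of_nonneg _ _ hp0.le, ← ENNReal.rpow_mul, one_div_mul_cancel hp0.ne',
      ENNReal.rpow_one]
  have e3 : ∀ a, (k a ^ (1 / q)) ^ q = k a := by
    intro a
    rw [← ENNReal.rpow_mul, one_div_mul_cancel hq0.ne', ENNReal.rpow_one]
  simp only [Pi.mul_apply, e1, e2, e3] at key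
  have hpq : 1 / q * p = p - 1 := by
    have : 1 / q = 1 - 1 / p := by linarith
    rw [this]; field_simp
  calc (∫⁻ a, k a * h a ∂μ) ^ p
      ≤ ((∫⁻ a, k a * h a ^ p ∂μ) ^ (1 / p) * (∫⁻ a, k a ∂μ) ^ (1 / q)) ^ p := by gcongr
    _ = _ := by
      rw [ENNReal.mul_rpow_of_nonneg _ _ hp0.le, ← ENNReal.rpow_mul, ← ENNReal.rpow_mul,
        one_div_mul_cancel hp0.ne', ENNReal.rpow_one, hpq, mul_comm]

section Young

variable {G : Type*} [MeasurableSpace G] [AddCommGroup G] [MeasurableAdd₂ G] [MeasurableNeg G]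
  (μ : Measure G) [SFinite μ] [μ.IsAddLeftInvariant] [μ.IsNegInvariant]

theorem lintegral_young {p : ℝ} (hp : 1 < p) {k h : G → ℝ≥0∞} (hk : Measurable k)
    (hh : AEMeasurable h μ) :
    ∫⁻ x, (∫⁻ y, k (x - y) * h y ∂μ) ^ p ∂μ ≤ (∫⁻ z, k z ∂μ) ^ p * ∫⁻ y, h y ^ p ∂μ := by
  have hp0 : 0 < p := by linarith
  wlog hh' : Measurable h generalizing h
  · have := this (h := hh.mk h) hh.measurable_mk.aemeasurable hh.measurable_mk
    have e : ∀ x, ∫⁻ y, k (x - y) * h y ∂μ = ∫⁻ y, k (x - y) * hh.mk h y ∂μ := fun x =>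
      lintegral_congr_ae (by filter_upwards [hh.ae_eq_mk] with y hy; rw [hy])
    have e2 : ∫⁻ y, h y ^ p ∂μ = ∫⁻ y, hh.mk h y ^ p ∂μ :=
      lintegral_congr_ae (by filter_upwards [hh.ae_eq_mk] with y hy; rw [hy])
    simpa only [e, e2] using this
  have hmk : Measurable fun z : G × G => k (z.1 - z.2) := by fun_prop
  calc ∫⁻ x, (∫⁻ y, k (x - y) * h y ∂μ) ^ p ∂μ
      ≤ ∫⁻ x, (∫⁻ y, k (x - y) ∂μ) ^ (p - 1) * ∫⁻ y, k (x - y) * h y ^ p ∂μ ∂μ := by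
        refine lintegral_mono fun x => rpow_lintegral_mul_le μ hp ?_ hh
        exact (hk.comp (measurable_const.sub measurable_id)).aemeasurable
    _ = (∫⁻ z, k z ∂μ) ^ (p - 1) * ∫⁻ x, ∫⁻ y, k (x - y) * h y ^ p ∂μ ∂μ := by
        simp only [lintegral_sub_left_eq_self k]
        rw [lintegral_const_mul]
        exact Measurable.lintegral_prod_right' (f := fun z : G × G => k (z.1 - z.2) * h z.2 ^ p)
          (by fun_prop)
    _ = (∫⁻ z, k z ∂μ) ^ (p - 1) * ((∫⁻ z, k z ∂μ) * ∫⁻ y, h y ^ p ∂μ) := by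
        rw [lintegral_lintegral_swap (by unfold Function.uncurry; fun_prop)]
        congr 1
        rw [← lintegral_const_mul _ (by fun_prop)]
        refine lintegral_congr fun y => ?_
        rw [lintegral_mul_const _ (by fun_prop), lintegral_sub_right_eq_self k]
    _ = _ := by
        rw [← mul_assoc]
        congr 1
        conv_rhs => rw [show p = (p - 1) + 1 by ring,
          ENNReal.rpow_add_of_nonneg _ _ (by linarith) zero_le_one, ENNReal.rpow_one]

end Young

theorem lintegral_rpow_le_of_weak_type {X Y : Type*} [MeasurableSpace X] [MeasurableSpace Y]
    (μ : Measure X) [SFinite μ] (ν : Measure Y) {p q c : ℝ} (hqp : q < p)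
    (hq : 0 < q) (hc : 0 < c) (C : ℝ≥0∞) {f : X → ℝ} (hf : Measurable f) (hf0 : ∀ x, 0 ≤ f x)
    {F : Y → ℝ} (hF : AEMeasurable F ν) (hF0 : ∀ y, 0 ≤ F y)
    (hweak : ∀ s : ℝ, 0 < s → ν {y | s < F y} ≤
      C * ENNReal.ofReal (s ^ (-q)) * ∫⁻ x in {x | c * s < f x}, ENNReal.ofReal (f x ^ q) ∂μ) :
    ∫⁻ y, ENNReal.ofReal (F y ^ p) ∂ν ≤
      C * ENNReal.ofReal (p / (p - q) * c ^ (q - p)) * ∫⁻ x, ENNReal.ofReal (f x ^ p) ∂μ := by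
  have hp : 0 < p := hq.trans hqp
  rw [lintegral_rpow_eq_lintegral_meas_lt_mul ν (Filter.Eventually.of_forall hF0) hF hp]
  set g : ℝ → X → ℝ≥0∞ := fun s x => {z : ℝ × X | c * z.1 < f z.2}.indicator
    (fun z => ENNReal.ofReal (f z.2 ^ q) * ENNReal.ofReal (z.1 ^ (p - 1 - q))) (s, x) with hg
  have hms : MeasurableSet {z : ℝ × X | c * z.1 < f z.2} :=
    measurableSet_lt (by fun_prop) (by fun_prop)
  have hgm : Measurable (Function.uncurry g) := by
    have : Function.uncurry g = {z : ℝ × X | c * z.1 < f z.2}.indicator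
      (fun z => ENNReal.ofReal (f z.2 ^ q) * ENNReal.ofReal (z.1 ^ (p - 1 - q))) := by
      ext ⟨s, x⟩; rfl
    rw [this]
    exact Measurable.indicator (by fun_prop) hms
  have h1 : ∫⁻ t in Set.Ioi (0:ℝ), ν {a | t < F a} * ENNReal.ofReal (t ^ (p - 1)) ≤
      ∫⁻ t in Set.Ioi (0:ℝ), C * ∫⁻ x, g t x ∂μ := by
    refine setLIntegral_mono' measurableSet_Ioi fun t ht => ?_
    have ht : 0 < t := ht
    have hset : MeasurableSet {x | c * t < f x} := measurableSet_lt (by fun_prop) hf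
    calc ν {a | t < F a} * ENNReal.ofReal (t ^ (p - 1))
        ≤ C * ENNReal.ofReal (t ^ (-q)) * (∫⁻ x in {x | c * t < f x}, ENNReal.ofReal (f x ^ q) ∂μ)
          * ENNReal.ofReal (t ^ (p - 1)) := by gcongr; exact hweak t ht
      _ = C * ((∫⁻ x in {x | c * t < f x}, ENNReal.ofReal (f x ^ q) ∂μ)
          * ENNReal.ofReal (t ^ (p - 1 - q))) := by
          have : ENNReal.ofReal (t ^ (p - 1 - q)) =
              ENNReal.ofReal (t ^ (-q)) * ENNReal.ofReal (t ^ (p - 1)) := by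
            rw [← ENNReal.ofReal_mul (by positivity), ← Real.rpow_add ht]; congr 2; ring
          rw [this]; ring
      _ = C * ∫⁻ x, g t x ∂μ := by
          rw [← lintegral_mul_const _ (by fun_prop), ← lintegral_indicator hset]
          rfl
  have h2 : ∀ x, ∫⁻ t in Set.Ioi (0:ℝ), g t x =
      ENNReal.ofReal (1 / (p - q) * c ^ (q - p)) * ENNReal.ofReal (f x ^ p) := by
    intro x
    have e : ∀ t, g t x = ENNReal.ofReal (f x ^ q) *
        (Set.Iio (f x / c)).indicator (fun t => ENNReal.ofReal (t ^ (p - 1 - q))) t := by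
      intro t
      simp only [hg, Set.indicator, Set.mem_ofPred_eq, Set.mem_Iio, lt_div_iff₀ hc, mul_comm c t]
      split_ifs <;> simp
    simp only [e]
    rw [lintegral_const_mul _ (Measurable.indicator (by fun_prop) measurableSet_Iio),
      lintegral_indicator measurableSet_Iio, Measure.restrict_restrict measurableSet_Iio]
    have hfc : 0 ≤ f x / c := div_nonneg (hf0 x) hc.le
    have hS : Set.Iio (f x / c) ∩ Set.Ioi 0 = Set.Ioo 0 (f x / c) := by
      ext; simp [and_comm]
    rw [hS, Measure.restrict_congr_set Ioo_ae_eq_Ioc, ← ofReal_integral_eq_lintegral_ofReal,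
      ← intervalIntegral.integral_of_le hfc, integral_rpow (Or.inl (by linarith)),
      ← ENNReal.ofReal_mul (by have := hf0 x; positivity),
      ← ENNReal.ofReal_mul (by have : 0 < p - q := by linarith
                               positivity)]
    · congr 1
      rw [show p - 1 - q + 1 = p - q by ring, Real.zero_rpow (by linarith), sub_zero,
        Real.div_rpow (hf0 x) hc.le]
      have : c ^ (q - p) = (c ^ (p - q))⁻¹ := by
        rw [← Real.rpow_neg hc.le]; congr 1; ring
      rw [this]
      rcases (hf0 x).eq_or_lt with h | h
      · rw [← h, Real.zero_rpow hq.ne', Real.zero_rpow hp.ne']; simp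
      · have : f x ^ p = f x ^ q * f x ^ (p - q) := by
          rw [← Real.rpow_add h]; congr 1; ring
        rw [this]; field_simp
    · exact (intervalIntegrable_iff_integrableOn_Ioc_of_le hfc).mp
        (intervalIntegral.intervalIntegrable_rpow' (by linarith))
    · filter_upwards [ae_restrict_mem measurableSet_Ioc] with t ht
      exact Real.rpow_nonneg ht.1.le _
  calc _ ≤ ENNReal.ofReal p * ∫⁻ t in Set.Ioi (0:ℝ), C * ∫⁻ x, g t x ∂μ := by gcongr
    _ = ENNReal.ofReal p * (C * ∫⁻ x, (∫⁻ t in Set.Ioi (0:ℝ), g t x) ∂μ) := by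
        have hm : Measurable fun t => ∫⁻ x, g t x ∂μ := hgm.lintegral_prod_right'
        rw [lintegral_const_mul _ hm, lintegral_lintegral_swap]
        exact hgm.aemeasurable
    _ = _ := by
        simp only [h2]
        rw [lintegral_const_mul _ (by fun_prop)]
        have hpq : 0 < p - q := by linarith
        rw [show p / (p - q) * c ^ (q - p) = p * (1 / (p - q) * c ^ (q - p)) by ring,
          ENNReal.ofReal_mul hp.le]
        ring

end

section

theorem volume_closedBall_mul (z : 𝔼) {a : ℝ} (ha : 0 < a) (r : ℝ) :
    volume (Metric.closedBall z (a * r)) =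
      ENNReal.ofReal (a ^ d) * volume (Metric.closedBall z r) := by
  rw [Measure.addHaar_closedBall_mul_of_pos _ _ ha, Measure.addHaar_closedBall_center volume z r]
  simp

theorem volume_biUnion_le_of_average_gt {ι : Type*} (J : Finset ι) (z : ι → 𝔼) (r : ι → ℝ)
    {g : 𝔼 → ℝ} (hg : Measurable g) {s : ℝ} (hs : 0 < s)
    (hJ : ∀ i ∈ J, ENNReal.ofReal s * volume (Metric.closedBall (z i) (r i)) ≤
      ∫⁻ x in Metric.closedBall (z i) (r i), ENNReal.ofReal (g x)) :
    volume (⋃ i ∈ J, Metric.closedBall (z i) (r i)) ≤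
      ENNReal.ofReal (4 ^ d) * (ENNReal.ofReal (2 * s⁻¹) *
        ∫⁻ x in {x | 1 / 2 * s < g x}, ENNReal.ofReal (g x)) := by
  classical
  obtain ⟨R, hR⟩ : ∃ R, ∀ i ∈ (J : Set ι), r i ≤ R := by
    obtain ⟨R, hR⟩ := (J.image r).bddAbove
    exact ⟨R, fun i hi => hR (by simpa using ⟨i, hi, rfl⟩)⟩
  obtain ⟨u, huJ, hdisj, hcov⟩ := Vitali.exists_disjoint_subfamily_covering_enlargement_closedBall
    (J : Set ι) z r R hR 4 (by norm_num)
  have hufin : u.Finite := J.finite_toSet.subset huJ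
  set v := hufin.toFinset with hv
  have hset : MeasurableSet {x | 1 / 2 * s < g x} := measurableSet_lt (by fun_prop) hg
  have key : ∀ b ∈ v, volume (Metric.closedBall (z b) (r b)) ≤ ENNReal.ofReal (2 * s⁻¹) *
      ∫⁻ x in Metric.closedBall (z b) (r b) ∩ {x | 1 / 2 * s < g x}, ENNReal.ofReal (g x) := by
    intro b hb
    have hbJ := hJ b (huJ (hufin.mem_toFinset.mp hb))
    set V := volume (Metric.closedBall (z b) (r b)) with hV
    have hVfin : V ≠ ∞ := measure_closedBall_lt_top.ne
    set X := ∫⁻ x in Metric.closedBall (z b) (r b) ∩ {x | 1 / 2 * s < g x}, ENNReal.ofReal (g x)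
    have h1 : ∫⁻ x in Metric.closedBall (z b) (r b), ENNReal.ofReal (g x) ≤
        X + ENNReal.ofReal (1 / 2 * s) * V := by
      rw [← lintegral_inter_add_sdiff _ _ hset]
      gcongr
      calc _ ≤ ∫⁻ x in Metric.closedBall (z b) (r b) \ {x | 1 / 2 * s < g x},
            ENNReal.ofReal (1 / 2 * s) := by
            refine setLIntegral_mono' (measurableSet_closedBall.diff hset) fun x hx => ?_
            exact ENNReal.ofReal_le_ofReal (not_lt.mp hx.2)
        _ ≤ _ := by
            rw [setLIntegral_const]
            gcongr
            exact measure_mono Set.sdiff_subset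
    have h2 : ENNReal.ofReal s * V = ENNReal.ofReal (1 / 2 * s) * V
        + ENNReal.ofReal (1 / 2 * s) * V := by
      rw [← add_mul, ← ENNReal.ofReal_add (by positivity) (by positivity)]; congr 2; ring
    have h3 : ENNReal.ofReal (1 / 2 * s) * V ≤ X := by
      have := hbJ.trans h1
      rw [h2] at this
      exact (ENNReal.add_le_add_iff_right
        (ENNReal.mul_ne_top ENNReal.ofReal_ne_top hVfin)).mp this
    calc V = ENNReal.ofReal (2 * s⁻¹) * (ENNReal.ofReal (1 / 2 * s) * V) := by
          rw [← mul_assoc, ← ENNReal.ofReal_mul (by positivity)]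
          rw [show 2 * s⁻¹ * (1 / 2 * s) = 1 by field_simp]; simp
      _ ≤ _ := by gcongr
  calc volume (⋃ i ∈ J, Metric.closedBall (z i) (r i))
      ≤ volume (⋃ b ∈ v, Metric.closedBall (z b) (4 * r b)) := by
        refine measure_mono (Set.iUnion₂_subset fun i hi => ?_)
        obtain ⟨b, hb, hib⟩ := hcov i hi
        exact hib.trans (Set.subset_biUnion_of_mem (u := fun b => Metric.closedBall (z b) (4 * r b))
          (show b ∈ v from hufin.mem_toFinset.mpr hb))
    _ ≤ ∑ b ∈ v, volume (Metric.closedBall (z b) (4 * r b)) := measure_biUnion_finset_le _ _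
    _ ≤ ∑ b ∈ v, ENNReal.ofReal (4 ^ d) * (ENNReal.ofReal (2 * s⁻¹) *
      ∫⁻ x in Metric.closedBall (z b) (r b) ∩ {x | 1 / 2 * s < g x}, ENNReal.ofReal (g x)) := by
        refine Finset.sum_le_sum fun b hb => ?_
        rw [volume_closedBall_mul _ (by norm_num)]
        gcongr
        exact key b hb
    _ = ENNReal.ofReal (4 ^ d) * (ENNReal.ofReal (2 * s⁻¹) *
      ∫⁻ x in ⋃ b ∈ v, Metric.closedBall (z b) (r b) ∩ {x | 1 / 2 * s < g x},
        ENNReal.ofReal (g x)) := by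
        rw [← Finset.mul_sum, ← Finset.mul_sum, lintegral_biUnion_finset]
        · intro a ha b hb hab
          exact (hdisj (hufin.mem_toFinset.mp ha) (hufin.mem_toFinset.mp hb) hab).mono
            Set.inter_subset_left Set.inter_subset_left
        · exact fun b _ => measurableSet_closedBall.inter hset
    _ ≤ _ := by
        gcongr
        exact Set.iUnion₂_subset fun b _ => Set.inter_subset_right

theorem measurable_finset_sup_nnreal {α ι : Type*} [MeasurableSpace α] (I : Finset ι)
    (f : ι → α → NNReal) (hf : ∀ i, Measurable (f i)) :
    Measurable fun x => I.sup fun i => f i x := by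
  classical
  induction I using Finset.induction_on with
  | empty => simp
  | insert i I _ ih =>
    simp only [Finset.sup_insert]
    exact (hf i).sup ih

theorem lintegral_sup_average_rpow_le {p : ℝ} (hp : 1 < p) {ι : Type*} (I : Finset ι)
    (z : ι → 𝔼) (r : ι → ℝ) (W : ι → Set 𝔼) (hWm : ∀ i, MeasurableSet (W i))
    (hW : ∀ i, W i ⊆ Metric.closedBall (z i) (r i)) {g : 𝔼 → ℝ} (hg : Measurable g)
    (hg0 : ∀ x, 0 ≤ g x) (av : ι → NNReal)
    (hav : ∀ i, av i * volume (Metric.closedBall (z i) (r i)) =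
      ∫⁻ x in Metric.closedBall (z i) (r i), ENNReal.ofReal (g x)) :
    ∫⁻ x, ((I.sup fun i => (W i).indicator (fun _ => av i) x : NNReal) : ℝ≥0∞) ^ p ≤
      ENNReal.ofReal (4 ^ d * 2) * ENNReal.ofReal (p / (p - 1) * (1 / 2) ^ (1 - p)) *
        ∫⁻ x, ENNReal.ofReal (g x ^ p) := by
  classical
  have hm := measurable_finset_sup_nnreal I (fun i => (W i).indicator (fun _ => av i))
    (fun i => measurable_const.indicator (hWm i))
  have := lintegral_rpow_le_of_weak_type (volume : Measure 𝔼) (volume : Measure 𝔼) (p := p)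
    (q := 1) (c := 1 / 2) hp one_pos (by norm_num) (ENNReal.ofReal (4 ^ d * 2)) hg hg0
    (F := fun x => ((I.sup fun i => (W i).indicator (fun _ => av i) x : NNReal) : ℝ))
    (hm.coe_nnreal_real.aemeasurable) (fun _ => NNReal.coe_nonneg _) ?_
  · refine le_trans (le_of_eq (lintegral_congr fun x => ?_)) this
    rw [← ENNReal.ofReal_rpow_of_nonneg (NNReal.coe_nonneg _) (by linarith), ENNReal.ofReal_coe_nnreal]
  · intro s hs
    have h1 : {y | s < ((I.sup fun i => (W i).indicator (fun _ => av i) y : NNReal) : ℝ)} ⊆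
        ⋃ i ∈ I.filter (fun i => s < av i), Metric.closedBall (z i) (r i) := by
      intro y hy
      have hy : s < ((I.sup fun i => (W i).indicator (fun _ => av i) y : NNReal) : ℝ) := hy
      lift s to NNReal using hs.le
      rw [NNReal.coe_lt_coe, Finset.lt_sup_iff] at hy
      obtain ⟨i, hi, hlt⟩ := hy
      by_cases hyi : y ∈ W i
      · rw [Set.indicator_of_mem hyi] at hlt
        exact Set.mem_biUnion (show i ∈ I.filter _ by simpa using ⟨hi, hlt⟩) (hW i hyi)
      · rw [Set.indicator_of_notMem hyi] at hlt
        exact absurd hlt (not_lt.mpr zero_le)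
    refine (measure_mono h1).trans ((volume_biUnion_le_of_average_gt _ z r hg hs ?_).trans ?_)
    · intro i hi
      rw [← hav i]
      gcongr
      rw [← ENNReal.ofReal_coe_nnreal]
      exact ENNReal.ofReal_le_ofReal (Finset.mem_filter.mp hi).2.le
    · rw [← mul_assoc, ← ENNReal.ofReal_mul (by positivity), ← ENNReal.ofReal_mul (by positivity)]
      simp only [Real.rpow_one]
      rw [Real.rpow_neg_one, mul_assoc]

theorem rpow_setLIntegral_le {α : Type*} [MeasurableSpace α] (μ : Measure α) {p : ℝ}
    (hp : 1 < p) (s : Set α) {h : α → ℝ≥0∞} (hh : AEMeasurable h μ) :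
    (∫⁻ a in s, h a ∂μ) ^ p ≤ (μ s) ^ (p - 1) * ∫⁻ a in s, h a ^ p ∂μ := by
  simpa using rpow_lintegral_mul_le (μ.restrict s) hp (k := fun _ => 1) (h := h)
    aemeasurable_const hh.restrict

theorem ENNReal.le_rpow_of_le_mul_rpow {X Y : ℝ≥0∞} {p : ℝ} (hp : 1 < p) (hX : X ≠ ∞)
    (h : X ≤ Y * X ^ (1 - 1 / p)) : X ≤ Y ^ p := by
  have hp0 : 0 < p := by linarith
  rcases eq_or_ne X 0 with rfl | h0
  · simp
  have h1 : X = X ^ (1 / p) * X ^ (1 - 1 / p) := by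
    rw [← ENNReal.rpow_add _ _ h0 hX]; simp
  have h2 : X ^ (1 / p) ≤ Y := by
    have hne : X ^ (1 - 1 / p) ≠ 0 := by simp [ENNReal.rpow_eq_zero_iff, h0, hX]
    have hnt : X ^ (1 - 1 / p) ≠ ∞ := by simp [ENNReal.rpow_eq_top_iff, h0, hX]
    refine (ENNReal.mul_le_mul_iff_left hne hnt).mp ?_
    rw [← h1]; exact h
  calc X = (X ^ (1 / p)) ^ p := by rw [← ENNReal.rpow_mul, one_div_mul_cancel hp0.ne', ENNReal.rpow_one]
    _ ≤ _ := by gcongr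

theorem lintegral_mul_le_sqrt {α : Type*} [MeasurableSpace α] (μ : Measure α)
    {f g : α → ℝ≥0∞} (hf : AEMeasurable f μ) (hg : AEMeasurable g μ) :
    ∫⁻ a, f a * g a ∂μ ≤
      (∫⁻ a, f a ^ (2 : ℝ) ∂μ) ^ (1 / 2 : ℝ) * (∫⁻ a, g a ^ (2 : ℝ) ∂μ) ^ (1 / 2 : ℝ) :=
  ENNReal.lintegral_mul_le_Lp_mul_Lq μ Real.HolderConjugate.two_two hf hg

/-- Square-integrable functions concentrated on dilated balls add up in `L^p`, `p < 2`, as well as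
the characteristic functions of the balls themselves. -/
theorem lintegral_sum_indicator_rpow_le {p : ℝ} (hp : 1 < p) (hp2 : p < 2) (Λ : NNReal) :
    ∃ C : NNReal, ∀ {ι : Type} (I : Finset ι)
      (z : ι → 𝔼) (r : ι → ℝ) (_ : ∀ i, 0 < r i) (W : ι → Set 𝔼) (_ : ∀ i, MeasurableSet (W i))
      (_ : ∀ i, W i ⊆ Metric.closedBall (z i) (r i))
      (_ : ∀ i, volume (Metric.closedBall (z i) (r i)) ≤ Λ * volume (W i))
      (c : ι → NNReal) (F : ι → 𝔼 → ℝ≥0∞) (_ : ∀ i, Measurable (F i)) (D : NNReal)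
      (_ : ∀ i, ∫⁻ x, F i x ^ (2 : ℝ) ≤ (D * c i) ^ (2 : ℝ) * volume (W i)),
      ∫⁻ x, (∑ i ∈ I, (Metric.closedBall (z i) (r i)).indicator (F i) x) ^ p ≤
        (C * D) ^ p * ∫⁻ x, (∑ i ∈ I, (W i).indicator (fun _ => (c i : ℝ≥0∞)) x) ^ p := by
  have hp0 : 0 < p := by linarith
  have hp1 : 0 < p - 1 := by linarith
  set q : ℝ := p / (2 * (p - 1)) with hq
  have hq1 : 1 < q := by rw [hq, one_lt_div (by linarith)]; linarith
  set CM : ℝ≥0∞ := ENNReal.ofReal (4 ^ d * 2) *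
    ENNReal.ofReal (q / (q - 1) * (1 / 2) ^ (1 - q)) with hCM
  have hCMt : CM ≠ ∞ := ENNReal.mul_ne_top ENNReal.ofReal_ne_top ENNReal.ofReal_ne_top
  set C' : ℝ≥0∞ := (Λ : ℝ≥0∞) ^ (1 / 2 : ℝ) * CM ^ (1 - 1 / p) with hC'
  have h1p : 0 < 1 - 1 / p := by
    rw [sub_pos, div_lt_one hp0]; exact hp
  have hC't : C' ≠ ∞ := ENNReal.mul_ne_top (ENNReal.rpow_ne_top_of_nonneg (by norm_num) (by simp))
    (ENNReal.rpow_ne_top_of_nonneg h1p.le hCMt)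
  refine ⟨C'.toNNReal, ?_⟩
  intro ι I z r hr W hWm hW hΛ c F hF D hFD
  rw [ENNReal.coe_toNNReal hC't]
  set B : ι → Set 𝔼 := fun i => Metric.closedBall (z i) (r i) with hB
  have hBm : ∀ i, MeasurableSet (B i) := fun i => measurableSet_closedBall
  have hBfin : ∀ i, volume (B i) ≠ ∞ := fun i => measure_closedBall_lt_top.ne
  have hBpos : ∀ i, volume (B i) ≠ 0 := fun i => (Metric.measure_closedBall_pos _ _ (hr i)).ne'
  have hWfin : ∀ i, volume (W i) ≠ ∞ := fun i => ((measure_mono (hW i)).trans_lt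
    measure_closedBall_lt_top).ne
  set S : 𝔼 → ℝ≥0∞ := fun x => ∑ i ∈ I, (B i).indicator (F i) x with hS
  have hSm : Measurable S := Finset.measurable_fun_sum _ fun i _ => (hF i).indicator (hBm i)
  set X := ∫⁻ x, S x ^ p with hX
  have hXfin : X ≠ ∞ := by
    have h1 : ∀ x, S x ^ p ≤ (I.card : ℝ≥0∞) ^ (p - 1) * ∑ i ∈ I, ((B i).indicator (F i) x) ^ p :=
      fun x => ENNReal.rpow_sum_le_const_mul_sum_rpow _ _ hp.le
    have h2 : ∀ i, ∫⁻ x, ((B i).indicator (F i) x) ^ p ≠ ∞ := by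
      intro i
      have e : ∀ x, ((B i).indicator (F i) x) ^ p = (B i).indicator (fun x => F i x ^ p) x := by
        intro x
        by_cases hx : x ∈ B i <;> simp [hx, hp0]
      simp only [e]
      rw [lintegral_indicator (hBm i)]
      have h3 := rpow_setLIntegral_le volume (p := 2 / p)
        ((one_lt_div hp0).mpr hp2) (B i) (h := fun x => F i x ^ p)
        ((hF i).pow_const _).aemeasurable
      simp only [← ENNReal.rpow_mul, mul_div_cancel₀ 2 hp0.ne'] at h3
      intro htop
      rw [htop, ENNReal.top_rpow_of_pos (by positivity)] at h3
      refine absurd (top_le_iff.mp h3) (ENNReal.mul_ne_top ?_ ?_)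
      · exact ENNReal.rpow_ne_top_of_nonneg (by
          rw [sub_nonneg]; exact ((one_lt_div hp0).mpr hp2).le) (hBfin i)
      · refine ((setLIntegral_le_lintegral _ _).trans (hFD i)).trans_lt ?_ |>.ne
        refine ENNReal.mul_lt_top (ENNReal.rpow_lt_top_of_nonneg (by norm_num) ?_) (hWfin i).lt_top
        exact ENNReal.mul_ne_top (by simp) (by simp)
    refine ((lintegral_mono h1).trans_lt ?_).ne
    rw [lintegral_const_mul _ (Finset.measurable_fun_sum _ fun i _ =>
      ((hF i).indicator (hBm i)).pow_const _), lintegral_finsetSum _ fun i _ =>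
      ((hF i).indicator (hBm i)).pow_const _]
    refine ENNReal.mul_lt_top (ENNReal.rpow_lt_top_of_nonneg hp1.le (by simp)) ?_
    exact ENNReal.sum_lt_top.mpr fun i _ => (h2 i).lt_top
  set g : 𝔼 → ℝ := fun x => (S x ^ (2 * (p - 1))).toReal with hg
  have hgm : Measurable g := (hSm.pow_const _).ennreal_toReal
  have hSfin : ∀ᵐ x, S x < ∞ := by
    have := ae_lt_top (hSm.pow_const p) hXfin
    filter_upwards [this] with x hx
    by_contra h
    rw [not_lt_top_iff.mp h, ENNReal.top_rpow_of_pos hp0] at hx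
    exact lt_irrefl _ hx
  have hgS : ∀ᵐ x, ENNReal.ofReal (g x) = S x ^ (2 * (p - 1)) := by
    filter_upwards [hSfin] with x hx
    exact ENNReal.ofReal_toReal (ENNReal.rpow_ne_top_of_nonneg (by linarith) hx.ne)
  have hgq : ∫⁻ x, ENNReal.ofReal (g x ^ q) = X := by
    refine lintegral_congr_ae ?_
    filter_upwards [hgS] with x hx
    rw [← ENNReal.ofReal_rpow_of_nonneg ENNReal.toReal_nonneg (by linarith), hx,
      ← ENNReal.rpow_mul]
    congr 1; rw [hq]; field_simp
  have hgB : ∀ i, ∫⁻ x in B i, ENNReal.ofReal (g x) ≠ ∞ := by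
    intro i
    have h3 := rpow_setLIntegral_le volume hq1 (B i) (h := fun x => ENNReal.ofReal (g x))
      hgm.ennreal_ofReal.aemeasurable
    intro htop
    rw [htop, ENNReal.top_rpow_of_pos (by linarith)] at h3
    refine absurd (top_le_iff.mp h3) (ENNReal.mul_ne_top ?_ ?_)
    · exact ENNReal.rpow_ne_top_of_nonneg (by linarith) (hBfin i)
    · refine ((setLIntegral_le_lintegral _ _).trans (le_of_eq ?_)).trans_lt hXfin.lt_top |>.ne
      rw [← hgq]
      exact lintegral_congr fun x =>
        ENNReal.ofReal_rpow_of_nonneg ENNReal.toReal_nonneg (by linarith)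
  set av : ι → NNReal := fun i => ((∫⁻ x in B i, ENNReal.ofReal (g x)) / volume (B i)).toNNReal
    with hav
  have hav' : ∀ i, av i * volume (B i) = ∫⁻ x in B i, ENNReal.ofReal (g x) := by
    intro i
    rw [hav, ENNReal.coe_toNNReal (ENNReal.div_ne_top (hgB i) (hBpos i)),
      ENNReal.div_mul_cancel (hBpos i) (hBfin i)]
  have hmax := lintegral_sup_average_rpow_le hq1 I z r W hWm hW hgm
    (fun x => ENNReal.toReal_nonneg) av hav'
  rw [hgq, ← hCM] at hmax
  set M : 𝔼 → NNReal := fun x => I.sup fun i => (W i).indicator (fun _ => av i) x with hM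
  have hMm : Measurable M := measurable_finset_sup_nnreal I (fun i => (W i).indicator (fun _ => av i))
    (fun i => measurable_const.indicator (hWm i))
  set H : 𝔼 → ℝ≥0∞ := fun x => ∑ i ∈ I, (W i).indicator (fun _ => (c i : ℝ≥0∞)) x with hH
  have hHm : Measurable H := Finset.measurable_fun_sum _ fun i _ =>
    measurable_const.indicator (hWm i)
  have hterm : ∀ i ∈ I, ∫⁻ x, (B i).indicator (F i) x * S x ^ (p - 1) ≤
      D * (Λ : ℝ≥0∞) ^ (1 / 2 : ℝ) * ∫⁻ x, (W i).indicator (fun _ => (c i : ℝ≥0∞)) x *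
        (M x : ℝ≥0∞) ^ (1 / 2 : ℝ) := by
    intro i hi
    calc ∫⁻ x, (B i).indicator (F i) x * S x ^ (p - 1)
        = ∫⁻ x in B i, F i x * S x ^ (p - 1) := by
          rw [← lintegral_indicator (hBm i)]
          refine lintegral_congr fun x => ?_
          by_cases hx : x ∈ B i <;> simp [hx]
      _ ≤ (∫⁻ x in B i, F i x ^ (2 : ℝ)) ^ (1 / 2 : ℝ) *
          (∫⁻ x in B i, (S x ^ (p - 1)) ^ (2 : ℝ)) ^ (1 / 2 : ℝ) :=
          lintegral_mul_le_sqrt _ (hF i).aemeasurable (hSm.pow_const _).aemeasurable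
      _ ≤ ((D * c i) ^ (2 : ℝ) * volume (W i)) ^ (1 / 2 : ℝ) *
          (av i * (Λ * volume (W i))) ^ (1 / 2 : ℝ) := by
          gcongr
          · exact (setLIntegral_le_lintegral _ _).trans (hFD i)
          · have : ∫⁻ x in B i, (S x ^ (p - 1)) ^ (2 : ℝ) = av i * volume (B i) := by
              rw [hav']
              refine lintegral_congr_ae (ae_restrict_of_ae ?_)
              filter_upwards [hgS] with x hx
              rw [hx, ← ENNReal.rpow_mul, mul_comm]
            rw [this]
            gcongr
            exact hΛ i
      _ = D * (Λ : ℝ≥0∞) ^ (1 / 2 : ℝ) * (c i * (av i : ℝ≥0∞) ^ (1 / 2 : ℝ) * volume (W i)) := by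
          have e : volume (W i) = volume (W i) ^ (1 / 2 : ℝ) * volume (W i) ^ (1 / 2 : ℝ) := by
            rw [← ENNReal.rpow_add_of_nonneg _ _ (by norm_num) (by norm_num)]; norm_num
          simp only [ENNReal.mul_rpow_of_nonneg _ _ (by norm_num : (0:ℝ) ≤ 1 / 2)]
          simp only [← ENNReal.rpow_mul, show (2:ℝ) * (1 / 2) = 1 by norm_num, ENNReal.rpow_one]
          conv_rhs => rw [e]
          ring
      _ = D * (Λ : ℝ≥0∞) ^ (1 / 2 : ℝ) * ∫⁻ x in W i, c i * (av i : ℝ≥0∞) ^ (1 / 2 : ℝ) := by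
          rw [setLIntegral_const]
      _ ≤ _ := by
          refine mul_le_mul' le_rfl ?_
          rw [← lintegral_indicator (hWm i)]
          refine lintegral_mono fun x => ?_
          by_cases hx : x ∈ W i
          · simp only [Set.indicator_of_mem hx]
            gcongr
            have := Finset.le_sup (f := fun i => (W i).indicator (fun _ => av i) x) hi
            simpa only [Set.indicator_of_mem hx] using this
          · simp [hx]
  refine (ENNReal.le_rpow_of_le_mul_rpow hp hXfin (Y := C' * D * (∫⁻ x, H x ^ p) ^ (1 / p))
    ?_).trans (le_of_eq ?_)
  · have hconj : p.HolderConjugate (p / (p - 1)) := Real.HolderConjugate.conjExponent hp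
    calc X = ∫⁻ x, ∑ i ∈ I, (B i).indicator (F i) x * S x ^ (p - 1) := by
          refine lintegral_congr fun x => ?_
          rw [← Finset.sum_mul]
          conv_lhs => rw [show p = 1 + (p - 1) by ring,
            ENNReal.rpow_add_of_nonneg _ _ zero_le_one hp1.le, ENNReal.rpow_one]
      _ = ∑ i ∈ I, ∫⁻ x, (B i).indicator (F i) x * S x ^ (p - 1) :=
          lintegral_finsetSum _ fun i _ => ((hF i).indicator (hBm i)).mul (hSm.pow_const _)
      _ ≤ ∑ i ∈ I, D * (Λ : ℝ≥0∞) ^ (1 / 2 : ℝ) *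
          ∫⁻ x, (W i).indicator (fun _ => (c i : ℝ≥0∞)) x * (M x : ℝ≥0∞) ^ (1 / 2 : ℝ) :=
          Finset.sum_le_sum hterm
      _ = D * (Λ : ℝ≥0∞) ^ (1 / 2 : ℝ) * ∫⁻ x, H x * (M x : ℝ≥0∞) ^ (1 / 2 : ℝ) := by
          have hsum := lintegral_finsetSum (μ := volume) I (f := fun i x =>
            (W i).indicator (fun _ => (c i : ℝ≥0∞)) x * (M x : ℝ≥0∞) ^ (1 / 2 : ℝ)) fun i _ =>
            (measurable_const.indicator (hWm i)).mul (hMm.coe_nnreal_ennreal.pow_const _)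
          rw [← Finset.mul_sum, ← hsum]
          simp only [← Finset.sum_mul, hH]
      _ ≤ D * (Λ : ℝ≥0∞) ^ (1 / 2 : ℝ) * ((∫⁻ x, H x ^ p) ^ (1 / p) *
          (∫⁻ x, ((M x : ℝ≥0∞) ^ (1 / 2 : ℝ)) ^ (p / (p - 1))) ^ (1 / (p / (p - 1)))) := by
          gcongr
          exact ENNReal.lintegral_mul_le_Lp_mul_Lq volume hconj hHm.aemeasurable
            (hMm.coe_nnreal_ennreal.pow_const _).aemeasurable
      _ ≤ D * (Λ : ℝ≥0∞) ^ (1 / 2 : ℝ) * ((∫⁻ x, H x ^ p) ^ (1 / p) *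
          (CM * X) ^ (1 - 1 / p)) := by
          have e1 : (1 / 2 : ℝ) * (p / (p - 1)) = q := by rw [hq]; field_simp
          have e2 : 1 / (p / (p - 1)) = 1 - 1 / p := by field_simp
          simp only [← ENNReal.rpow_mul, e1, e2]
          gcongr
      _ = _ := by
          rw [ENNReal.mul_rpow_of_nonneg _ _ h1p.le, hC']; ring
  · rw [ENNReal.mul_rpow_of_nonneg _ _ hp0.le, ← ENNReal.rpow_mul, one_div_mul_cancel hp0.ne',
      ENNReal.rpow_one]

end

section

/-- The `L¹`-normalised dilation of a kernel. -/
def dil (s : ℝ) (K : EuclideanSpace ℝ (Fin d) → ℂ) (z : EuclideanSpace ℝ (Fin d)) : ℂ :=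
  (((s ^ d)⁻¹ : ℝ) : ℂ) * K (s⁻¹ • z)

/-- The convolution of a kernel with a function. -/
def cv (K f : EuclideanSpace ℝ (Fin d) → ℂ) (x : EuclideanSpace ℝ (Fin d)) : ℂ :=
  ∫ y, K (x - y) * f y

/-- Bounded measurable integrable functions. -/
structure Nice (f : EuclideanSpace ℝ (Fin d) → ℂ) : Prop where
  meas : Measurable f
  int : Integrable f
  bdd : ∃ C : ℝ, ∀ x, ‖f x‖ ≤ C

/-- Bounded continuous integrable functions. -/
structure NiceKer (K : EuclideanSpace ℝ (Fin d) → ℂ) : Prop where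
  cont : Continuous K
  int : Integrable K
  bdd : ∃ C : ℝ, ∀ x, ‖K x‖ ≤ C

variable {K L f g : EuclideanSpace ℝ (Fin d) → ℂ} {s : ℝ}

theorem NiceKer.nice (hK : NiceKer K) : Nice K := ⟨hK.cont.measurable, hK.int, hK.bdd⟩

theorem SchwartzMap.niceKer (f : SchwartzMap 𝔼 ℂ) : NiceKer (f : 𝔼 → ℂ) :=
  ⟨f.continuous, f.integrable, ‖f.toBoundedContinuousFunction‖,
    fun x => f.toBoundedContinuousFunction.norm_coe_le_norm x⟩

theorem NiceKer.dil (hK : NiceKer K) (hs : 0 < s) : NiceKer (dil s K) := by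
  obtain ⟨C, hC⟩ := hK.bdd
  refine ⟨?_, ?_, (s ^ d)⁻¹ * C, fun x => ?_⟩
  · exact continuous_const.mul (hK.cont.comp (continuous_const_smul _))
  · exact ((integrable_comp_smul_iff volume K (inv_ne_zero hs.ne')).mpr hK.int).const_mul _
  · rw [_root_.dil, norm_mul, Complex.norm_real, Real.norm_of_nonneg (by positivity)]
    exact mul_le_mul_of_nonneg_left (hC _) (by positivity)

theorem NiceKer.integrable_mul (hK : NiceKer K) (hf : Integrable f) (x : 𝔼) :
    Integrable fun y => K (x - y) * f y := by
  obtain ⟨C, hC⟩ := hK.bdd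
  exact hf.bdd_mul (hK.cont.comp (by fun_prop)).aestronglyMeasurable
    (Filter.Eventually.of_forall fun y => hC (x - y))

theorem NiceKer.continuous_cv (hK : NiceKer K) (hf : Integrable f) : Continuous (cv K f) := by
  obtain ⟨C, hC⟩ := hK.bdd
  refine continuous_of_dominated (bound := fun y => C * ‖f y‖)
    (fun x => (hK.integrable_mul hf x).aestronglyMeasurable) (fun x => ?_) (hf.norm.const_mul C)
    (Filter.Eventually.of_forall fun y => ?_)
  · exact Filter.Eventually.of_forall fun y => by
      rw [norm_mul]; exact mul_le_mul_of_nonneg_right (hC _) (norm_nonneg _)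
  · exact (hK.cont.comp (by fun_prop)).mul continuous_const

theorem cv_eq_convolution (K f : 𝔼 → ℂ) :
    cv K f = MeasureTheory.convolution f K (ContinuousLinearMap.mul ℂ ℂ) volume := by
  ext x
  simp [cv, MeasureTheory.convolution, mul_comm]

theorem cv_comm (K f : 𝔼 → ℂ) : cv K f = cv f K := by
  ext x
  rw [cv, cv, ← integral_sub_left_eq_self _ _ x]
  simp [mul_comm]

theorem NiceKer.integrable_cv (hK : NiceKer K) (hf : Integrable f) : Integrable (cv K f) := by
  rw [cv_eq_convolution]
  exact hf.integrable_convolution _ hK.int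

theorem NiceKer.cv (hK : NiceKer K) (hf : Integrable f) : NiceKer (cv K f) := by
  obtain ⟨C, hC⟩ := hK.bdd
  refine ⟨hK.continuous_cv hf, hK.integrable_cv hf, ∫ y, C * ‖f y‖, fun x => ?_⟩
  refine norm_integral_le_of_norm_le (hf.norm.const_mul C) (Filter.Eventually.of_forall fun y => ?_)
  rw [norm_mul]; exact mul_le_mul_of_nonneg_right (hC _) (norm_nonneg _)

theorem NiceKer.cv_sub (hK : NiceKer K) (hf : Integrable f) (hg : Integrable g) (x : 𝔼) :
    _root_.cv K (fun y => f y - g y) x = _root_.cv K f x - _root_.cv K g x := by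
  simp only [_root_.cv, mul_sub]
  exact integral_sub (hK.integrable_mul hf x) (hK.integrable_mul hg x)

theorem NiceKer.cv_finset_sum {ι : Type*} (hK : NiceKer K) (I : Finset ι) {F : ι → 𝔼 → ℂ}
    (hF : ∀ i ∈ I, Integrable (F i)) (x : 𝔼) :
    _root_.cv K (fun y => ∑ i ∈ I, F i y) x = ∑ i ∈ I, _root_.cv K (F i) x := by
  simp only [_root_.cv, Finset.mul_sum]
  exact integral_finsetSum _ fun i hi => hK.integrable_mul (hF i hi) x

theorem enorm_cv_le (K f : 𝔼 → ℂ) (x : 𝔼) :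
    ‖cv K f x‖ₑ ≤ ∫⁻ y, ‖K (x - y)‖ₑ * ‖f y‖ₑ := by
  refine (enorm_integral_le_lintegral_enorm _).trans (le_of_eq ?_)
  simp only [enorm_mul]

theorem NiceKer.lintegral_cv_rpow_le {p : ℝ} (hp : 1 < p) (hK : NiceKer K)
    (hf : AEMeasurable f) :
    ∫⁻ x, ‖_root_.cv K f x‖ₑ ^ p ≤ (∫⁻ z, ‖K z‖ₑ) ^ p * ∫⁻ y, ‖f y‖ₑ ^ p := by
  refine le_trans (lintegral_mono fun x => ?_)
    (lintegral_young (μ := volume) hp hK.cont.measurable.enorm hf.enorm)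
  gcongr
  exact enorm_cv_le K f x

theorem NiceKer.cv_assoc (hK : NiceKer K) (hL : NiceKer L) (hf : Integrable f) :
    _root_.cv K (_root_.cv L f) = _root_.cv (_root_.cv K L) f := by
  ext x
  simp only [_root_.cv]
  obtain ⟨C, hC⟩ := hK.bdd
  have hint : Integrable (Function.uncurry fun y z : 𝔼 => K (x - y) * (L (y - z) * f z))
      (volume.prod volume) := by
    have h1 : Integrable (fun q : 𝔼 × 𝔼 => f q.2 * L (q.1 - q.2)) (volume.prod volume) :=
      hf.convolution_integrand (ContinuousLinearMap.mul ℂ ℂ) hL.int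
    refine Integrable.bdd_mul (c := C) (f := fun q : 𝔼 × 𝔼 => K (x - q.1))
      (g := fun q : 𝔼 × 𝔼 => L (q.1 - q.2) * f q.2) ?_ ?_
      (Filter.Eventually.of_forall fun q => hC _)
    · simpa only [mul_comm] using h1
    · exact (hK.cont.comp (by fun_prop)).aestronglyMeasurable
  calc ∫ y, K (x - y) * ∫ z, L (y - z) * f z
      = ∫ y, ∫ z, K (x - y) * (L (y - z) * f z) := by simp only [integral_const_mul]
    _ = ∫ z, ∫ y, K (x - y) * (L (y - z) * f z) := integral_integral_swap hint
    _ = _ := by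
      refine integral_congr_ae (Filter.Eventually.of_forall fun z => ?_)
      simp only [← mul_assoc, integral_mul_const]
      congr 1
      rw [← integral_sub_right_eq_self (fun y => K (x - z - y) * L y) z]
      simp

theorem lintegral_dil (hs : 0 < s) {u : 𝔼 → ℝ≥0∞} :
    ∫⁻ z, ENNReal.ofReal ((s ^ d)⁻¹) * u (s⁻¹ • z) = ∫⁻ z, u z := by
  have h := Measure.map_addHaar_smul (volume : Measure 𝔼) (inv_ne_zero hs.ne')
  rw [lintegral_const_mul' _ _ ENNReal.ofReal_ne_top]
  have e : ∫⁻ z, u (s⁻¹ • z) = ∫⁻ z, u z ∂(Measure.map (fun z : 𝔼 => s⁻¹ • z) volume) :=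
    (lintegral_map_equiv u (Homeomorph.smulOfNeZero s⁻¹ (inv_ne_zero hs.ne')).toMeasurableEquiv).symm
  rw [e, h, lintegral_smul_measure, finrank_euclideanSpace_fin, smul_eq_mul, ← mul_assoc,
    ← ENNReal.ofReal_mul (by positivity), inv_pow, inv_inv, abs_of_pos (by positivity),
    inv_mul_cancel₀ (by positivity), ENNReal.ofReal_one, one_mul]

theorem enorm_dil (hs : 0 < s) (K : 𝔼 → ℂ) (z : 𝔼) :
    ‖dil s K z‖ₑ = ENNReal.ofReal ((s ^ d)⁻¹) * ‖K (s⁻¹ • z)‖ₑ := by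
  rw [dil, enorm_mul, ← ofReal_norm, Complex.norm_real, Real.norm_of_nonneg (by positivity)]

theorem lintegral_enorm_dil_tail (hs : 0 < s) (K : 𝔼 → ℂ) (r : ℝ) :
    ∫⁻ z in {z | r < ‖z‖}, ‖dil s K z‖ₑ = ∫⁻ z in {z | r / s < ‖z‖}, ‖K z‖ₑ := by
  have hm : ∀ r : ℝ, MeasurableSet {z : 𝔼 | r < ‖z‖} := fun r =>
    measurableSet_lt measurable_const measurable_norm
  rw [← lintegral_indicator (hm _), ← lintegral_indicator (hm _),
    ← lintegral_dil hs (u := ({z : 𝔼 | r / s < ‖z‖}).indicator fun z => ‖K z‖ₑ)]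
  refine lintegral_congr fun z => ?_
  have e : r / s < ‖s⁻¹ • z‖ ↔ r < ‖z‖ := by
    rw [norm_smul, Real.norm_of_nonneg (by positivity), div_eq_inv_mul]
    exact mul_lt_mul_iff_right₀ (by positivity)
  by_cases hz : r < ‖z‖
  · simp only [Set.indicator, Set.mem_ofPred_eq, e, hz, if_true, enorm_dil hs]
  · simp only [Set.indicator, Set.mem_ofPred_eq, e, hz, if_false, mul_zero]

theorem lintegral_enorm_dil (hs : 0 < s) (K : 𝔼 → ℂ) :
    ∫⁻ z, ‖dil s K z‖ₑ = ∫⁻ z, ‖K z‖ₑ := by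
  simp only [enorm_dil hs]
  exact lintegral_dil hs (u := fun z => ‖K z‖ₑ)

theorem integral_comp_inv_smul (hs : 0 < s) (u : 𝔼 → ℂ) :
    ∫ y, u y = ((s ^ d : ℝ) : ℂ) * ∫ y, u (s • y) := by
  rw [Measure.integral_comp_smul, finrank_euclideanSpace_fin, abs_of_pos (by positivity),
    Complex.real_smul, ← mul_assoc, ← Complex.ofReal_mul, mul_inv_cancel₀ (by positivity)]
  simp

theorem cv_dil (hs : 0 < s) (K f : 𝔼 → ℂ) (x : 𝔼) :
    cv (dil s K) f x = cv K (fun y => f (s • y)) (s⁻¹ • x) := by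
  rw [cv, cv, integral_comp_inv_smul hs, ← integral_const_mul]
  refine integral_congr_ae (Filter.Eventually.of_forall fun y => ?_)
  simp only [dil, smul_sub, smul_smul, inv_mul_cancel₀ hs.ne', one_smul]
  rw [← mul_assoc, ← mul_assoc, ← Complex.ofReal_mul, mul_inv_cancel₀ (by positivity)]
  simp

/-- A bound for `cv K` on `L^p` yields the same bound for all dilations. -/
theorem lintegral_cv_dil_rpow_le {p : ℝ} {a : ℝ≥0∞}
    (h : ∀ f : 𝔼 → ℂ, Nice f → ∫⁻ x, ‖cv K f x‖ₑ ^ p ≤ a * ∫⁻ x, ‖f x‖ₑ ^ p) (hs : 0 < s)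
    (hf : Nice f) : ∫⁻ x, ‖cv (dil s K) f x‖ₑ ^ p ≤ a * ∫⁻ x, ‖f x‖ₑ ^ p := by
  have hf' : Nice fun y => f (s • y) := by
    obtain ⟨C, hC⟩ := hf.bdd
    exact ⟨hf.meas.comp (measurable_const_smul s),
      (integrable_comp_smul_iff volume f hs.ne').mpr hf.int, C, fun x => hC _⟩
  have h1 := h _ hf'
  have e1 := lintegral_dil hs (u := fun x => ‖cv K (fun y => f (s • y)) x‖ₑ ^ p)
  have e2 := lintegral_dil hs (u := fun x => ‖f (s • x)‖ₑ ^ p)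
  simp only [smul_smul, mul_inv_cancel₀ hs.ne', one_smul] at e2
  have hne : ENNReal.ofReal ((s ^ d)⁻¹) ≠ 0 := by
    simp only [ne_eq, ENNReal.ofReal_eq_zero, not_le]; positivity
  rw [← e1, ← e2] at h1
  simp only [← cv_dil hs] at h1
  rw [lintegral_const_mul' _ _ ENNReal.ofReal_ne_top, lintegral_const_mul' _ _ ENNReal.ofReal_ne_top,
    mul_left_comm] at h1
  exact (ENNReal.mul_le_mul_iff_right hne ENNReal.ofReal_ne_top).mp h1

end

section

open FourierTransform in
/-- The dilation of a Schwartz kernel, as a Schwartz function. -/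
def dilS (s : ℝ) (hs : 0 < s) (K : SchwartzMap (EuclideanSpace ℝ (Fin d)) ℂ) :
    SchwartzMap (EuclideanSpace ℝ (Fin d)) ℂ :=
  (((s ^ d)⁻¹ : ℝ) : ℂ) • SchwartzMap.compCLMOfContinuousLinearEquiv ℂ
    (ContinuousLinearEquiv.smulLeft (Units.mk0 s⁻¹ (inv_ne_zero hs.ne'))) K

theorem coe_dilS {s : ℝ} (hs : 0 < s) (K : SchwartzMap 𝔼 ℂ) : ⇑(dilS s hs K) = dil s ⇑K := by
  ext x
  simp [dilS, dil, Units.smul_def]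

open FourierTransform in
theorem fourier_dil {s : ℝ} (hs : 0 < s) (K : 𝔼 → ℂ) (ξ : 𝔼) :
    𝓕 (dil s K) ξ = 𝓕 K (s • ξ) := by
  rw [Real.fourier_eq', Real.fourier_eq', integral_comp_inv_smul hs, ← integral_const_mul]
  refine integral_congr_ae (Filter.Eventually.of_forall fun y => ?_)
  simp only [dil, smul_smul, inv_mul_cancel₀ hs.ne', one_smul, smul_eq_mul, inner_smul_left,
    inner_smul_right]
  have h : ((s ^ d : ℝ) : ℂ) ≠ 0 := by exact_mod_cast (pow_pos hs d).ne'
  rw [Complex.ofReal_inv]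
  field_simp
  simp
  ring_nf

theorem tendsto_eLpNorm_of_tendsto_sub {α ι : Type*} [MeasurableSpace α] {μ : Measure α}
    {l : Filter ι} {q : ℝ≥0∞} (hq : 1 ≤ q) {u : ι → α → ℂ} {v : α → ℂ}
    (hu : ∀ i, AEStronglyMeasurable (u i) μ) (hv : AEStronglyMeasurable v μ)
    (h : Filter.Tendsto (fun i => eLpNorm (v - u i) q μ) l (nhds 0)) :
    Filter.Tendsto (fun i => eLpNorm (u i) q μ) l (nhds (eLpNorm v q μ)) := by
  have h1 : ∀ i, eLpNorm v q μ ≤ eLpNorm (u i) q μ + eLpNorm (v - u i) q μ := fun i => by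
    simpa using eLpNorm_add_le (hu i) (hv.sub (hu i)) hq
  have h2 : ∀ i, eLpNorm (u i) q μ ≤ eLpNorm v q μ + eLpNorm (v - u i) q μ := fun i => by
    have := eLpNorm_sub_le hv (hv.sub (hu i)) hq
    simpa using this
  refine tendsto_of_tendsto_of_tendsto_of_le_of_le (g := fun i => eLpNorm v q μ - eLpNorm (v - u i) q μ)
    (h := fun i => eLpNorm v q μ + eLpNorm (v - u i) q μ) ?_ ?_
    (fun i => tsub_le_iff_right.mpr (h1 i)) h2
  · simpa using ENNReal.Tendsto.sub tendsto_const_nhds h (Or.inr ENNReal.zero_ne_top)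
  · simpa using tendsto_const_nhds.add h

theorem Nice.lintegral_rpow_lt_top {f : 𝔼 → ℂ} (hf : Nice f) {p : ℝ} (hp : 1 ≤ p) :
    ∫⁻ x, ‖f x‖ₑ ^ p < ∞ := by
  obtain ⟨C, hC⟩ := hf.bdd
  have h : ∀ x, ‖f x‖ₑ ^ p ≤ ENNReal.ofReal C ^ (p - 1) * ‖f x‖ₑ := fun x => by
    conv_lhs => rw [show p = (p - 1) + 1 by ring,
      ENNReal.rpow_add_of_nonneg _ _ (by linarith) zero_le_one, ENNReal.rpow_one]
    have : ‖f x‖ₑ ≤ ENNReal.ofReal C := by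
      rw [← ofReal_norm]; exact ENNReal.ofReal_le_ofReal (hC x)
    exact mul_le_mul_left (ENNReal.rpow_le_rpow this (by linarith)) _
  refine (lintegral_mono h).trans_lt ?_
  have hC' : ENNReal.ofReal C ^ (p - 1) ≠ ∞ :=
    ENNReal.rpow_ne_top_of_nonneg (by linarith) ENNReal.ofReal_ne_top
  rw [lintegral_const_mul' _ _ hC']
  exact ENNReal.mul_lt_top hC'.lt_top hf.int.2

theorem Nice.memLp {f : 𝔼 → ℂ} (hf : Nice f) {p : ℝ} (hp : 1 ≤ p) :
    MemLp f (ENNReal.ofReal p) := by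
  refine ⟨hf.meas.aestronglyMeasurable, ?_⟩
  rw [eLpNorm_lt_top_iff_lintegral_rpow_enorm_lt_top (by simpa using by linarith)
    ENNReal.ofReal_ne_top, ENNReal.toReal_ofReal (by linarith)]
  exact hf.lintegral_rpow_lt_top hp

theorem eLpNorm_ofReal_rpow {α : Type*} [MeasurableSpace α] (μ : Measure α) {p : ℝ} (hp : 0 < p)
    (f : α → ℂ) : eLpNorm f (ENNReal.ofReal p) μ ^ p = ∫⁻ x, ‖f x‖ₑ ^ p ∂μ := by
  rw [eLpNorm_eq_lintegral_rpow_enorm_toReal (by simpa using hp) ENNReal.ofReal_ne_top,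
    ENNReal.toReal_ofReal hp.le, ← ENNReal.rpow_mul, one_div_mul_cancel hp.ne', ENNReal.rpow_one]

/-- Nice functions are approximated in `L^p` by Schwartz functions, simultaneously with all their
convolutions with nice kernels. -/
theorem Nice.exists_schwartz_approx {f : 𝔼 → ℂ} (hf : Nice f) {p : ℝ} (hp : 1 < p) :
    ∃ g : ℕ → SchwartzMap 𝔼 ℂ,
      Filter.Tendsto (fun n => ∫⁻ x, ‖g n x‖ₑ ^ p) Filter.atTop (nhds (∫⁻ x, ‖f x‖ₑ ^ p)) ∧
      ∀ K : 𝔼 → ℂ, NiceKer K → Filter.Tendsto (fun n => ∫⁻ x, ‖cv K (g n) x‖ₑ ^ p) Filter.atTop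
        (nhds (∫⁻ x, ‖cv K f x‖ₑ ^ p)) := by
  have hp0 : 0 < p := by linarith
  have hq : 1 ≤ ENNReal.ofReal p := by simpa using hp.le
  have hex : ∀ n : ℕ, ∃ g : SchwartzMap 𝔼 ℂ,
      eLpNorm (f - ⇑g) (ENNReal.ofReal p) ≤ ENNReal.ofReal (1 / ((n : ℝ) + 1)) := by
    intro n
    obtain ⟨g, hg₁, hg₂, hg₃⟩ := MemLp.exist_eLpNorm_sub_le ENNReal.ofReal_ne_top hq
      (hf.memLp hp.le) (ε := 1 / ((n : ℝ) + 1)) (by positivity)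
    exact ⟨hg₁.toSchwartzMap hg₂, hg₃⟩
  choose g hg using hex
  have h0 : Filter.Tendsto (fun n => eLpNorm (f - ⇑(g n)) (ENNReal.ofReal p)) Filter.atTop
      (nhds 0) := by
    refine tendsto_of_tendsto_of_tendsto_of_le_of_le tendsto_const_nhds ?_ (fun n => zero_le) hg
    simpa using ENNReal.tendsto_ofReal tendsto_one_div_add_atTop_nhds_zero_nat
  refine ⟨g, ?_, fun K hK => ?_⟩
  · have := tendsto_eLpNorm_of_tendsto_sub hq (fun n => (g n).continuous.aestronglyMeasurable)
      hf.meas.aestronglyMeasurable h0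
    simpa only [eLpNorm_ofReal_rpow _ hp0] using this.ennrpow_const p
  · have h1 : ∀ n, eLpNorm (cv K f - cv K (g n)) (ENNReal.ofReal p) ≤
        (∫⁻ z, ‖K z‖ₑ) * eLpNorm (f - ⇑(g n)) (ENNReal.ofReal p) := by
      intro n
      rw [← ENNReal.rpow_le_rpow_iff hp0, ENNReal.mul_rpow_of_nonneg _ _ hp0.le,
        eLpNorm_ofReal_rpow _ hp0, eLpNorm_ofReal_rpow _ hp0]
      have e : ∀ x, (cv K f - cv K (g n)) x = cv K (fun y => f y - g n y) x := fun x =>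
        (hK.cv_sub hf.int (g n).integrable x).symm
      simp only [e]
      exact hK.lintegral_cv_rpow_le hp (hf.meas.sub (g n).continuous.measurable).aemeasurable
    have h2 : Filter.Tendsto (fun n => eLpNorm (cv K f - cv K (g n)) (ENNReal.ofReal p))
        Filter.atTop (nhds 0) := by
      refine tendsto_of_tendsto_of_tendsto_of_le_of_le tendsto_const_nhds ?_ (fun n => zero_le) h1
      simpa using ENNReal.Tendsto.const_mul h0 (Or.inr hK.int.2.ne)
    have := tendsto_eLpNorm_of_tendsto_sub hq
      (fun n => (hK.continuous_cv (g n).integrable).aestronglyMeasurable)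
      (hK.continuous_cv hf.int).aestronglyMeasurable h2
    simpa only [eLpNorm_ofReal_rpow _ hp0] using this.ennrpow_const p

open FourierTransform in
theorem SchwartzMap.lintegral_norm_sq_fourier (f : SchwartzMap 𝔼 ℂ) :
    ∫⁻ ξ, ‖𝓕 f ξ‖ₑ ^ (2 : ℝ) = ∫⁻ x, ‖f x‖ₑ ^ (2 : ℝ) := by
  have key : ∀ g : SchwartzMap 𝔼 ℂ, ∫⁻ x, ‖g x‖ₑ ^ (2 : ℝ) = ENNReal.ofReal (∫ x, ‖g x‖ ^ 2) := by
    intro g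
    rw [ofReal_integral_eq_lintegral_ofReal]
    · refine lintegral_congr fun x => ?_
      rw [← ofReal_norm, ENNReal.ofReal_rpow_of_nonneg (norm_nonneg _) (by norm_num)]
      norm_num
    · exact (memLp_two_iff_integrable_sq_norm g.continuous.aestronglyMeasurable).mp (g.memLp 2)
    · exact Filter.Eventually.of_forall fun x => by positivity
  rw [key, key, SchwartzMap.integral_norm_sq_fourier]

open FourierTransform in
theorem SchwartzMap.exists_cv (K f : SchwartzMap 𝔼 ℂ) :
    ∃ g : SchwartzMap 𝔼 ℂ, ⇑g = cv K f ∧ ∀ ξ, 𝓕 g ξ = 𝓕 K ξ * 𝓕 f ξ := by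
  refine ⟨SchwartzMap.convolution (ContinuousLinearMap.mul ℂ ℂ) f K, ?_, fun ξ => ?_⟩
  · ext x
    rw [SchwartzMap.convolution_apply, cv_eq_convolution]
  · rw [SchwartzMap.fourier_convolution]
    simp [mul_comm]

open FourierTransform in
/-- Plancherel's theorem for a finite family of convolution operators. -/
theorem sum_lintegral_cv_sq_le {ι : Type*} (I : Finset ι) (K : ι → SchwartzMap 𝔼 ℂ) {a : ℝ≥0∞}
    (ha : a ≠ ∞) (hK : ∀ ξ, ∑ k ∈ I, ‖𝓕 (K k) ξ‖ₑ ^ (2 : ℝ) ≤ a) {f : 𝔼 → ℂ} (hf : Nice f) :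
    ∑ k ∈ I, ∫⁻ x, ‖cv (K k) f x‖ₑ ^ (2 : ℝ) ≤ a * ∫⁻ x, ‖f x‖ₑ ^ (2 : ℝ) := by
  have hS : ∀ g : SchwartzMap 𝔼 ℂ,
      ∑ k ∈ I, ∫⁻ x, ‖cv (K k) g x‖ₑ ^ (2 : ℝ) ≤ a * ∫⁻ x, ‖g x‖ₑ ^ (2 : ℝ) := by
    intro g
    have h1 : ∀ k, ∫⁻ x, ‖cv (K k) g x‖ₑ ^ (2 : ℝ) =
        ∫⁻ ξ, ‖𝓕 (K k) ξ‖ₑ ^ (2 : ℝ) * ‖𝓕 g ξ‖ₑ ^ (2 : ℝ) := by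
      intro k
      obtain ⟨G, hG, hG'⟩ := SchwartzMap.exists_cv (K k) g
      rw [← hG, ← SchwartzMap.lintegral_norm_sq_fourier]
      refine lintegral_congr fun ξ => ?_
      rw [hG', enorm_mul, ENNReal.mul_rpow_of_nonneg _ _ (by norm_num)]
    simp only [h1]
    rw [← lintegral_finsetSum]
    · simp only [← Finset.sum_mul]
      rw [← SchwartzMap.lintegral_norm_sq_fourier, ← lintegral_const_mul' _ _ ha]
      refine lintegral_mono fun ξ => ?_
      gcongr
      exact hK ξ
    · intro k _
      exact ((𝓕 (K k)).continuous.measurable.enorm.pow_const _).mul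
        ((𝓕 g).continuous.measurable.enorm.pow_const _)
  obtain ⟨g, hg, hg'⟩ := hf.exists_schwartz_approx (p := 2) (by norm_num)
  refine le_of_tendsto_of_tendsto' (tendsto_finsetSum I fun k _ => hg' _ (K k).niceKer)
    (ENNReal.Tendsto.const_mul hg (Or.inr ha)) fun n => hS (g n)

end

section

open FourierTransform in
theorem invFourierTd_eq (g : 𝔼 → ℂ) (x : 𝔼) :
    invFourierTd g x = 𝓕⁻ (fun η : 𝔼 => g ((2 * π) • η)) x := by
  rw [invFourierTd, Real.fourierInv_eq', integral_comp_inv_smul two_pi_pos, ← mul_assoc,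
    ← Complex.ofReal_mul, inv_mul_cancel₀ (by positivity), Complex.ofReal_one, one_mul]
  refine integral_congr_ae (Filter.Eventually.of_forall fun η => ?_)
  simp only [inner_smul_right, smul_eq_mul, real_inner_comm x η]
  congr 2
  push_cast
  ring

open FourierTransform in
theorem fourierTd_two_pi_smul (f : 𝔼 → ℂ) (η : 𝔼) : fourierTd f ((2 * π) • η) = 𝓕 f η := by
  rw [fourierTd, Real.fourier_eq']
  refine integral_congr_ae (Filter.Eventually.of_forall fun x => ?_)
  simp only [inner_smul_right, smul_eq_mul]
  congr 2
  push_cast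
  ring

theorem hasCompactSupport_of_annulus {m : 𝔼 → ℂ}
    (hm : Function.support m ⊆ {ξ : 𝔼 | 1 ≤ ‖ξ‖ ∧ ‖ξ‖ ≤ 2}) : HasCompactSupport m :=
  HasCompactSupport.of_support_subset_isCompact (isCompact_closedBall (0 : 𝔼) 2)
    fun ξ hξ => by simpa using (hm hξ).2

open FourierTransform in
/-- The convolution kernel of a smooth compactly supported multiplier. -/
theorem exists_schwartz_kernel {m : 𝔼 → ℂ} (hm : ContDiff ℝ (⊤ : ℕ∞) m)
    (hc : HasCompactSupport m) : ∃ K : SchwartzMap 𝔼 ℂ, ⇑K = invFourierTd m ∧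
      (∀ η, 𝓕 K η = m ((2 * π) • η)) ∧
      ∀ (f : SchwartzMap 𝔼 ℂ) (s : ℝ), 0 < s →
        Tmultd (fun ξ => m (s • ξ)) ⇑f = cv (dil s ⇑K) ⇑f := by
  have hc' : HasCompactSupport fun η : 𝔼 => m ((2 * π) • η) :=
    hc.comp_homeomorph (Homeomorph.smulOfNeZero (2 * π) two_pi_pos.ne')
  have hm' : ContDiff ℝ (⊤ : ℕ∞) fun η : 𝔼 => m ((2 * π) • η) :=
    hm.comp (contDiff_const_smul _)
  set M : SchwartzMap 𝔼 ℂ := hc'.toSchwartzMap hm' with hM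
  have hMa : ∀ η, M η = m ((2 * π) • η) := fun η => rfl
  have hF : ∀ η, 𝓕 (𝓕⁻ M) η = m ((2 * π) • η) := fun η => by
    rw [FourierTransform.fourier_fourierInv_eq, hMa]
  refine ⟨𝓕⁻ M, ?_, hF, fun f s hs => ?_⟩
  · ext x
    rw [invFourierTd_eq, SchwartzMap.fourierInv_coe]
    rfl
  · obtain ⟨g, hg, hg'⟩ := SchwartzMap.exists_cv (dilS s hs (𝓕⁻ M)) f
    rw [coe_dilS] at hg
    rw [← hg]
    ext x
    rw [Tmultd, invFourierTd_eq]
    conv_rhs => rw [← FourierTransform.fourierInv_fourier_eq (F := SchwartzMap 𝔼 ℂ) g, SchwartzMap.fourierInv_coe]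
    refine congrArg (fun h : 𝔼 → ℂ => 𝓕⁻ h x) (funext fun η => ?_)
    rw [hg', SchwartzMap.fourier_coe (dilS _ _ _), coe_dilS, fourier_dil hs,
      ← SchwartzMap.fourier_coe, hF, fourierTd_two_pi_smul, ← SchwartzMap.fourier_coe,
      smul_comm]

theorem contDiff_radialDeriv {m : 𝔼 → ℂ} (hm : ContDiff ℝ (⊤ : ℕ∞) m) (c : ℂ) :
    ContDiff ℝ (⊤ : ℕ∞) fun ξ => c * radialDeriv m ξ :=
  contDiff_const.mul ((hm.fderiv_right (by simp)).clm_apply contDiff_id)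

theorem support_radialDeriv_subset {m : 𝔼 → ℂ}
    (hm : Function.support m ⊆ {ξ : 𝔼 | 1 ≤ ‖ξ‖ ∧ ‖ξ‖ ≤ 2}) (c : ℂ) :
    (Function.support fun ξ => c * radialDeriv m ξ) ⊆ {ξ : 𝔼 | 1 ≤ ‖ξ‖ ∧ ‖ξ‖ ≤ 2} := by
  have hcl : IsClosed {ξ : 𝔼 | 1 ≤ ‖ξ‖ ∧ ‖ξ‖ ≤ 2} :=
    (isClosed_le continuous_const continuous_norm).inter
      (isClosed_le continuous_norm continuous_const)
  intro ξ hξ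
  refine closure_minimal hm hcl (support_fderiv_subset ℝ (f := m) ?_)
  intro h0
  simp [radialDeriv, h0] at hξ

variable (d) in
open FourierTransform in
/-- A smooth frequency cutoff to an annulus. -/
theorem exists_cutoff_kernel : ∃ φ : SchwartzMap (EuclideanSpace ℝ (Fin d)) ℂ,
    (∀ η, 1 / 2 ≤ 2 * π * ‖η‖ → 2 * π * ‖η‖ ≤ 2 → 𝓕 φ η = 1) ∧
    (∀ η, 𝓕 φ η ≠ 0 → 1 / 4 ≤ 2 * π * ‖η‖ ∧ 2 * π * ‖η‖ ≤ 4) ∧ ∀ η, ‖𝓕 φ η‖ ≤ 1 := by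
  have hpi := pi_pos
  let b₁ : ContDiffBump (0 : 𝔼) := ⟨2, 4, by norm_num, by norm_num⟩
  let b₂ : ContDiffBump (0 : 𝔼) := ⟨1 / 4, 1 / 2, by norm_num, by norm_num⟩
  have hsm : ContDiff ℝ (⊤ : ℕ∞) fun ξ : 𝔼 => ((b₁ ξ - b₂ ξ : ℝ) : ℂ) :=
    Complex.ofRealCLM.contDiff.comp (b₁.contDiff.sub b₂.contDiff)
  have hcp : HasCompactSupport fun ξ : 𝔼 => ((b₁ ξ - b₂ ξ : ℝ) : ℂ) :=
    (b₁.hasCompactSupport.sub b₂.hasCompactSupport).comp_left (g := fun x : ℝ => (x : ℂ)) (by simp)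
  obtain ⟨φ, -, hφ, -⟩ := exists_schwartz_kernel hsm hcp
  have hn : ∀ η : 𝔼, ‖(2 * π) • η‖ = 2 * π * ‖η‖ := fun η => by
    rw [norm_smul, Real.norm_of_nonneg (by positivity)]
  refine ⟨φ, fun η h1 h2 => ?_, fun η h => ?_, fun η => ?_⟩
  · have e1 : b₁ ((2 * π) • η) = 1 := b₁.one_of_mem_closedBall (by simpa [hn, b₁] using h2)
    have e2 : b₂ ((2 * π) • η) = 0 := b₂.zero_of_le_dist (by simpa [hn, b₂] using h1)
    rw [hφ, e1, e2]; simp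
  · contrapose! h
    rw [hφ]
    by_cases h1 : 1 / 4 ≤ 2 * π * ‖η‖
    · have e1 : b₁ ((2 * π) • η) = 0 := b₁.zero_of_le_dist (by simpa [hn, b₁] using (h h1).le)
      have e2 : b₂ ((2 * π) • η) = 0 := b₂.zero_of_le_dist (by
        have := h h1
        simp only [dist_zero_right, hn, b₂]; linarith)
      rw [e1, e2]; simp
    · have e1 : b₁ ((2 * π) • η) = 1 := b₁.one_of_mem_closedBall (by
        simp only [mem_closedBall_zero_iff, hn, b₁]; linarith)
      have e2 : b₂ ((2 * π) • η) = 1 := b₂.one_of_mem_closedBall (by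
        simp only [mem_closedBall_zero_iff, hn, b₂]; linarith)
      rw [e1, e2]; simp
  · rw [hφ, Complex.norm_real, Real.norm_eq_abs, abs_le]
    constructor <;> linarith [b₁.nonneg (x := (2 * π) • η), b₁.le_one (x := (2 * π) • η),
      b₂.nonneg (x := (2 * π) • η), b₂.le_one (x := (2 * π) • η)]

open FourierTransform in
theorem cv_dil_cutoff {K φ : SchwartzMap 𝔼 ℂ}
    (hK : ∀ η, 𝓕 K η ≠ 0 → 1 ≤ 2 * π * ‖η‖ ∧ 2 * π * ‖η‖ ≤ 2)
    (hφ : ∀ η, 1 / 2 ≤ 2 * π * ‖η‖ → 2 * π * ‖η‖ ≤ 2 → 𝓕 φ η = 1)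
    {t s : ℝ} (ht : 0 < t) (hts : t ≤ s) (hst : s ≤ 2 * t) {f : 𝔼 → ℂ} (hf : Integrable f) :
    cv (dil s ⇑K) (cv (dil t ⇑φ) f) = cv (dil s ⇑K) f := by
  have hs : 0 < s := ht.trans_le hts
  have hpi := pi_pos
  rw [(K.niceKer.dil hs).cv_assoc (φ.niceKer.dil ht) hf]
  congr 1
  obtain ⟨g, hg, hg'⟩ := SchwartzMap.exists_cv (dilS s hs K) (dilS t ht φ)
  have : g = dilS s hs K := by
    have h : 𝓕 g = 𝓕 (dilS s hs K) := by
      ext η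
      rw [hg', SchwartzMap.fourier_coe, SchwartzMap.fourier_coe (dilS t ht φ), coe_dilS, coe_dilS,
        fourier_dil hs, fourier_dil ht, ← SchwartzMap.fourier_coe, ← SchwartzMap.fourier_coe]
      by_cases h0 : 𝓕 K (s • η) = 0
      · rw [h0, zero_mul]
      · obtain ⟨h1, h2⟩ := hK _ h0
        rw [norm_smul, Real.norm_of_nonneg hs.le] at h1 h2
        have h3 : 2 * π * (s * ‖η‖) ≤ 2 * π * (2 * t * ‖η‖) := by gcongr
        have h4 : 2 * π * (t * ‖η‖) ≤ 2 * π * (s * ‖η‖) := by gcongr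
        rw [hφ, mul_one] <;> rw [norm_smul, Real.norm_of_nonneg ht.le] <;> linarith
    rw [← FourierTransform.fourierInv_fourier_eq (F := SchwartzMap 𝔼 ℂ) g, h,
      FourierTransform.fourierInv_fourier_eq]
  rw [← coe_dilS hs, ← coe_dilS ht, ← hg, this]

open FourierTransform in
theorem sum_enorm_fourier_cutoff_le {φ : SchwartzMap 𝔼 ℂ}
    (hφ : ∀ η, 𝓕 φ η ≠ 0 → 1 / 4 ≤ 2 * π * ‖η‖ ∧ 2 * π * ‖η‖ ≤ 4) (hφ' : ∀ η, ‖𝓕 φ η‖ ≤ 1)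
    (I : Finset ℤ) (η : 𝔼) : ∑ k ∈ I, ‖𝓕 φ ((2 : ℝ) ^ k • η)‖ₑ ^ (2 : ℝ) ≤ 5 := by
  classical
  have hpi := pi_pos
  set J := I.filter fun k => 𝓕 φ ((2 : ℝ) ^ k • η) ≠ 0 with hJ
  have h1 : ∑ k ∈ I, ‖𝓕 φ ((2 : ℝ) ^ k • η)‖ₑ ^ (2 : ℝ) =
      ∑ k ∈ J, ‖𝓕 φ ((2 : ℝ) ^ k • η)‖ₑ ^ (2 : ℝ) := by
    rw [hJ, Finset.sum_filter]
    refine Finset.sum_congr rfl fun k _ => ?_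
    split_ifs with h
    · rfl
    · rw [not_not] at h
      simp [h]
  have h2 : ∑ k ∈ J, ‖𝓕 φ ((2 : ℝ) ^ k • η)‖ₑ ^ (2 : ℝ) ≤ J.card := by
    rw [Finset.cast_card]
    refine Finset.sum_le_sum fun k _ => ?_
    have : ‖𝓕 φ ((2 : ℝ) ^ k • η)‖ₑ ≤ 1 := by
      rw [← ofReal_norm]; exact ENNReal.ofReal_le_one.mpr (hφ' _)
    calc _ ≤ (1 : ℝ≥0∞) ^ (2 : ℝ) := by gcongr
      _ = 1 := by simp
  have h3 : J.card ≤ 5 := by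
    rcases J.eq_empty_or_nonempty with h | h
    · simp [h]
    · have hsub : J ⊆ Finset.Icc (J.min' h) (J.min' h + 4) := by
        intro k hk
        have hk0 := J.min'_le k hk
        set k₀ := J.min' h with hk₀
        have hm : k₀ ∈ J := J.min'_mem h
        refine Finset.mem_Icc.mpr ⟨hk0, ?_⟩
        have a1 := (hφ _ (Finset.mem_filter.mp hm).2).1
        have a2 := (hφ _ (Finset.mem_filter.mp hk).2).2
        rw [norm_smul, Real.norm_of_nonneg (by positivity)] at a1 a2
        by_contra! hlt
        have h5 : (2 : ℝ) ^ (k₀ + 5) ≤ 2 ^ k := zpow_le_zpow_right₀ (by norm_num) (by omega)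
        rw [zpow_add₀ (by norm_num)] at h5
        norm_num at h5
        have : 2 * π * (2 ^ k₀ * 32 * ‖η‖) ≤ 2 * π * (2 ^ k * ‖η‖) := by gcongr
        nlinarith
      calc J.card ≤ _ := Finset.card_le_card hsub
        _ ≤ 5 := by rw [Int.card_Icc]; omega
  rw [h1]
  refine h2.trans ?_
  exact_mod_cast h3

open FourierTransform in
/-- Square function estimate for smooth frequency projections. -/
theorem sum_lintegral_cutoff_sq_le {φ : SchwartzMap 𝔼 ℂ}
    (hφ : ∀ η, 𝓕 φ η ≠ 0 → 1 / 4 ≤ 2 * π * ‖η‖ ∧ 2 * π * ‖η‖ ≤ 4) (hφ' : ∀ η, ‖𝓕 φ η‖ ≤ 1)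
    (I : Finset ℤ) {f : 𝔼 → ℂ} (hf : Nice f) :
    ∑ k ∈ I, ∫⁻ x, ‖cv (dil ((2 : ℝ) ^ k) ⇑φ) f x‖ₑ ^ (2 : ℝ) ≤ 5 * ∫⁻ x, ‖f x‖ₑ ^ (2 : ℝ) := by
  have := sum_lintegral_cv_sq_le I (fun k => dilS ((2 : ℝ) ^ k) (by positivity) φ) (a := 5)
    (by simp) (fun η => ?_) hf
  · simpa only [coe_dilS] using this
  · refine le_trans (le_of_eq (Finset.sum_congr rfl fun k _ => ?_))
      (sum_enorm_fourier_cutoff_le hφ hφ' I η)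
    rw [SchwartzMap.fourier_coe, coe_dilS, fourier_dil (by positivity), ← SchwartzMap.fourier_coe]

open FourierTransform in
theorem lintegral_cv_sq_le {K : SchwartzMap 𝔼 ℂ} {a : ℝ} (hK : ∀ η, ‖𝓕 K η‖ ≤ a)
    {f : 𝔼 → ℂ} (hf : Nice f) :
    ∫⁻ x, ‖cv K f x‖ₑ ^ (2 : ℝ) ≤ ENNReal.ofReal a ^ (2 : ℝ) * ∫⁻ x, ‖f x‖ₑ ^ (2 : ℝ) := by
  have := sum_lintegral_cv_sq_le {()} (fun _ => K) (a := ENNReal.ofReal a ^ (2 : ℝ))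
    (ENNReal.rpow_ne_top_of_nonneg (by norm_num) ENNReal.ofReal_ne_top) (fun η => ?_) hf
  · simpa using this
  · rw [Finset.sum_singleton]
    gcongr
    rw [← ofReal_norm]
    exact ENNReal.ofReal_le_ofReal (hK η)

end

section

theorem Nice.lintegral_cv_rpow_le_of_schwartz {K : SchwartzMap 𝔼 ℂ} {p A : ℝ} (hp : 1 < p)
    (h : ∀ f : SchwartzMap 𝔼 ℂ, eLpNorm (cv K f) (ENNReal.ofReal p) volume ≤
      ENNReal.ofReal A * eLpNorm f (ENNReal.ofReal p) volume) {f : 𝔼 → ℂ} (hf : Nice f) :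
    ∫⁻ x, ‖cv K f x‖ₑ ^ p ≤ ENNReal.ofReal A ^ p * ∫⁻ x, ‖f x‖ₑ ^ p := by
  have hp0 : 0 < p := by linarith
  obtain ⟨g, hg, hg'⟩ := hf.exists_schwartz_approx hp
  refine le_of_tendsto_of_tendsto' (hg' _ K.niceKer)
    (ENNReal.Tendsto.const_mul hg (Or.inr (ENNReal.rpow_ne_top_of_nonneg hp0.le
      ENNReal.ofReal_ne_top))) fun n => ?_
  have := ENNReal.rpow_le_rpow (h (g n)) hp0.le
  rwa [ENNReal.mul_rpow_of_nonneg _ _ hp0.le, eLpNorm_ofReal_rpow _ hp0,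
    eLpNorm_ofReal_rpow _ hp0] at this

open FourierTransform Filter Topology in
/-- A multiplier bounded on `L^p` is bounded by its operator norm. -/
theorem norm_fourier_le_of_lintegral_cv_rpow_le {K : 𝔼 → ℂ} (hK : NiceKer K) {p A : ℝ}
    (hp : 1 < p) (hA : 0 ≤ A)
    (h : ∀ f : 𝔼 → ℂ, Nice f →
      ∫⁻ x, ‖cv K f x‖ₑ ^ p ≤ ENNReal.ofReal A ^ p * ∫⁻ x, ‖f x‖ₑ ^ p) (η : 𝔼) :
    ‖𝓕 K η‖ ≤ A := by
  have hp0 : 0 < p := by linarith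
  obtain ⟨g, hgc, hg1, hgi, hg0⟩ : ∃ g : 𝔼 → ℂ, Continuous g ∧ (∀ x, ‖g x‖ ≤ 1) ∧ Integrable g ∧
      ∀ x ∈ Metric.ball (0 : 𝔼) 1, g x = 1 := by
    let b : ContDiffBump (0 : 𝔼) := ⟨1, 2, by norm_num, by norm_num⟩
    refine ⟨fun x => ((b x : ℝ) : ℂ), Complex.continuous_ofReal.comp b.continuous, fun x => ?_,
      b.integrable.ofReal, fun x hx => ?_⟩
    · rw [Complex.norm_real, Real.norm_of_nonneg b.nonneg]; exact b.le_one
    · simp only [b.one_of_mem_closedBall (Metric.ball_subset_closedBall hx), Complex.ofReal_one]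
  have hgN : Nice g := ⟨hgc.measurable, hgi, 1, hg1⟩
  set e : ℝ → 𝔼 → ℂ := fun s x => Complex.exp (((2 * π * ⟪s⁻¹ • x, η⟫ : ℝ) : ℂ) * Complex.I) with he
  have hec : ∀ s, Continuous (e s) := fun s => by
    rw [he]; fun_prop
  have he1 : ∀ s x, ‖e s x‖ = 1 := fun s x => Complex.norm_exp_ofReal_mul_I _
  have hfN : ∀ s, Nice fun x => e s x * g x := fun s => by
    refine ⟨((hec s).mul hgc).measurable, ?_, 1, fun x => ?_⟩
    · exact hgN.int.bdd_mul (c := 1) (hec s).aestronglyMeasurable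
        (Filter.Eventually.of_forall fun x => (he1 s x).le)
    · rw [norm_mul, he1, one_mul]; exact hg1 x
  set G : ℝ → 𝔼 → ℂ := fun s x => ∫ y, (Complex.exp (((-2 * π * ⟪y, η⟫ : ℝ) : ℂ) * Complex.I) * K y) *
    g (x - s • y) with hG
  have hGe : ∀ s, 0 < s → ∀ x, ‖cv (dil s K) (fun x => e s x * g x) x‖ₑ = ‖G s x‖ₑ := by
    intro s hs x
    rw [cv_dil hs, cv_comm, cv]
    have : ∀ y, e s (s • (s⁻¹ • x - y)) * g (s • (s⁻¹ • x - y)) * K y = e s x *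
        ((Complex.exp (((-2 * π * ⟪y, η⟫ : ℝ) : ℂ) * Complex.I) * K y) * g (x - s • y)) := by
      intro y
      have e1 : s • (s⁻¹ • x - y) = x - s • y := by
        rw [smul_sub, smul_smul, mul_inv_cancel₀ hs.ne', one_smul]
      have e2 : e s (x - s • y) =
          e s x * Complex.exp (((-2 * π * ⟪y, η⟫ : ℝ) : ℂ) * Complex.I) := by
        rw [he, ← Complex.exp_add]
        refine congrArg Complex.exp ?_
        rw [smul_sub, smul_smul, inv_mul_cancel₀ hs.ne', one_smul, inner_sub_left]
        push_cast; ring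
      rw [e1, e2]; ring
    simp only [this]
    rw [integral_const_mul, enorm_mul, ← ofReal_norm (e s x), he1]
    simp [hG]
  have hlim : ∀ x, Tendsto (fun n : ℕ => G (1 / ((n : ℝ) + 1)) x) atTop (𝓝 (𝓕 K η * g x)) := by
    intro x
    rw [Real.fourier_eq', ← integral_mul_const]
    refine tendsto_integral_of_dominated_convergence (fun y => ‖K y‖) (fun n => ?_) hK.int.norm
      (fun n => Eventually.of_forall fun y => ?_) (Eventually.of_forall fun y => ?_)
    · have hc1 : Continuous fun y : 𝔼 =>
          Complex.exp (((-2 * π * ⟪y, η⟫ : ℝ) : ℂ) * Complex.I) := by fun_prop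
      have hc2 : Continuous fun y : 𝔼 => x - (1 / ((n : ℝ) + 1)) • y := by fun_prop
      exact ((hc1.mul hK.cont).mul (hgc.comp hc2)).aestronglyMeasurable
    · rw [norm_mul, norm_mul, Complex.norm_exp_ofReal_mul_I, one_mul]
      exact mul_le_of_le_one_right (norm_nonneg _) (hg1 _)
    · rw [smul_eq_mul]
      refine tendsto_const_nhds.mul ?_
      have h1 : Tendsto (fun n : ℕ => x - (1 / ((n : ℝ) + 1)) • y) atTop (𝓝 x) := by
        have h2 : Tendsto (fun n : ℕ => (1 / ((n : ℝ) + 1)) • y) atTop (𝓝 ((0 : ℝ) • y)) :=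
          tendsto_one_div_add_atTop_nhds_zero_nat.smul_const y
        have h3 := (tendsto_const_nhds (x := x)).sub h2
        rwa [zero_smul, sub_zero] at h3
      exact (hgc.tendsto x).comp h1
  have hb : ∀ n : ℕ, ∫⁻ x, ‖G (1 / ((n : ℝ) + 1)) x‖ₑ ^ p ≤
      ENNReal.ofReal A ^ p * ∫⁻ x, ‖g x‖ₑ ^ p := by
    intro n
    have hs : (0 : ℝ) < 1 / ((n : ℝ) + 1) := by positivity
    have := lintegral_cv_dil_rpow_le h hs (hfN (1 / ((n : ℝ) + 1)))
    simp only [hGe _ hs, enorm_mul] at this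
    simpa only [← ofReal_norm (e _ _), he1, ENNReal.ofReal_one, one_mul] using this
  have hGm : ∀ n : ℕ, Measurable fun x => ‖G (1 / ((n : ℝ) + 1)) x‖ₑ ^ p := by
    intro n
    have hs : (0 : ℝ) < 1 / ((n : ℝ) + 1) := by positivity
    simp only [← hGe _ hs]
    exact ((hK.dil hs).continuous_cv (hfN _).int).measurable.enorm.pow_const _
  have hF : ∫⁻ x, ‖𝓕 K η * g x‖ₑ ^ p ≤ ENNReal.ofReal A ^ p * ∫⁻ x, ‖g x‖ₑ ^ p := by
    have e0 : ∀ x, ‖𝓕 K η * g x‖ₑ ^ p =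
        liminf (fun n : ℕ => ‖G (1 / ((n : ℝ) + 1)) x‖ₑ ^ p) atTop := fun x =>
      ((hlim x).enorm.ennrpow_const p).liminf_eq.symm
    simp only [e0]
    refine (lintegral_liminf_le hGm).trans ?_
    exact liminf_le_of_le (by isBoundedDefault) fun b hb' => by
      obtain ⟨n, hn⟩ := hb'.exists
      exact hn.trans (hb n)
  simp only [enorm_mul, ENNReal.mul_rpow_of_nonneg _ _ hp0.le] at hF
  have hgpos : ∫⁻ x, ‖g x‖ₑ ^ p ≠ 0 := by
    have h1 : volume (Metric.ball (0 : 𝔼) 1) ≤ ∫⁻ x, ‖g x‖ₑ ^ p := by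
      rw [← lintegral_indicator_one measurableSet_ball]
      refine lintegral_mono fun x => ?_
      by_cases hx : x ∈ Metric.ball (0 : 𝔼) 1
      · simp [hg0 x hx, hx]
      · simp [hx]
    exact ((Metric.measure_ball_pos _ _ one_pos).trans_le h1).ne'
  rw [lintegral_const_mul' _ _ (ENNReal.rpow_ne_top_of_nonneg hp0.le enorm_ne_top),
    ENNReal.mul_le_mul_iff_left hgpos (hgN.lintegral_rpow_lt_top hp.le).ne,
    ENNReal.rpow_le_rpow_iff hp0, ← ofReal_norm] at hF
  exact (ENNReal.ofReal_le_ofReal_iff hA).mp hF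

end

section

theorem dil_invFourierTd {s : ℝ} (hs : 0 < s) (m : 𝔼 → ℂ) (z : 𝔼) :
    dil s (invFourierTd m) z = invFourierTd (fun ξ => m (s • ξ)) z := by
  have h0 : (s : ℂ) ≠ 0 := by exact_mod_cast hs.ne'
  rw [dil, invFourierTd, integral_comp_inv_smul hs, invFourierTd]
  have : ∀ ξ : 𝔼, ⟪s⁻¹ • z, s • ξ⟫ = ⟪z, ξ⟫ := fun ξ => by
    rw [inner_smul_left, inner_smul_right]
    simp [hs.ne']
  simp only [this]
  push_cast
  field_simp

theorem hasDerivAt_dil_invFourierTd {m : 𝔼 → ℂ} (hm : ContDiff ℝ (⊤ : ℕ∞) m)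
    (hc : HasCompactSupport m) {lam : ℝ} (hlam : 0 < lam) (z : 𝔼) {s₀ : ℝ} (hs₀ : 0 < s₀) :
    HasDerivAt (fun s => dil s (invFourierTd m) z)
      (((lam / s₀ : ℝ) : ℂ) *
        dil s₀ (invFourierTd fun ξ => (lam : ℂ)⁻¹ * radialDeriv m ξ) z) s₀ := by
  have hl : (lam : ℂ) ≠ 0 := by exact_mod_cast hlam.ne'
  have hs0 : (s₀ : ℂ) ≠ 0 := by exact_mod_cast hs₀.ne'
  set F : ℝ → 𝔼 → ℂ := fun s ξ => Complex.exp (Complex.I * (⟪z, ξ⟫ : ℂ)) * m (s • ξ) with hF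
  set F' : ℝ → 𝔼 → ℂ := fun s ξ =>
    Complex.exp (Complex.I * (⟪z, ξ⟫ : ℂ)) * fderiv ℝ m (s • ξ) ξ with hF'
  have hcm : Continuous m := hm.continuous
  have hcf : Continuous (fderiv ℝ m) := hm.continuous_fderiv (by simp)
  have hFc : ∀ s, Continuous (F s) := fun s => by
    simp only [hF]; fun_prop
  have hF'c : ∀ s, Continuous (F' s) := fun s => by
    simp only [hF']
    exact (by fun_prop : Continuous fun ξ : 𝔼 => Complex.exp (Complex.I * (⟪z, ξ⟫ : ℂ))).mul
      ((hcf.comp (continuous_const_smul s)).clm_apply continuous_id)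
  obtain ⟨R, hR0, hR⟩ : ∃ R : ℝ, 0 < R ∧ ∀ ξ : 𝔼, R < ‖ξ‖ → fderiv ℝ m ξ = 0 := by
    obtain ⟨R, hR⟩ := (hc.fderiv (𝕜 := ℝ)).isCompact.isBounded.exists_pos_norm_le
    refine ⟨R, hR.1, fun ξ hξ => ?_⟩
    by_contra h
    exact absurd (hR.2 ξ (subset_tsupport _ h)) (not_le.mpr hξ)
  obtain ⟨C, hC⟩ := (hc.fderiv (𝕜 := ℝ)).exists_bound_of_continuous hcf
  have hC0 : 0 ≤ C := (norm_nonneg _).trans (hC 0)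
  have key := hasDerivAt_integral_of_dominated_loc_of_deriv_le (μ := volume) (F := F) (F' := F')
    (x₀ := s₀) (s := Metric.ball s₀ (s₀ / 2))
    (bound := (Metric.closedBall (0 : 𝔼) (R / (s₀ / 2))).indicator fun _ => C * (R / (s₀ / 2)))
    (Metric.ball_mem_nhds _ (by positivity))
    (Filter.Eventually.of_forall fun s => (hFc s).aestronglyMeasurable)
    ((hFc s₀).integrable_of_hasCompactSupport ?_) (hF'c s₀).aestronglyMeasurable
    (Filter.Eventually.of_forall fun ξ s hs => ?_)
    ((integrable_indicator_iff measurableSet_closedBall).mpr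
      (integrableOn_const measure_closedBall_lt_top.ne))
    (Filter.Eventually.of_forall fun ξ s hs => ?_)
  · have h2 := (key.2.const_mul ((((2 * Real.pi) ^ d)⁻¹ : ℝ) : ℂ))
    have h3 : (fun s => dil s (invFourierTd m) z) =ᶠ[nhds s₀]
        fun s => ((((2 * Real.pi) ^ d)⁻¹ : ℝ) : ℂ) * ∫ ξ, F s ξ := by
      filter_upwards [Ioi_mem_nhds hs₀] with s hs
      rw [dil_invFourierTd hs, invFourierTd]
    refine (h2.congr_of_eventuallyEq h3).congr_deriv ?_
    rw [dil_invFourierTd hs₀, invFourierTd, mul_left_comm]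
    congr 1
    rw [← integral_const_mul]
    refine integral_congr_ae (Filter.Eventually.of_forall fun ξ => ?_)
    simp only [hF', radialDeriv, map_smul]
    rw [Complex.real_smul]
    push_cast
    field_simp
  · refine HasCompactSupport.mul_left ?_
    exact hc.comp_homeomorph (Homeomorph.smulOfNeZero s₀ hs₀.ne')
  · have hs' : s₀ / 2 < s := by
      have := hs
      rw [Metric.mem_ball, Real.dist_eq, abs_lt] at this
      linarith
    have hn : ‖F' s ξ‖ = ‖fderiv ℝ m (s • ξ) ξ‖ := by
      simp only [hF', norm_mul]
      rw [mul_comm Complex.I, Complex.norm_exp_ofReal_mul_I, one_mul]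
    rw [hn]
    by_cases hξ : ξ ∈ Metric.closedBall (0 : 𝔼) (R / (s₀ / 2))
    · rw [Set.indicator_of_mem hξ]
      rw [mem_closedBall_zero_iff] at hξ
      exact ((fderiv ℝ m (s • ξ)).le_opNorm ξ).trans
        (mul_le_mul (hC _) hξ (norm_nonneg _) hC0)
    · rw [Set.indicator_of_notMem hξ]
      rw [mem_closedBall_zero_iff, not_le, div_lt_iff₀ (by positivity)] at hξ
      rw [hR (s • ξ)]
      · simp
      · rw [norm_smul, Real.norm_of_nonneg (by linarith), mul_comm]
        exact hξ.trans_le (mul_le_mul_of_nonneg_left hs'.le (norm_nonneg _))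
  · have h1 : HasDerivAt (fun s : ℝ => s • ξ) ξ s := by
      simpa using (hasDerivAt_id s).smul_const ξ
    exact ((hm.differentiable (by simp)).differentiableAt.hasFDerivAt.comp_hasDerivAt s
      h1).const_mul _

variable {K L f g : EuclideanSpace ℝ (Fin d) → ℂ}

theorem continuousAt_dil (hK : NiceKer K) (z : 𝔼) {s₀ : ℝ} (hs₀ : 0 < s₀) :
    ContinuousAt (fun s => dil s K z) s₀ := by
  have h1 : ContinuousAt (fun s : ℝ => s⁻¹ • z) s₀ :=
    (continuousAt_inv₀ hs₀.ne').smul continuousAt_const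
  have h2 : ContinuousAt (fun s : ℝ => (((s ^ d)⁻¹ : ℝ) : ℂ)) s₀ :=
    Complex.continuous_ofReal.continuousAt.comp
      ((continuousAt_id.pow d).inv₀ (pow_ne_zero d hs₀.ne'))
  exact h2.mul (hK.cont.continuousAt.comp h1)

theorem exists_dil_bound (hK : NiceKer K) : ∃ C : ℝ, 0 ≤ C ∧
    ∀ s₀ : ℝ, 0 < s₀ → ∀ s, s₀ ≤ s → ∀ z, ‖dil s K z‖ ≤ (s₀ ^ d)⁻¹ * C := by
  obtain ⟨C, hC⟩ := hK.bdd
  refine ⟨C, (norm_nonneg _).trans (hC 0), fun s₀ h0 s hs z => ?_⟩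
  have h1 : 0 < s := h0.trans_le hs
  rw [dil, norm_mul, Complex.norm_real, Real.norm_of_nonneg (by positivity)]
  refine mul_le_mul ?_ (hC _) (norm_nonneg _) (by positivity)
  exact inv_anti₀ (by positivity) (pow_le_pow_left₀ h0.le hs d)

theorem continuousAt_cv_dil (hK : NiceKer K) (hf : Integrable f) (x : 𝔼) {s₀ : ℝ}
    (hs₀ : 0 < s₀) : ContinuousAt (fun s => cv (dil s K) f x) s₀ := by
  obtain ⟨C, hC0, hC⟩ := exists_dil_bound hK
  refine continuousAt_of_dominated (bound := fun y => ((s₀ / 2) ^ d)⁻¹ * C * ‖f y‖) ?_ ?_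
    (hf.norm.const_mul _) ?_
  · filter_upwards [Ioi_mem_nhds hs₀] with s hs
    exact ((hK.dil hs).integrable_mul hf x).aestronglyMeasurable
  · filter_upwards [Ioi_mem_nhds (half_lt_self hs₀)] with s hs
    refine Filter.Eventually.of_forall fun y => ?_
    rw [norm_mul]
    exact mul_le_mul_of_nonneg_right (hC _ (by positivity) s (le_of_lt hs) _) (norm_nonneg _)
  · exact Filter.Eventually.of_forall fun y =>
      (continuousAt_dil hK (x - y) hs₀).mul continuousAt_const

theorem hasDerivAt_cv_dil {lam : ℝ} (hlam : 0 ≤ lam) (hK : NiceKer K) (hL : NiceKer L)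
    (hd : ∀ z s, 0 < s → HasDerivAt (fun s => dil s K z) (((lam / s : ℝ) : ℂ) * dil s L z) s)
    (hf : Integrable f) (x : 𝔼) {s₀ : ℝ} (hs₀ : 0 < s₀) :
    HasDerivAt (fun s => cv (dil s K) f x) (((lam / s₀ : ℝ) : ℂ) * cv (dil s₀ L) f x) s₀ := by
  obtain ⟨C, hC0, hC⟩ := exists_dil_bound hL
  have hpos : ∀ s ∈ Metric.ball s₀ (s₀ / 2), s₀ / 2 < s := fun s hs => by
    rw [Metric.mem_ball, Real.dist_eq, abs_lt] at hs
    linarith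
  have key := hasDerivAt_integral_of_dominated_loc_of_deriv_le (μ := volume)
    (F := fun s y => dil s K (x - y) * f y)
    (F' := fun s y => ((lam / s : ℝ) : ℂ) * dil s L (x - y) * f y)
    (x₀ := s₀) (s := Metric.ball s₀ (s₀ / 2))
    (bound := fun y => lam / (s₀ / 2) * (((s₀ / 2) ^ d)⁻¹ * C) * ‖f y‖)
    (Metric.ball_mem_nhds _ (by positivity)) ?_ ((hK.dil hs₀).integrable_mul hf x) ?_
    (Filter.Eventually.of_forall fun y s hs => ?_) (hf.norm.const_mul _)
    (Filter.Eventually.of_forall fun y s hs => ?_)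
  · refine key.2.congr_deriv ?_
    simp only [mul_assoc]
    rw [integral_const_mul, cv]
  · filter_upwards [Ioi_mem_nhds hs₀] with s hs
    exact ((hK.dil hs).integrable_mul hf x).aestronglyMeasurable
  · simp only [mul_assoc]
    exact (((hL.dil hs₀).integrable_mul hf x).const_mul _).aestronglyMeasurable
  · have h1 := hpos s hs
    have h2 : 0 < s := by linarith
    rw [norm_mul, norm_mul, Complex.norm_real, Real.norm_of_nonneg (by positivity)]
    refine mul_le_mul_of_nonneg_right (mul_le_mul ?_ (hC _ (by positivity) s h1.le _)
      (norm_nonneg _) (by positivity)) (norm_nonneg _)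
    exact div_le_div_of_nonneg_left hlam (by positivity) h1.le
  · have h1 := hpos s hs
    exact (hd (x - y) s (by linarith)).mul_const _

end

section

theorem enorm_mul_le_setLIntegral_of_hasDerivAt {F G : ℝ → ℂ} {lam S : ℝ} (hlam : 1 ≤ lam)
    (hS : 0 < S) (hd : ∀ u, 0 < u → HasDerivAt F (((lam / u : ℝ) : ℂ) * G u) u)
    (hG : ∀ u, 0 < u → ContinuousAt G u) {s a : ℝ} (ha : S ≤ a)
    (hs : s ∈ Set.Icc a (a + S / lam)) :
    ENNReal.ofReal (S / lam) * ‖F s‖ₑ ≤ ∫⁻ u in Set.Icc a (a + S / lam), (‖F u‖ₑ + ‖G u‖ₑ) := by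
  have hl : 0 < lam := by linarith
  set I := Set.Icc a (a + S / lam) with hI
  have hpos : ∀ u ∈ I, 0 < u := fun u hu => by have := hu.1; linarith
  have hFm : AEMeasurable (fun u => ‖F u‖ₑ) (volume.restrict I) := by
    refine (ContinuousOn.aemeasurable (fun u hu => ?_) measurableSet_Icc).enorm
    exact (hd u (hpos u hu)).continuousAt.continuousWithinAt
  have hstep : ∀ t ∈ I, ‖F s‖ₑ ≤ ‖F t‖ₑ + ENNReal.ofReal (lam / S) * ∫⁻ u in I, ‖G u‖ₑ := by
    intro t ht
    have hsub : Set.uIcc t s ⊆ I := Set.uIcc_subset_Icc ht hs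
    have hci : ContinuousOn (fun u => ((lam / u : ℝ) : ℂ) * G u) (Set.uIcc t s) := by
      intro u hu
      have hu0 := hpos u (hsub hu)
      refine ContinuousAt.continuousWithinAt ?_
      exact (Complex.continuous_ofReal.continuousAt.comp
        (continuousAt_const.div continuousAt_id hu0.ne')).mul (hG u hu0)
    have h1 := intervalIntegral.integral_eq_sub_of_hasDerivAt
      (fun u hu => hd u (hpos u (hsub hu))) hci.intervalIntegrable
    have h2 : F s = F t + ∫ u in t..s, ((lam / u : ℝ) : ℂ) * G u := by rw [h1]; ring
    rw [h2]
    refine (enorm_add_le _ _).trans (add_le_add le_rfl ?_)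
    have h3 : ‖∫ u in t..s, ((lam / u : ℝ) : ℂ) * G u‖ₑ ≤
        ∫⁻ u in Set.uIoc t s, ‖((lam / u : ℝ) : ℂ) * G u‖ₑ := by
      rw [← ofReal_norm, intervalIntegral.norm_intervalIntegral_eq, ofReal_norm]
      exact enorm_integral_le_lintegral_enorm _
    refine h3.trans ?_
    refine (lintegral_mono_set (Set.uIoc_subset_uIcc.trans hsub)).trans ?_
    rw [← lintegral_const_mul' _ _ ENNReal.ofReal_ne_top]
    refine setLIntegral_mono' measurableSet_Icc fun u hu => ?_
    rw [enorm_mul]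
    refine mul_le_mul' ?_ le_rfl
    rw [← ofReal_norm, Complex.norm_real, Real.norm_of_nonneg
      (div_nonneg hl.le (hpos u hu).le)]
    exact ENNReal.ofReal_le_ofReal (div_le_div_of_nonneg_left hl.le hS (ha.trans hu.1))
  have hvol : volume I = ENNReal.ofReal (S / lam) := by rw [hI, Real.volume_Icc]; congr 1; ring
  have h4 : ENNReal.ofReal (S / lam) * ‖F s‖ₑ ≤
      ∫⁻ t in I, (‖F t‖ₑ + ENNReal.ofReal (lam / S) * ∫⁻ u in I, ‖G u‖ₑ) := by
    rw [← hvol, mul_comm, ← setLIntegral_const]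
    exact setLIntegral_mono' measurableSet_Icc hstep
  refine h4.trans (le_of_eq ?_)
  rw [lintegral_add_left' hFm, lintegral_add_left' hFm, setLIntegral_const, hvol, mul_right_comm,
    ← ENNReal.ofReal_mul (by positivity)]
  have : lam / S * (S / lam) = 1 := by field_simp
  rw [this, ENNReal.ofReal_one, one_mul]

/-- One-dimensional Sobolev inequality on a dyadic interval. -/
theorem enorm_rpow_le_setLIntegral_of_hasDerivAt {F G : ℝ → ℂ} {lam S q : ℝ} (hq : 1 < q)
    (hlam : 1 ≤ lam)
    (hS : 0 < S) (hd : ∀ u, 0 < u → HasDerivAt F (((lam / u : ℝ) : ℂ) * G u) u)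
    (hG : ∀ u, 0 < u → ContinuousAt G u) {s : ℝ} (hs : s ∈ Set.Icc S (2 * S)) :
    ‖F s‖ₑ ^ q ≤ ENNReal.ofReal (lam / S) * (2 ^ (q - 1) *
      ∫⁻ u in Set.Icc S (2 * S), (‖F u‖ₑ ^ q + ‖G u‖ₑ ^ q)) := by
  have hl : 0 < lam := by linarith
  have hq0 : 0 < q := by linarith
  have hSl : S / lam ≤ S := div_le_self hS.le hlam
  obtain ⟨a, ha, ha2, hsa⟩ : ∃ a, S ≤ a ∧ a + S / lam ≤ 2 * S ∧
      s ∈ Set.Icc a (a + S / lam) := by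
    have : 0 < S / lam := by positivity
    rcases le_total s (2 * S - S / lam) with h | h
    · exact ⟨s, hs.1, by linarith, le_rfl, by linarith⟩
    · exact ⟨2 * S - S / lam, by linarith, by linarith, h, by linarith [hs.2]⟩
  set I := Set.Icc a (a + S / lam) with hI
  have hpos : ∀ u ∈ I, 0 < u := fun u hu => by have := hu.1; linarith
  have hFm : AEMeasurable (fun u => ‖F u‖ₑ + ‖G u‖ₑ) (volume.restrict I) := by
    have hF1 : AEMeasurable F (volume.restrict I) :=
      ContinuousOn.aemeasurable
        (fun u hu => (hd u (hpos u hu)).continuousAt.continuousWithinAt) measurableSet_Icc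
    have hG1 : AEMeasurable G (volume.restrict I) :=
      ContinuousOn.aemeasurable
        (fun u hu => (hG u (hpos u hu)).continuousWithinAt) measurableSet_Icc
    exact hF1.enorm.add hG1.enorm
  have hvol : volume I = ENNReal.ofReal (S / lam) := by rw [hI, Real.volume_Icc]; congr 1; ring
  have h1 := enorm_mul_le_setLIntegral_of_hasDerivAt hlam hS hd hG ha hsa
  have h2 : (ENNReal.ofReal (S / lam) * ‖F s‖ₑ) ^ q ≤
      ENNReal.ofReal (S / lam) ^ (q - 1) * ∫⁻ u in I, (‖F u‖ₑ + ‖G u‖ₑ) ^ q := by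
    refine (ENNReal.rpow_le_rpow h1 hq0.le).trans ?_
    have := rpow_lintegral_mul_le (volume.restrict I) hq (k := fun _ => 1)
      (h := fun u => ‖F u‖ₑ + ‖G u‖ₑ) aemeasurable_const hFm
    simpa [hvol] using this
  have h3 : ∫⁻ u in I, (‖F u‖ₑ + ‖G u‖ₑ) ^ q ≤
      2 ^ (q - 1) * ∫⁻ u in Set.Icc S (2 * S), (‖F u‖ₑ ^ q + ‖G u‖ₑ ^ q) := by
    rw [← lintegral_const_mul' _ _ (by finiteness)]
    refine (lintegral_mono_set (Set.Icc_subset_Icc ha ha2)).trans ?_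
    exact lintegral_mono fun u => ENNReal.rpow_add_le_mul_rpow_add_rpow _ _ hq.le
  have hx0 : ENNReal.ofReal (S / lam) ≠ 0 := by
    rw [Ne, ENNReal.ofReal_eq_zero, not_le]; positivity
  have hinv : ENNReal.ofReal (lam / S) * ENNReal.ofReal (S / lam) = 1 := by
    rw [← ENNReal.ofReal_mul (by positivity)]
    have : lam / S * (S / lam) = 1 := by field_simp
    rw [this, ENNReal.ofReal_one]
  have h4 : ENNReal.ofReal (lam / S) ^ q * (ENNReal.ofReal (S / lam) * ‖F s‖ₑ) ^ q =
      ‖F s‖ₑ ^ q := by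
    rw [← ENNReal.mul_rpow_of_nonneg _ _ hq0.le, ← mul_assoc, hinv, one_mul]
  have h5 : ENNReal.ofReal (lam / S) ^ q * ENNReal.ofReal (S / lam) ^ (q - 1) =
      ENNReal.ofReal (lam / S) := by
    have : ENNReal.ofReal (lam / S) ^ q = ENNReal.ofReal (lam / S) ^ (q - 1) *
        ENNReal.ofReal (lam / S) := by
      nth_rw 3 [← ENNReal.rpow_one (ENNReal.ofReal (lam / S))]
      rw [← ENNReal.rpow_add_of_nonneg _ _ (by linarith) zero_le_one]
      congr 1; ring
    rw [this, mul_right_comm, ← ENNReal.mul_rpow_of_nonneg _ _ (by linarith), hinv,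
      ENNReal.one_rpow, one_mul]
  rw [← h4]
  refine (mul_le_mul' le_rfl (h2.trans (mul_le_mul' le_rfl h3))).trans (le_of_eq ?_)
  rw [← mul_assoc, h5]

/-- The `q`-th power square-function type majorant of the maximal function over
`[S, 2S]`. -/
def sobMaj (lam q S : ℝ) (K L f : EuclideanSpace ℝ (Fin d) → ℂ)
    (x : EuclideanSpace ℝ (Fin d)) : ℝ≥0∞ :=
  ENNReal.ofReal (lam / S) * (2 ^ (q - 1) * ∫⁻ u in Set.Icc S (2 * S),
    (‖cv (dil u K) f x‖ₑ ^ q + ‖cv (dil u L) f x‖ₑ ^ q))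

variable {K L f φ : EuclideanSpace ℝ (Fin d) → ℂ}

theorem measurable_cv_dil (hK : NiceKer K) (hf : Measurable f) :
    Measurable fun z : ℝ × 𝔼 => cv (dil z.1 K) f z.2 := by
  refine StronglyMeasurable.measurable ?_
  refine StronglyMeasurable.integral_prod_right'
    (f := fun w : (ℝ × 𝔼) × 𝔼 => dil w.1.1 K (w.1.2 - w.2) * f w.2) ?_
  refine Measurable.stronglyMeasurable ?_
  have hKm := hK.cont.measurable
  unfold dil
  fun_prop

theorem measurable_sobMaj (lam q S : ℝ) (hK : NiceKer K) (hL : NiceKer L) (hf : Measurable f) :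
    Measurable (sobMaj lam q S K L f) := by
  unfold sobMaj
  refine Measurable.const_mul (Measurable.const_mul ?_ _) _
  refine Measurable.lintegral_prod_left'
    (f := fun z : ℝ × 𝔼 => ‖cv (dil z.1 K) f z.2‖ₑ ^ q + ‖cv (dil z.1 L) f z.2‖ₑ ^ q) ?_
  exact ((measurable_cv_dil hK hf).enorm.pow_const q).add
    ((measurable_cv_dil hL hf).enorm.pow_const q)

theorem enorm_cv_dil_rpow_le_sobMaj {lam q S : ℝ} (hq : 1 < q) (hlam : 1 ≤ lam) (hS : 0 < S)
    (hK : NiceKer K) (hL : NiceKer L)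
    (hd : ∀ z s, 0 < s → HasDerivAt (fun s => dil s K z) (((lam / s : ℝ) : ℂ) * dil s L z) s)
    (hf : Integrable f) (x : 𝔼) {s : ℝ} (hs : s ∈ Set.Icc S (2 * S)) :
    ‖cv (dil s K) f x‖ₑ ^ q ≤ sobMaj lam q S K L f x :=
  enorm_rpow_le_setLIntegral_of_hasDerivAt (F := fun s => cv (dil s K) f x)
    (G := fun s => cv (dil s L) f x) hq hlam hS
    (fun _ hu => hasDerivAt_cv_dil (by linarith) hK hL hd hf x hu)
    (fun _ hu => continuousAt_cv_dil hL hf x hu) hs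

theorem lintegral_average_Icc_le {lam q S : ℝ} {a : ℝ≥0∞} (hlam : 0 ≤ lam) (hS : 0 < S)
    {Φ Ψ : ℝ → 𝔼 → ℝ≥0∞} (hΦ : Measurable (Function.uncurry Φ))
    (hΨ : Measurable (Function.uncurry Ψ)) (hΦa : ∀ u ∈ Set.Icc S (2 * S), ∫⁻ x, Φ u x ≤ a)
    (hΨa : ∀ u ∈ Set.Icc S (2 * S), ∫⁻ x, Ψ u x ≤ a) :
    ∫⁻ x, ENNReal.ofReal (lam / S) * (2 ^ (q - 1) * ∫⁻ u in Set.Icc S (2 * S),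
      (Φ u x + Ψ u x)) ≤ ENNReal.ofReal lam * 2 ^ q * a := by
  rw [lintegral_const_mul' _ _ ENNReal.ofReal_ne_top]
  have hswap := lintegral_lintegral_swap (μ := (volume : Measure 𝔼))
    (ν := volume.restrict (Set.Icc S (2 * S)))
    (f := fun x u => Φ u x + Ψ u x) ((hΦ.add hΨ).comp measurable_swap).aemeasurable
  rw [lintegral_const_mul' _ _ (by finiteness), hswap]
  have h1 : ∫⁻ u in Set.Icc S (2 * S), ∫⁻ x, (Φ u x + Ψ u x) ≤
      ∫⁻ u in Set.Icc S (2 * S), (a + a) := by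
    refine setLIntegral_mono' measurableSet_Icc fun u hu => ?_
    rw [lintegral_add_left (hΦ.of_uncurry_left (x := u))]
    exact add_le_add (hΦa u hu) (hΨa u hu)
  refine (mul_le_mul' le_rfl (mul_le_mul' le_rfl h1)).trans (le_of_eq ?_)
  rw [setLIntegral_const, Real.volume_Icc]
  have h2 : lam / S * (2 * S - S) = lam := by field_simp; ring
  have h3 : (2 : ℝ≥0∞) ^ q = 2 ^ (q - 1) * 2 := by
    nth_rw 3 [← ENNReal.rpow_one 2]
    rw [← ENNReal.rpow_add _ _ (by norm_num) (by norm_num)]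
    congr 1; ring
  have h4 : ENNReal.ofReal lam = ENNReal.ofReal (lam / S) * ENNReal.ofReal (2 * S - S) := by
    rw [← ENNReal.ofReal_mul (by positivity), h2]
  rw [h4, h3]
  ring

theorem lintegral_sobMaj_le {lam q S : ℝ} {a : ℝ≥0∞} (hlam : 0 ≤ lam) (hS : 0 < S)
    (hK : NiceKer K) (hL : NiceKer L) (hf : Measurable f)
    (hKb : ∀ u ∈ Set.Icc S (2 * S), ∫⁻ x, ‖cv (dil u K) f x‖ₑ ^ q ≤ a)
    (hLb : ∀ u ∈ Set.Icc S (2 * S), ∫⁻ x, ‖cv (dil u L) f x‖ₑ ^ q ≤ a) :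
    ∫⁻ x, sobMaj lam q S K L f x ≤ ENNReal.ofReal lam * 2 ^ q * a :=
  lintegral_average_Icc_le hlam hS ((measurable_cv_dil hK hf).enorm.pow_const q)
    ((measurable_cv_dil hL hf).enorm.pow_const q) hKb hLb

end

section

/-- Kernels of operators bounded on `L^p` and `L²` by `A`, with tails bounded by
`B (1 + r)^(-ε)`, and whose frequencies are localised by `φ`. -/
structure AdmKer (p ε A B : ℝ) (φ K : EuclideanSpace ℝ (Fin d) → ℂ) : Prop where
  ker : NiceKer K
  Lp : ∀ f, Nice f → ∫⁻ x, ‖cv K f x‖ₑ ^ p ≤ ENNReal.ofReal A ^ p * ∫⁻ x, ‖f x‖ₑ ^ p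
  L2 : ∀ f, Nice f → ∫⁻ x, ‖cv K f x‖ₑ ^ (2 : ℝ) ≤
    ENNReal.ofReal A ^ (2 : ℝ) * ∫⁻ x, ‖f x‖ₑ ^ (2 : ℝ)
  tail : ∀ r, 0 < r →
    ∫⁻ z in {z | r < ‖z‖}, ‖K z‖ₑ ≤ ENNReal.ofReal (B * (1 + r) ^ (-ε))
  repro : ∀ t s, 0 < t → t ≤ s → s ≤ 2 * t → ∀ f, Integrable f →
    cv (dil s K) (cv (dil t φ) f) = cv (dil s K) f

/-- A pair of admissible kernels, the second being the normalised derivative of the first. -/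
structure AdmPair (p ε lam A B : ℝ) (φ K L : EuclideanSpace ℝ (Fin d) → ℂ) : Prop where
  left : AdmKer p ε A B φ K
  right : AdmKer p ε A B φ L
  one_le : 1 ≤ lam
  deriv : ∀ z s, 0 < s →
    HasDerivAt (fun s => dil s K z) (((lam / s : ℝ) : ℂ) * dil s L z) s

/-- Bounded functions of mean zero supported in a set comparable to a ball. -/
structure BallAtom (Λ : NNReal) (W : Set (EuclideanSpace ℝ (Fin d)))
    (z : EuclideanSpace ℝ (Fin d)) (j : ℤ) (c : NNReal)
    (a : EuclideanSpace ℝ (Fin d) → ℂ) : Prop where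
  measSet : MeasurableSet W
  sub : W ⊆ Metric.closedBall z (2 ^ j)
  vol : volume (Metric.closedBall z (2 * 2 ^ j)) ≤ Λ * volume W
  meas : Measurable a
  bdd : ∀ x, ‖a x‖ₑ ≤ W.indicator (fun _ => (c : ℝ≥0∞)) x
  zero : ∫ x, a x = 0

variable {K L φ f : EuclideanSpace ℝ (Fin d) → ℂ} {p ε lam A B : ℝ}

theorem AdmPair.lintegral_sobMaj_Lp (H : AdmPair p ε lam A B φ K L) (hφ : NiceKer φ)
    (hf : Nice f) {S : ℝ} (hS : 0 < S) : ∫⁻ x, sobMaj lam p S K L f x ≤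
      ENNReal.ofReal lam * 2 ^ p *
        (ENNReal.ofReal A ^ p * ∫⁻ x, ‖cv (dil S φ) f x‖ₑ ^ p) := by
  have hn : Nice (cv (dil S φ) f) := ((hφ.dil hS).cv hf.int).nice
  refine lintegral_sobMaj_le (by linarith [H.one_le]) hS H.left.ker H.right.ker hf.meas
    (fun u hu => ?_) fun u hu => ?_
  · rw [← H.left.repro S u hS hu.1 hu.2 f hf.int]
    exact lintegral_cv_dil_rpow_le H.left.Lp (hS.trans_le hu.1) hn
  · rw [← H.right.repro S u hS hu.1 hu.2 f hf.int]
    exact lintegral_cv_dil_rpow_le H.right.Lp (hS.trans_le hu.1) hn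

theorem AdmPair.lintegral_sobMaj_L2 (H : AdmPair p ε lam A B φ K L) (hφ : NiceKer φ)
    (hf : Nice f) {S : ℝ} (hS : 0 < S) : ∫⁻ x, sobMaj lam 2 S K L f x ≤
      ENNReal.ofReal lam * 2 ^ (2 : ℝ) *
        (ENNReal.ofReal A ^ (2 : ℝ) * ∫⁻ x, ‖cv (dil S φ) f x‖ₑ ^ (2 : ℝ)) := by
  have hn : Nice (cv (dil S φ) f) := ((hφ.dil hS).cv hf.int).nice
  refine lintegral_sobMaj_le (by linarith [H.one_le]) hS H.left.ker H.right.ker hf.meas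
    (fun u hu => ?_) fun u hu => ?_
  · rw [← H.left.repro S u hS hu.1 hu.2 f hf.int]
    exact lintegral_cv_dil_rpow_le H.left.L2 (hS.trans_le hu.1) hn
  · rw [← H.right.repro S u hS hu.1 hu.2 f hf.int]
    exact lintegral_cv_dil_rpow_le H.right.L2 (hS.trans_le hu.1) hn

theorem AdmPair.enorm_rpow_le_sobMaj (H : AdmPair p ε lam A B φ K L) {q : ℝ} (hq : 1 < q)
    (hf : Integrable f) (x : 𝔼) {S s : ℝ} (hS : 0 < S) (hs : s ∈ Set.Icc S (2 * S)) :
    ‖cv (dil s K) f x‖ₑ ^ q ≤ sobMaj lam q S K L f x :=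
  enorm_cv_dil_rpow_le_sobMaj hq H.one_le hS H.left.ker H.right.ker H.deriv hf x hs

theorem tsum_two_rpow_neg_abs_ne_top {δ : ℝ} (hδ : 0 < δ) :
    ∑' n : ℤ, ENNReal.ofReal (2 ^ (-(δ * |(n : ℝ)|))) ≠ ∞ := by
  have h1 : (2 : ℝ) ^ (-δ) < 1 := Real.rpow_lt_one_of_one_lt_of_neg (by norm_num) (by linarith)
  have h2 : Summable fun n : ℕ => (2 : ℝ) ^ (-(δ * (n : ℝ))) := by
    refine (summable_geometric_of_lt_one (by positivity) h1).congr fun n => ?_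
    rw [← Real.rpow_natCast, ← Real.rpow_mul (by norm_num)]
    congr 1; ring
  have h3 : Summable fun n : ℤ => (2 : ℝ) ^ (-(δ * |(n : ℝ)|)) := by
    refine Summable.of_nat_of_neg ?_ ?_
    · simpa using h2
    · simpa using h2
  exact h3.tsum_ofReal_ne_top

theorem BallAtom.nice {Λ : NNReal} {W : Set 𝔼} {z : 𝔼} {j : ℤ} {c : NNReal} {a : 𝔼 → ℂ}
    (h : BallAtom Λ W z j c a) : Nice a := by
  have hb : ∀ x, ‖a x‖ₑ ≤ c := fun x => (h.bdd x).trans (Set.indicator_le_self' (by simp) x)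
  refine ⟨h.meas, ⟨h.meas.aestronglyMeasurable, ?_⟩, c, fun x => ?_⟩
  · refine (lintegral_mono h.bdd).trans_lt ?_
    rw [lintegral_indicator h.measSet, setLIntegral_const]
    refine ENNReal.mul_lt_top ENNReal.coe_lt_top ?_
    exact (measure_mono h.sub).trans_lt measure_closedBall_lt_top
  · have := hb x
    rw [← ofReal_norm, ENNReal.ofReal_le_iff_le_toReal ENNReal.coe_ne_top] at this
    simpa using this

theorem tsum_lintegral_weighted_sum_rpow_le (hp : 1 ≤ p) {ι : Type} (I : Finset ι)
    (w : ℤ → ℝ≥0∞) (j : ι → ℤ) (n : ℤ) (g : ι → 𝔼 → ℝ≥0∞) (hg : ∀ i, Measurable (g i)) :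
    ∑' k : ℤ, ∫⁻ x, (∑ i ∈ I, w (j i - k - n) * g i x) ^ p ≤
      (∑' m, w m) ^ p * ∫⁻ x, (∑ i ∈ I, g i x) ^ p := by
  have hp0 : 0 ≤ p := by linarith
  rw [← lintegral_tsum fun k => ((Finset.measurable_sum _ fun i _ =>
    (hg i).const_mul _).pow_const p).aemeasurable,
    ← lintegral_const_mul _ ((Finset.measurable_sum _ fun i _ => hg i).pow_const p)]
  refine lintegral_mono fun x => (tsum_rpow_le_rpow_tsum hp _).trans ?_
  rw [← ENNReal.mul_rpow_of_nonneg _ _ hp0]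
  refine ENNReal.rpow_le_rpow (le_of_eq ?_) hp0
  rw [Summable.tsum_finsetSum fun _ _ => ENNReal.summable, Finset.mul_sum]
  refine Finset.sum_congr rfl fun i _ => ?_
  rw [ENNReal.tsum_mul_right]
  congr 1
  have : ∀ k, j i - k - n = Equiv.subLeft (j i - n) k := fun k => by
    rw [Equiv.subLeft_apply]; ring
  simp only [this]
  exact Equiv.tsum_eq (Equiv.subLeft (j i - n)) w

/-- The part of `|K_u|` far from the origin, weighted by a power of the distance. -/
def farKer (K : EuclideanSpace ℝ (Fin d) → ℂ) (δ R u : ℝ) (z : EuclideanSpace ℝ (Fin d)) :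
    ℝ≥0∞ :=
  {z | R < ‖z‖}.indicator (fun z => ‖dil u K z‖ₑ * ENNReal.ofReal ((‖z‖ / R) ^ δ)) z

theorem measurable_farKer (hK : NiceKer K) (δ R : ℝ) :
    Measurable fun w : ℝ × 𝔼 => farKer K δ R w.1 w.2 := by
  have hKm := hK.cont.measurable
  have : (fun w : ℝ × 𝔼 => farKer K δ R w.1 w.2) = {w : ℝ × 𝔼 | R < ‖w.2‖}.indicator
      fun w => ‖dil w.1 K w.2‖ₑ * ENNReal.ofReal ((‖w.2‖ / R) ^ δ) := by
    ext w
    simp only [farKer, Set.indicator_apply, Set.mem_ofPred_eq]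
  rw [this]
  refine Measurable.indicator ?_ (measurableSet_lt measurable_const (by fun_prop))
  unfold dil
  fun_prop

theorem exists_lintegral_farKer_le (hε : 0 < ε) : ∃ C : NNReal, ∀ (d : ℕ)
    (K : EuclideanSpace ℝ (Fin d) → ℂ) (_ : NiceKer K) (A B : ℝ) (_ : 0 < A)
    (_ : ∀ r, 0 < r → ∫⁻ z in {z | r < ‖z‖}, ‖K z‖ₑ ≤ ENNReal.ofReal (B * (1 + r) ^ (-ε)))
    (N : ℕ) (_ : B ≤ A * 2 ^ (ε * N)) (S u : ℝ) (_ : 0 < S) (_ : u ∈ Set.Icc S (2 * S)),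
    ∫⁻ z, farKer K (ε / 2) (S * 2 ^ N) u z ≤ C * ENNReal.ofReal A := by
  have hg : Summable fun n : ℕ => (2 : ℝ) ^ (3 * ε / 2) * ((2 : ℝ) ^ (-(ε / 2))) ^ n :=
    (summable_geometric_of_lt_one (by positivity)
      (Real.rpow_lt_one_of_one_lt_of_neg (by norm_num) (by linarith))).mul_left _
  refine ⟨(∑' n : ℕ, ENNReal.ofReal ((2 : ℝ) ^ (3 * ε / 2) *
    ((2 : ℝ) ^ (-(ε / 2))) ^ n)).toNNReal, ?_⟩
  intro d K hK A B hA htail N hN S u hS hu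
  have hu0 : 0 < u := hS.trans_le hu.1
  rw [ENNReal.coe_toNNReal hg.tsum_ofReal_ne_top]
  set R : ℝ := S * 2 ^ N with hR
  have hR0 : 0 < R := by positivity
  have hpt : ∀ z, farKer K (ε / 2) R u z ≤ ∑' n : ℕ, ENNReal.ofReal ((2 : ℝ) ^ ((n + 1) * (ε / 2))) *
      {z | 2 ^ n * R < ‖z‖}.indicator (fun z => ‖dil u K z‖ₑ) z := by
    intro z
    rw [farKer]
    by_cases hz : R < ‖z‖
    · rw [Set.indicator_of_mem (by exact hz)]
      have h1 : 1 < ‖z‖ / R := by rwa [one_lt_div hR0]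
      obtain ⟨n, hn1, hn2⟩ : ∃ n : ℕ, (2 : ℝ) ^ n < ‖z‖ / R ∧ ‖z‖ / R ≤ 2 ^ (n + 1) := by
        obtain ⟨n, hn⟩ := exists_mem_Ioc_zpow (zero_lt_one.trans h1) (one_lt_two (α := ℝ))
        have hn0 : 0 ≤ n := by
          by_contra hlt
          have : (2 : ℝ) ^ (n + 1) ≤ 2 ^ (0 : ℤ) :=
            zpow_le_zpow_right₀ one_le_two (by omega)
          rw [zpow_zero] at this
          linarith [hn.2]
        lift n to ℕ using hn0
        exact ⟨n, by simpa using hn.1, by exact_mod_cast hn.2⟩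
      refine le_trans ?_ (ENNReal.le_tsum n)
      rw [Set.indicator_of_mem (by
        simp only [Set.mem_ofPred_eq]; rwa [← lt_div_iff₀ hR0]), mul_comm]
      refine mul_le_mul' (ENNReal.ofReal_le_ofReal ?_) le_rfl
      refine (Real.rpow_le_rpow (by positivity) hn2 (by positivity)).trans (le_of_eq ?_)
      rw [← Real.rpow_natCast, ← Real.rpow_mul (by norm_num)]
      push_cast
      rfl
    · rw [Set.indicator_of_notMem (by exact hz)]
      exact bot_le
  have hms : ∀ r : ℝ, MeasurableSet {z : EuclideanSpace ℝ (Fin d) | r < ‖z‖} := fun r =>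
    measurableSet_lt measurable_const measurable_norm
  have hmd : Measurable fun z => ‖dil u K z‖ₑ := (hK.dil hu0).cont.measurable.enorm
  refine (lintegral_mono hpt).trans ?_
  rw [lintegral_tsum fun n => ((hmd.indicator (hms _)).const_mul _).aemeasurable,
    ← ENNReal.tsum_mul_right]
  refine ENNReal.tsum_le_tsum fun n => ?_
  rw [lintegral_const_mul _ (hmd.indicator (hms _)), lintegral_indicator (hms _),
    lintegral_enorm_dil_tail hu0]
  refine (mul_le_mul' le_rfl (htail _ (by positivity))).trans ?_
  rw [← ENNReal.ofReal_mul (by positivity), ← ENNReal.ofReal_mul (by positivity)]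
  refine ENNReal.ofReal_le_ofReal ?_
  have h1 : (2 : ℝ) ^ ((n : ℝ) + N - 1) ≤ 1 + 2 ^ n * R / u := by
    have : (2 : ℝ) ^ n * R / (2 * S) ≤ 2 ^ n * R / u :=
      div_le_div_of_nonneg_left (by positivity) hu0 hu.2
    have h2 : (2 : ℝ) ^ n * R / (2 * S) = (2 : ℝ) ^ ((n : ℝ) + N - 1) := by
      rw [Real.rpow_sub (by norm_num), Real.rpow_add (by norm_num), Real.rpow_one,
        Real.rpow_natCast, Real.rpow_natCast, hR]
      field_simp
    linarith
  have h2 : (1 + 2 ^ n * R / u) ^ (-ε) ≤ (2 : ℝ) ^ (((n : ℝ) + N - 1) * (-ε)) := by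
    rw [Real.rpow_mul (by norm_num)]
    exact Real.rpow_le_rpow_of_nonpos (by positivity) h1 (by linarith)
  calc (2 : ℝ) ^ (((n : ℝ) + 1) * (ε / 2)) * (B * (1 + 2 ^ n * R / u) ^ (-ε))
      ≤ (2 : ℝ) ^ (((n : ℝ) + 1) * (ε / 2)) * (A * 2 ^ (ε * N) *
        (2 : ℝ) ^ (((n : ℝ) + N - 1) * (-ε))) := by
        refine mul_le_mul_of_nonneg_left ?_ (by positivity)
        exact mul_le_mul hN h2 (by positivity) (by positivity)
    _ = (2 : ℝ) ^ (3 * ε / 2) * ((2 : ℝ) ^ (-(ε / 2))) ^ n * A := by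
        rw [← Real.rpow_natCast ((2 : ℝ) ^ (-(ε / 2))), ← Real.rpow_mul (by norm_num),
          ← Real.rpow_add (by norm_num), mul_assoc A, ← Real.rpow_add (by norm_num),
          mul_left_comm, ← Real.rpow_add (by norm_num), mul_comm A]
        congr 2
        ring

end

section

variable {K L φ f : EuclideanSpace ℝ (Fin d) → ℂ} {p ε lam A B : ℝ}

/-- Away from the atoms, the operator is controlled by the weighted kernel. -/
theorem enorm_cv_far_le {Λ : NNReal} {ι : Type} (I : Finset ι) {W : ι → Set 𝔼} {z : ι → 𝔼}
    {j : ι → ℤ} {c : ι → NNReal} {a : ι → 𝔼 → ℂ}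
    (ha : ∀ i, BallAtom Λ (W i) (z i) (j i) (c i) (a i)) {δ : ℝ} (hδ : 0 < δ) (k : ℤ) (N : ℕ)
    (K : 𝔼 → ℂ) (u : ℝ) (x : 𝔼) (J : Finset ι) (hJI : J ⊆ I)
    (hJ : ∀ i ∈ J, k + N < j i ∧ x ∉ Metric.closedBall (z i) (2 * 2 ^ (j i))) :
    ‖cv (dil u K) (fun y => ∑ i ∈ J, a i y) x‖ₑ ≤
      ∫⁻ y, farKer K δ (2 ^ k * 2 ^ N) u (x - y) *
        ∑ i ∈ I, ENNReal.ofReal (2 ^ (-(δ * |((j i - k - N : ℤ) : ℝ)|))) *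
          (W i).indicator (fun _ => (c i : ℝ≥0∞)) y := by
  refine (enorm_cv_le _ _ _).trans (lintegral_mono fun y => ?_)
  have h1 : ‖∑ i ∈ J, a i y‖ₑ ≤ ∑ i ∈ J, (W i).indicator (fun _ => (c i : ℝ≥0∞)) y :=
    (enorm_sum_le _ _).trans (Finset.sum_le_sum fun i _ => (ha i).bdd y)
  refine (mul_le_mul' le_rfl h1).trans ?_
  simp only [Finset.mul_sum]
  refine (Finset.sum_le_sum fun i hi => ?_).trans
    (Finset.sum_le_sum_of_subset hJI)
  by_cases hy : y ∈ W i
  swap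
  · simp [hy]
  obtain ⟨hk, hx⟩ := hJ i hi
  have hyz := (ha i).sub hy
  rw [Metric.mem_closedBall, dist_eq_norm] at hx hyz
  have hxy : (2 : ℝ) ^ j i < ‖x - y‖ := by
    have : x - z i = (x - y) + (y - z i) := by abel
    have h2 := norm_add_le (x - y) (y - z i)
    rw [← this] at h2
    push Not at hx
    linarith
  have hR : (2 : ℝ) ^ k * 2 ^ N = 2 ^ (k + N) := by
    rw [zpow_add₀ (by norm_num), zpow_natCast]
  have hRj : (2 : ℝ) ^ (k + N) < 2 ^ j i := zpow_lt_zpow_right₀ (by norm_num) hk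
  have hmem : (x - y) ∈ {z : 𝔼 | (2 : ℝ) ^ (k + N) < ‖z‖} := by
    simp only [Set.mem_ofPred_eq]; linarith
  rw [hR, farKer, Set.indicator_of_mem hmem, mul_assoc, ← mul_assoc (ENNReal.ofReal _)]
  refine mul_le_mul' le_rfl (le_mul_of_one_le_left bot_le ?_)
  rw [← ENNReal.ofReal_mul (by positivity), ENNReal.one_le_ofReal]
  have hn : (0 : ℝ) < ((j i - k - N : ℤ) : ℝ) := by exact_mod_cast (by omega : 0 < j i - k - N)
  have h3 : (2 : ℝ) ^ (((j i - k - N : ℤ) : ℝ)) ≤ ‖x - y‖ / 2 ^ (k + N) := by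
    rw [Real.rpow_intCast, le_div_iff₀ (by positivity), ← zpow_add₀ (by norm_num)]
    refine le_of_eq_of_le ?_ hxy.le
    congr 1; ring
  rw [abs_of_pos hn]
  calc (1 : ℝ) = ((2 : ℝ) ^ (((j i - k - N : ℤ) : ℝ))) ^ δ *
        2 ^ (-(δ * ((j i - k - N : ℤ) : ℝ))) := by
        rw [← Real.rpow_mul (by norm_num), ← Real.rpow_add (by norm_num)]
        rw [mul_comm δ, add_neg_cancel, Real.rpow_zero]
    _ ≤ _ := by
        refine mul_le_mul_of_nonneg_right ?_ (by positivity)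
        exact Real.rpow_le_rpow (by positivity) h3 hδ.le

theorem exists_far_majorant (hp : 1 < p) (hε : 0 < ε) : ∃ C : NNReal, ∀ (d : ℕ)
    (φ K L : EuclideanSpace ℝ (Fin d) → ℂ) (lam A B : ℝ)
    (_ : AdmPair p ε lam A B φ K L) (_ : 0 < A) (N : ℕ) (_ : B ≤ A * 2 ^ (ε * N)) (Λ : NNReal)
    (ι : Type) (I : Finset ι) (W : ι → Set (EuclideanSpace ℝ (Fin d)))
    (z : ι → EuclideanSpace ℝ (Fin d)) (j : ι → ℤ) (c : ι → NNReal)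
    (a : ι → EuclideanSpace ℝ (Fin d) → ℂ)
    (_ : ∀ i, BallAtom Λ (W i) (z i) (j i) (c i) (a i)),
    ∃ G : EuclideanSpace ℝ (Fin d) → ℝ≥0∞, Measurable G ∧
      ∫⁻ x, G x ≤ C * (ENNReal.ofReal lam * ENNReal.ofReal A ^ p *
        ∫⁻ x, (∑ i ∈ I, (W i).indicator (fun _ => (c i : ℝ≥0∞)) x) ^ p) ∧
      ∀ x (k : ℤ), ∀ s ∈ Set.Icc ((2 : ℝ) ^ k) (2 * 2 ^ k), ∀ J ⊆ I,
        (∀ i ∈ J, k + N < j i ∧ x ∉ Metric.closedBall (z i) (2 * 2 ^ (j i))) →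
        ‖cv (dil s K) (fun y => ∑ i ∈ J, a i y) x‖ₑ ^ p ≤ G x := by
  have hp0 : 0 < p := by linarith
  obtain ⟨C₁, hC₁⟩ := exists_lintegral_farKer_le hε
  set w : ℤ → ℝ≥0∞ := fun n => ENNReal.ofReal (2 ^ (-(ε / 2 * |(n : ℝ)|))) with hw
  have hwt : ∑' n, w n ≠ ∞ := tsum_two_rpow_neg_abs_ne_top (by positivity)
  refine ⟨((2 : ℝ≥0∞) ^ p * ((C₁ : ℝ≥0∞) ^ p * (∑' n, w n) ^ p)).toNNReal, ?_⟩
  rw [ENNReal.coe_toNNReal (by finiteness)]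
  intro d φ K L lam A B H hA N hN Λ ι I W z j c a ha
  have hlam : 0 ≤ lam := by linarith [H.one_le]
  set g : ι → EuclideanSpace ℝ (Fin d) → ℝ≥0∞ :=
    fun i => (W i).indicator (fun _ => (c i : ℝ≥0∞)) with hg
  have hgm : ∀ i, Measurable (g i) := fun i => measurable_const.indicator (ha i).measSet
  set Hk : ℤ → EuclideanSpace ℝ (Fin d) → ℝ≥0∞ :=
    fun k y => ∑ i ∈ I, w (j i - k - N) * g i y with hHk
  have hHm : ∀ k, Measurable (Hk k) := fun k =>
    Finset.measurable_sum _ fun i _ => (hgm i).const_mul _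
  set Φ : (EuclideanSpace ℝ (Fin d) → ℂ) → ℤ → ℝ → EuclideanSpace ℝ (Fin d) → ℝ≥0∞ :=
    fun K k u x => (∫⁻ y, farKer K (ε / 2) (2 ^ k * 2 ^ N) u (x - y) * Hk k y) ^ p with hΦ
  have hΦm : ∀ K, NiceKer K → ∀ k, Measurable (Function.uncurry (Φ K k)) := by
    intro K hK k
    refine Measurable.pow_const ?_ p
    refine Measurable.lintegral_prod_right' (f := fun v :
      (ℝ × EuclideanSpace ℝ (Fin d)) × EuclideanSpace ℝ (Fin d) =>
      farKer K (ε / 2) (2 ^ k * 2 ^ N) v.1.1 (v.1.2 - v.2) * Hk k v.2) ?_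
    have h1 := (measurable_farKer hK (ε / 2) (2 ^ k * 2 ^ N)).comp
      (g := fun w : ℝ × EuclideanSpace ℝ (Fin d) => farKer K (ε / 2) (2 ^ k * 2 ^ N) w.1 w.2)
      (f := fun v : (ℝ × EuclideanSpace ℝ (Fin d)) × EuclideanSpace ℝ (Fin d) =>
        (v.1.1, v.1.2 - v.2)) (by fun_prop)
    exact h1.mul ((hHm k).comp measurable_snd)
  have hΦi : ∀ K, AdmKer p ε A B φ K → ∀ k : ℤ, ∀ u ∈ Set.Icc ((2 : ℝ) ^ k) (2 * 2 ^ k),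
      ∫⁻ x, Φ K k u x ≤ (C₁ * ENNReal.ofReal A) ^ p * ∫⁻ x, Hk k x ^ p := by
    intro K hK k u hu
    have hfm : Measurable fun v => farKer K (ε / 2) (2 ^ k * 2 ^ N) u v :=
      (measurable_farKer hK.ker (ε / 2) (2 ^ k * 2 ^ N)).of_uncurry_left
        (f := fun u v => farKer K (ε / 2) (2 ^ k * 2 ^ N) u v) (x := u)
    refine (lintegral_young volume hp hfm (hHm k).aemeasurable).trans ?_
    refine mul_le_mul' (ENNReal.rpow_le_rpow ?_ hp0.le) le_rfl
    exact hC₁ d K hK.ker A B hA hK.tail N hN _ u (by positivity) hu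
  have hmG : ∀ k : ℤ, Measurable fun x => ENNReal.ofReal (lam / 2 ^ k) * (2 ^ (p - 1) *
      ∫⁻ u in Set.Icc ((2 : ℝ) ^ k) (2 * 2 ^ k), (Φ K k u x + Φ L k u x)) := fun k => by
    refine Measurable.const_mul (Measurable.const_mul ?_ _) _
    exact Measurable.lintegral_prod_left'
      (f := fun v : ℝ × EuclideanSpace ℝ (Fin d) => Φ K k v.1 v.2 + Φ L k v.1 v.2)
      ((hΦm K H.left.ker k).add (hΦm L H.right.ker k))
  refine ⟨fun x => ∑' k : ℤ, ENNReal.ofReal (lam / 2 ^ k) * (2 ^ (p - 1) *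
      ∫⁻ u in Set.Icc ((2 : ℝ) ^ k) (2 * 2 ^ k), (Φ K k u x + Φ L k u x)),
      Measurable.tsum hmG, ?_, ?_⟩
  · rw [lintegral_tsum fun k => (hmG k).aemeasurable]
    refine (ENNReal.tsum_le_tsum fun k => lintegral_average_Icc_le hlam (by positivity)
      (hΦm K H.left.ker k) (hΦm L H.right.ker k) (hΦi K H.left k) (hΦi L H.right k)).trans ?_
    rw [ENNReal.tsum_mul_left, ENNReal.tsum_mul_left]
    refine (mul_le_mul' le_rfl (mul_le_mul' le_rfl
      (tsum_lintegral_weighted_sum_rpow_le hp.le I w j N g hgm))).trans (le_of_eq ?_)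
    rw [ENNReal.mul_rpow_of_nonneg _ _ hp0.le]
    ring
  · intro x k s hs J hJI hJ
    refine le_trans ?_ (ENNReal.le_tsum k)
    have hni : Integrable fun y => ∑ i ∈ J, a i y :=
      integrable_finsetSum _ fun i _ => (ha i).nice.int
    refine (H.enorm_rpow_le_sobMaj hp hni x (by positivity) hs).trans ?_
    refine mul_le_mul' le_rfl (mul_le_mul' le_rfl (lintegral_mono fun u => ?_))
    exact add_le_add
      (ENNReal.rpow_le_rpow (enorm_cv_far_le I ha (by positivity) k N K u x J hJI hJ) hp0.le)
      (ENNReal.rpow_le_rpow (enorm_cv_far_le I ha (by positivity) k N L u x J hJI hJ) hp0.le)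

end

section

variable {K L f : EuclideanSpace ℝ (Fin d) → ℂ} {p ε lam A B : ℝ}

theorem SchwartzMap.exists_decay_bound (φ : SchwartzMap 𝔼 ℂ) : ∃ C : ℝ, 0 ≤ C ∧
    (∀ z, ‖φ z‖ ≤ C * ((1 + ‖z‖) ^ (d + 1))⁻¹ * (1 + ‖z‖)⁻¹) ∧
    ∀ z z', ‖z - z'‖ ≤ 1 → ‖φ z - φ z'‖ ≤ C * ((1 + ‖z‖) ^ (d + 1))⁻¹ * ‖z - z'‖ := by
  have h0 : ∀ n : ℕ, ∃ C : ℝ, 0 ≤ C ∧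
      ∀ z, ‖iteratedFDeriv ℝ n φ z‖ ≤ C * ((1 + ‖z‖) ^ (d + 2))⁻¹ := fun n => by
    have h := fun z => SchwartzMap.one_add_le_sup_seminorm_apply (𝕜 := ℝ) (m := (d + 2, n))
      (k := d + 2) (n := n) le_rfl le_rfl φ z
    refine ⟨_, (by positivity : 0 ≤ (1 + ‖(0 : 𝔼)‖) ^ (d + 2) *
      ‖iteratedFDeriv ℝ n φ 0‖).trans (h 0), fun z => ?_⟩
    rw [← div_eq_mul_inv, le_div_iff₀ (by positivity), mul_comm]
    exact h z
  obtain ⟨C₀, hC₀, h1⟩ := h0 0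
  obtain ⟨C₁, hC₁, h2⟩ := h0 1
  refine ⟨max C₀ (C₁ * 2 ^ (d + 1)), by positivity, fun z => ?_, fun z z' hz => ?_⟩
  · have := h1 z
    rw [norm_iteratedFDeriv_zero, pow_succ, mul_inv, ← mul_assoc] at this
    refine this.trans ?_
    gcongr
    exact le_max_left _ _
  · have hb : ∀ w ∈ Metric.closedBall z 1,
        ‖fderiv ℝ φ w‖ ≤ C₁ * 2 ^ (d + 1) * ((1 + ‖z‖) ^ (d + 1))⁻¹ := fun w hw => by
      have := h2 w
      rw [norm_iteratedFDeriv_one] at this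
      refine this.trans ?_
      rw [mul_assoc]
      refine mul_le_mul_of_nonneg_left ?_ hC₁
      rw [Metric.mem_closedBall, dist_eq_norm] at hw
      have h3 : 1 + ‖z‖ ≤ 2 * (1 + ‖w‖) := by
        have h4 := norm_sub_norm_le z w
        rw [norm_sub_rev] at h4
        linarith [norm_nonneg w]
      rw [← div_eq_mul_inv, le_div_iff₀ (by positivity), inv_mul_eq_div,
        div_le_iff₀ (by positivity)]
      refine (pow_le_pow_left₀ (by positivity) h3 (d + 1)).trans ?_
      rw [mul_pow]
      refine mul_le_mul_of_nonneg_left ?_ (by positivity)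
      exact pow_le_pow_right₀ (by linarith [norm_nonneg w]) (by omega)
    have h5 := (convex_closedBall z 1).norm_image_sub_le_of_norm_fderiv_le
      (fun w _ => φ.differentiable.differentiableAt) hb
      (by rw [Metric.mem_closedBall, dist_eq_norm, norm_sub_rev]; exact hz :
        z' ∈ Metric.closedBall z 1) (Metric.mem_closedBall_self zero_le_one)
    refine h5.trans ?_
    gcongr
    exact le_max_right _ _

/-- The `L¹`-normalised polynomially decaying kernel at scale `S`. -/
def bumpKer (d : ℕ) (S : ℝ) (z : EuclideanSpace ℝ (Fin d)) : ℝ≥0∞ :=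
  ENNReal.ofReal ((S ^ d)⁻¹) * ENNReal.ofReal (((1 + ‖S⁻¹ • z‖) ^ (d + 1))⁻¹)

theorem measurable_bumpKer (S : ℝ) : Measurable (bumpKer d S) := by
  unfold bumpKer; fun_prop

variable (d) in
theorem exists_lintegral_bumpKer_le : ∃ C : NNReal, ∀ S, 0 < S → ∫⁻ z, bumpKer d S z ≤ C := by
  have h : Integrable fun z : EuclideanSpace ℝ (Fin d) => (1 + ‖z‖) ^ (-((d : ℝ) + 1)) :=
    integrable_one_add_norm (by rw [finrank_euclideanSpace_fin]; linarith)
  refine ⟨(∫⁻ z : EuclideanSpace ℝ (Fin d),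
    ENNReal.ofReal (((1 + ‖z‖) ^ (d + 1))⁻¹)).toNNReal, fun S hS => ?_⟩
  rw [ENNReal.coe_toNNReal]
  · exact (lintegral_dil hS (u := fun z : EuclideanSpace ℝ (Fin d) =>
      ENNReal.ofReal (((1 + ‖z‖) ^ (d + 1))⁻¹))).le
  · refine ne_of_eq_of_ne (lintegral_congr fun z => ?_) h.lintegral_lt_top.ne
    rw [Real.rpow_neg (by positivity), ← Nat.cast_add_one, Real.rpow_natCast]

/-- Off-diagonal decay of the frequency localisation of an atom. -/
theorem exists_enorm_cv_atom_le (φ : SchwartzMap 𝔼 ℂ) : ∃ C : NNReal, ∀ (Λ : NNReal) (W : Set 𝔼)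
    (z : 𝔼) (j : ℤ) (c : NNReal) (a : 𝔼 → ℂ) (_ : BallAtom Λ W z j c a) (k : ℤ) (x : 𝔼)
    (_ : k ≤ j → x ∉ Metric.closedBall z (2 * 2 ^ j)),
    ‖cv (dil ((2 : ℝ) ^ k) φ) a x‖ₑ ≤ ∫⁻ y, (C * bumpKer d (2 ^ k) (x - y)) *
      (ENNReal.ofReal (2 ^ (-(1 * |((j - k : ℤ) : ℝ)|))) *
        W.indicator (fun _ => (c : ℝ≥0∞)) y) := by
  obtain ⟨C, hC, hφ1, hφ2⟩ := φ.exists_decay_bound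
  refine ⟨C.toNNReal, fun Λ W z j c a ha k x hx => ?_⟩
  have hS : (0 : ℝ) < 2 ^ k := by positivity
  set S : ℝ := 2 ^ k with hSk
  obtain ⟨b, hb, hbd⟩ : ∃ b : ℂ, cv (dil S φ) a x = ∫ y, (dil S φ (x - y) - b) * a y ∧
      ∀ y ∈ W, ‖dil S φ (x - y) - b‖ ≤ (S ^ d)⁻¹ * (C * ((1 + ‖S⁻¹ • (x - y)‖) ^ (d + 1))⁻¹ *
        2 ^ (-(1 * |((j - k : ℤ) : ℝ)|))) := by
    by_cases hjk : k ≤ j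
    · refine ⟨0, by simp [cv], fun y hy => ?_⟩
      rw [sub_zero, dil, norm_mul, Complex.norm_real, Real.norm_of_nonneg (by positivity)]
      refine mul_le_mul_of_nonneg_left ((hφ1 _).trans ?_) (by positivity)
      refine mul_le_mul_of_nonneg_left ?_ (by positivity)
      have hyz := ha.sub hy
      have hx' := hx hjk
      rw [Metric.mem_closedBall, dist_eq_norm] at hx' hyz
      have hxy : (2 : ℝ) ^ j ≤ ‖x - y‖ := by
        have : x - z = (x - y) + (y - z) := by abel
        have h2 := norm_add_le (x - y) (y - z)
        rw [← this] at h2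
        push Not at hx'
        linarith
      have h0 : (0 : ℝ) ≤ ((j - k : ℤ) : ℝ) := by exact_mod_cast (by omega : 0 ≤ j - k)
      rw [abs_of_nonneg h0, one_mul, Real.rpow_neg (by norm_num), Real.rpow_intCast]
      refine inv_anti₀ (by positivity) ?_
      rw [norm_smul, norm_inv, Real.norm_of_nonneg hS.le, zpow_sub₀ (by norm_num), div_eq_inv_mul]
      have := mul_le_mul_of_nonneg_left hxy (inv_nonneg.mpr hS.le)
      linarith
    · refine ⟨dil S φ (x - z), ?_, fun y hy => ?_⟩
      · simp only [sub_mul]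
        rw [integral_sub ((φ.niceKer.dil hS).integrable_mul ha.nice.int x)
          (ha.nice.int.const_mul _), integral_const_mul, ha.zero, mul_zero, sub_zero, cv]
      · have hyz := ha.sub hy
        rw [Metric.mem_closedBall, dist_eq_norm] at hyz
        have h0 : ((j - k : ℤ) : ℝ) ≤ 0 := by exact_mod_cast (by omega : j - k ≤ 0)
        have h1 : ‖S⁻¹ • (x - y) - S⁻¹ • (x - z)‖ ≤ 2 ^ (j - k) := by
          rw [← smul_sub, norm_smul, norm_inv, Real.norm_of_nonneg hS.le, zpow_sub₀ (by norm_num),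
            div_eq_inv_mul, sub_sub_sub_cancel_left, norm_sub_rev]
          exact mul_le_mul_of_nonneg_left hyz (inv_nonneg.mpr hS.le)
        have h2 : (2 : ℝ) ^ (j - k) ≤ 1 := zpow_le_one_of_nonpos₀ (by norm_num) (by omega)
        rw [dil, dil, ← mul_sub, norm_mul, Complex.norm_real, Real.norm_of_nonneg (by positivity)]
        refine mul_le_mul_of_nonneg_left ((hφ2 _ _ (h1.trans h2)).trans ?_) (by positivity)
        refine mul_le_mul_of_nonneg_left ?_ (by positivity)
        rw [abs_of_nonpos h0, one_mul, neg_neg, Real.rpow_intCast]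
        exact h1
  rw [hb]
  refine (enorm_integral_le_lintegral_enorm _).trans (lintegral_mono fun y => ?_)
  rw [enorm_mul]
  refine (mul_le_mul' le_rfl (ha.bdd y)).trans ?_
  by_cases hy : y ∈ W
  · rw [Set.indicator_of_mem hy, ← mul_assoc]
    refine mul_le_mul' ?_ le_rfl
    rw [← ofReal_norm]
    refine (ENNReal.ofReal_le_ofReal (hbd y hy)).trans (le_of_eq ?_)
    rw [ENNReal.ofReal_mul (by positivity), ENNReal.ofReal_mul (by positivity),
      ENNReal.ofReal_mul hC, bumpKer]
    change _ = ENNReal.ofReal C * _ * _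
    ring
  · simp [hy]

theorem BallAtom.lintegral_sq_le {Λ : NNReal} {W : Set 𝔼} {z : 𝔼} {j : ℤ} {c : NNReal} {a : 𝔼 → ℂ}
    (h : BallAtom Λ W z j c a) : ∫⁻ x, ‖a x‖ₑ ^ (2 : ℝ) ≤ (c : ℝ≥0∞) ^ (2 : ℝ) * volume W := by
  rw [← setLIntegral_const, ← lintegral_indicator h.measSet]
  refine lintegral_mono fun x => (ENNReal.rpow_le_rpow (h.bdd x) (by norm_num)).trans ?_
  by_cases hx : x ∈ W <;> simp [hx]

end

section

variable {p : ℝ}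

/-- Minkowski's inequality for the interchange of a finite sum and an `ℓ^p` norm. -/
theorem tsum_finset_sum_rpow_le (hp : 1 ≤ p) {ι : Type} (I : Finset ι) (e : ι → ℤ → ℝ≥0∞) :
    ∑' k, (∑ i ∈ I, e i k) ^ p ≤ (∑ i ∈ I, (∑' k, e i k ^ p) ^ (1 / p)) ^ p := by
  have h := lintegral_Lp_finset_sum_le Measure.count hp I e fun i _ => by fun_prop
  simp only [lintegral_count] at h
  have := ENNReal.rpow_le_rpow h (by linarith : 0 ≤ p)
  rwa [← ENNReal.rpow_mul, one_div_mul_cancel (by linarith), ENNReal.rpow_one] at this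

/-- Hölder's inequality on a window of `N + 1` indices. -/
theorem tsum_window_rpow_le (hp : 1 < p) (hp2 : p < 2) (N : ℕ) (j : ℤ) (e : ℤ → ℝ≥0∞) :
    (∑' k : ℤ, (if k ≤ j ∧ j ≤ k + N then e k else 0) ^ p) ^ (1 / p) ≤
      ((N : ℝ≥0∞) + 1) ^ (1 / p - 1 / 2) * (∑' k, e k ^ (2 : ℝ)) ^ (1 / (2 : ℝ)) := by
  have hp0 : 0 < p := by linarith
  have h1 : ∑' k : ℤ, (if k ≤ j ∧ j ≤ k + N then e k else 0) ^ p =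
      ∑ k ∈ Finset.Icc (j - N) j, e k ^ p := by
    rw [tsum_eq_sum (s := Finset.Icc (j - N) j) fun k hk => ?_]
    · refine Finset.sum_congr rfl fun k hk => ?_
      rw [Finset.mem_Icc] at hk
      rw [if_pos ⟨hk.2, by linarith⟩]
    · rw [Finset.mem_Icc] at hk
      rw [if_neg fun h => hk ⟨by linarith, h.1⟩, ENNReal.zero_rpow_of_pos hp0]
  have h2 : (∑ k ∈ Finset.Icc (j - N) j, e k ^ p) ^ (2 / p) ≤
      ((N : ℝ≥0∞) + 1) ^ (2 / p - 1) * ∑' k, e k ^ (2 : ℝ) := by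
    refine (ENNReal.rpow_sum_le_const_mul_sum_rpow _ _
      (by rw [le_div_iff₀ hp0]; linarith)).trans ?_
    have hcard : (Finset.Icc (j - N) j).card = N + 1 := by
      rw [Int.card_Icc]; omega
    rw [hcard]
    push_cast
    refine mul_le_mul' le_rfl ?_
    refine le_trans (le_of_eq (Finset.sum_congr rfl fun k _ => ?_)) (ENNReal.sum_le_tsum _)
    rw [← ENNReal.rpow_mul]
    congr 1
    field_simp
  have h3 := ENNReal.rpow_le_rpow h2 (by norm_num : (0 : ℝ) ≤ 1 / 2)
  rw [← ENNReal.rpow_mul, ENNReal.mul_rpow_of_nonneg _ _ (by norm_num), ← ENNReal.rpow_mul] at h3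
  rw [h1]
  convert h3 using 2 <;> [skip; congr 1] <;> field_simp

theorem exists_near_bound (hp : 1 < p) (hp2 : p < 2) (Λ : NNReal) (φ : SchwartzMap 𝔼 ℂ)
    (hsq : ∀ f : 𝔼 → ℂ, Nice f → ∑' k : ℤ, ∫⁻ x, ‖cv (dil ((2 : ℝ) ^ k) φ) f x‖ₑ ^ (2 : ℝ) ≤
      5 * ∫⁻ x, ‖f x‖ₑ ^ (2 : ℝ)) :
    ∃ C : NNReal, ∀ (N : ℕ) (ι : Type) (I : Finset ι) (W : ι → Set 𝔼) (z : ι → 𝔼) (j : ι → ℤ)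
      (c : ι → NNReal) (a : ι → 𝔼 → ℂ)
      (_ : ∀ i, BallAtom Λ (W i) (z i) (j i) (c i) (a i)),
      ∑' k : ℤ, ∫⁻ x, ‖cv (dil ((2 : ℝ) ^ k) φ)
          (fun y => ∑ i ∈ I with j i ≤ k + N, a i y) x‖ₑ ^ p ≤
        C * (((N : ℝ≥0∞) + 1) ^ (1 - p / 2) *
          ∫⁻ x, (∑ i ∈ I, (W i).indicator (fun _ => (c i : ℝ≥0∞)) x) ^ p) := by
  have hp0 : 0 < p := by linarith
  obtain ⟨C₁, hC₁⟩ := lintegral_sum_indicator_rpow_le (d := d) hp hp2 Λ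
  obtain ⟨C₂, hC₂⟩ := exists_enorm_cv_atom_le φ
  obtain ⟨C₃, hC₃⟩ := exists_lintegral_bumpKer_le d
  set w : ℤ → ℝ≥0∞ := fun n => ENNReal.ofReal (2 ^ (-(1 * |(n : ℝ)|))) with hw
  have hwt : ∑' n, w n ≠ ∞ := tsum_two_rpow_neg_abs_ne_top (by positivity)
  refine ⟨((2 : ℝ≥0∞) ^ (p - 1) * ((C₁ * 3 : ℝ≥0∞) ^ p +
    (C₂ * C₃ : ℝ≥0∞) ^ p * (∑' n, w n) ^ p)).toNNReal, ?_⟩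
  rw [ENNReal.coe_toNNReal (by finiteness)]
  intro N ι I W z j c a ha
  set g : ι → 𝔼 → ℝ≥0∞ := fun i => (W i).indicator (fun _ => (c i : ℝ≥0∞)) with hg
  have hgm : ∀ i, Measurable (g i) := fun i => measurable_const.indicator (ha i).measSet
  set Hk : ℤ → 𝔼 → ℝ≥0∞ := fun k y => ∑ i ∈ I, w (j i - k - 0) * g i y with hHk
  have hHm : ∀ k, Measurable (Hk k) := fun k =>
    Finset.measurable_sum _ fun i _ => (hgm i).const_mul _
  set E : ι → ℤ → 𝔼 → ℝ≥0∞ := fun i k x => ‖cv (dil ((2 : ℝ) ^ k) φ) (a i) x‖ₑ with hE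
  have hEm : ∀ i k, Measurable (E i k) := fun i k =>
    ((φ.niceKer.dil (by positivity)).continuous_cv (ha i).nice.int).measurable.enorm
  set Y : ℤ → 𝔼 → ℝ≥0∞ := fun k x => ∫⁻ y, (C₂ * bumpKer d (2 ^ k) (x - y)) * Hk k y with hY
  have hkm : ∀ k : ℤ, Measurable fun v : 𝔼 => C₂ * bumpKer d ((2 : ℝ) ^ k) v := fun k =>
    (measurable_bumpKer _).const_mul _
  have hYm : ∀ k, Measurable (Y k) := fun k => by
    refine Measurable.lintegral_prod_right' (f := fun v : 𝔼 × 𝔼 =>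
      (C₂ * bumpKer d (2 ^ k) (v.1 - v.2)) * Hk k v.2) ?_
    exact ((hkm k).comp (measurable_fst.sub measurable_snd)).mul ((hHm k).comp measurable_snd)
  set e : ι → ℤ → 𝔼 → ℝ≥0∞ := fun i k => (Metric.closedBall (z i) (2 * 2 ^ (j i))).indicator
    (fun x => if k ≤ j i ∧ j i ≤ k + N then E i k x else 0) with he
  have hem : ∀ i k, Measurable (e i k) := fun i k => by
    refine Measurable.indicator ?_ measurableSet_closedBall
    split_ifs
    · exact hEm i k
    · exact measurable_const
  set F : ι → 𝔼 → ℝ≥0∞ := fun i x => ((N : ℝ≥0∞) + 1) ^ (1 / p - 1 / 2) *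
    (∑' k, E i k x ^ (2 : ℝ)) ^ (1 / (2 : ℝ)) with hF
  have hFm : ∀ i, Measurable (F i) := fun i =>
    ((Measurable.tsum fun k => (hEm i k).pow_const _).pow_const _).const_mul _
  -- pointwise bound
  have hpt : ∀ k x, ‖cv (dil ((2 : ℝ) ^ k) φ) (fun y => ∑ i ∈ I with j i ≤ k + N, a i y) x‖ₑ ≤
      ∑ i ∈ I, e i k x + Y k x := by
    intro k x
    classical
    rw [(φ.niceKer.dil (by positivity)).cv_finset_sum _ fun i _ => (ha i).nice.int]
    refine (enorm_sum_le _ _).trans ?_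
    have h1 : ∀ i ∈ I.filter (fun i => j i ≤ k + N), E i k x ≤ e i k x +
        ∫⁻ y, (C₂ * bumpKer d (2 ^ k) (x - y)) * (w (j i - k - 0) * g i y) := by
      intro i hi
      rw [Finset.mem_filter] at hi
      by_cases hx : k ≤ j i ∧ x ∈ Metric.closedBall (z i) (2 * 2 ^ (j i))
      · refine le_add_right (le_of_eq ?_)
        simp only [he]
        rw [Set.indicator_of_mem hx.2, if_pos ⟨hx.1, hi.2⟩]
      · refine le_add_left ?_
        rw [sub_zero]
        exact hC₂ Λ (W i) (z i) (j i) (c i) (a i) (ha i) k x fun h1 h2 => hx ⟨h1, h2⟩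
    refine (Finset.sum_le_sum h1).trans
      ((Finset.sum_le_sum_of_subset (Finset.filter_subset _ _)).trans (le_of_eq ?_))
    rw [Finset.sum_add_distrib, ← lintegral_finsetSum]
    · simp only [hY, hHk, Finset.mul_sum]
    · exact fun i _ => ((hkm k).comp (measurable_const.sub measurable_id)).mul
        ((hgm i).const_mul _)
  have hX : ∑' k, ∫⁻ x, (∑ i ∈ I, e i k x) ^ p ≤
      (C₁ * 3) ^ p * (((N : ℝ≥0∞) + 1) ^ (1 - p / 2) * ∫⁻ x, (∑ i ∈ I, g i x) ^ p) := by
    rw [← lintegral_tsum fun k =>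
      ((Finset.measurable_sum _ fun i _ => hem i k).pow_const p).aemeasurable]
    have hD := hC₁ I z (fun i => 2 * 2 ^ (j i)) (fun i => by positivity) W
      (fun i => (ha i).measSet)
      (fun i => (ha i).sub.trans (Metric.closedBall_subset_closedBall (by
        have : (0 : ℝ) < 2 ^ j i := by positivity
        linarith))) (fun i => (ha i).vol) c F hFm
      (3 * ((N : NNReal) + 1) ^ (1 / p - 1 / 2)) fun i => ?_
    · refine le_trans (lintegral_mono fun x => ?_) (hD.trans (le_of_eq ?_))
      · refine (tsum_finset_sum_rpow_le hp.le I fun i k => e i k x).trans ?_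
        refine ENNReal.rpow_le_rpow (Finset.sum_le_sum fun i _ => ?_) hp0.le
        simp only [he]
        by_cases hx : x ∈ Metric.closedBall (z i) (2 * 2 ^ (j i))
        · simp only [Set.indicator_of_mem hx]
          exact tsum_window_rpow_le hp hp2 N (j i) fun k => E i k x
        · simp [Set.indicator_of_notMem hx, hp0]
      · rw [← mul_assoc]
        congr 1
        have hN1 : (((N : NNReal) + 1 : NNReal) : ℝ≥0∞) = (N : ℝ≥0∞) + 1 := by push_cast; rfl
        rw [ENNReal.coe_mul, ENNReal.coe_rpow_of_nonneg _ (by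
          rw [sub_nonneg]; exact one_div_le_one_div_of_le hp0 hp2.le), hN1, ← mul_assoc,
          ENNReal.mul_rpow_of_nonneg _ _ hp0.le, ← ENNReal.rpow_mul]
        congr 2
        field_simp
    · simp only [hF]
      have hN1 : (((N : NNReal) + 1 : NNReal) : ℝ≥0∞) = (N : ℝ≥0∞) + 1 := by push_cast; rfl
      rw [ENNReal.coe_mul, ENNReal.coe_rpow_of_nonneg _ (by
          rw [sub_nonneg]; exact one_div_le_one_div_of_le hp0 hp2.le), hN1]
      have h5 : ∫⁻ x, (((N : ℝ≥0∞) + 1) ^ (1 / p - 1 / 2) *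
          (∑' k, E i k x ^ (2 : ℝ)) ^ (1 / (2 : ℝ))) ^ (2 : ℝ) =
          (((N : ℝ≥0∞) + 1) ^ (1 / p - 1 / 2)) ^ (2 : ℝ) * ∑' k, ∫⁻ x, E i k x ^ (2 : ℝ) := by
        rw [← lintegral_tsum fun k => ((hEm i k).pow_const _).aemeasurable,
          ← lintegral_const_mul _ (Measurable.tsum fun k => (hEm i k).pow_const _)]
        refine lintegral_congr fun x => ?_
        rw [ENNReal.mul_rpow_of_nonneg _ _ (by norm_num), ← ENNReal.rpow_mul _ (1 / 2)]
        norm_num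
      rw [h5]
      refine (mul_le_mul' le_rfl ((hsq _ (ha i).nice).trans
        (mul_le_mul' le_rfl (ha i).lintegral_sq_le))).trans ?_
      rw [ENNReal.mul_rpow_of_nonneg _ _ (by norm_num), ENNReal.mul_rpow_of_nonneg _ _ (by norm_num)]
      have h9 : (5 : ℝ≥0∞) ≤ ((3 : NNReal) : ℝ≥0∞) ^ (2 : ℝ) := by
        rw [ENNReal.rpow_ofNat]; norm_num
      calc _ = 5 * ((((N : ℝ≥0∞) + 1) ^ (1 / p - 1 / 2)) ^ (2 : ℝ) *
            ((c i : ℝ≥0∞) ^ (2 : ℝ) * volume (W i))) := by ring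
        _ ≤ ((3 : NNReal) : ℝ≥0∞) ^ (2 : ℝ) * ((((N : ℝ≥0∞) + 1) ^ (1 / p - 1 / 2)) ^ (2 : ℝ) *
            ((c i : ℝ≥0∞) ^ (2 : ℝ) * volume (W i))) := mul_le_mul' h9 le_rfl
        _ = _ := by ring
  have hYs : ∑' k, ∫⁻ x, Y k x ^ p ≤ (C₂ * C₃ : ℝ≥0∞) ^ p * (∑' n, w n) ^ p *
      ∫⁻ x, (∑ i ∈ I, g i x) ^ p := by
    have h1 : ∀ k, ∫⁻ x, Y k x ^ p ≤ (C₂ * C₃ : ℝ≥0∞) ^ p * ∫⁻ x, Hk k x ^ p := fun k => by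
      refine (lintegral_young volume hp (hkm k) (hHm k).aemeasurable).trans ?_
      refine mul_le_mul' (ENNReal.rpow_le_rpow ?_ hp0.le) le_rfl
      rw [lintegral_const_mul _ (measurable_bumpKer _)]
      exact mul_le_mul' le_rfl (hC₃ _ (by positivity))
    refine (ENNReal.tsum_le_tsum h1).trans ?_
    rw [ENNReal.tsum_mul_left, mul_assoc]
    exact mul_le_mul' le_rfl (tsum_lintegral_weighted_sum_rpow_le hp.le I w j 0 g hgm)
  have hN : (1 : ℝ≥0∞) ≤ ((N : ℝ≥0∞) + 1) ^ (1 - p / 2) :=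
    ENNReal.one_le_rpow (by simp) (by linarith)
  calc _ ≤ ∑' k, ∫⁻ x, 2 ^ (p - 1) * ((∑ i ∈ I, e i k x) ^ p + Y k x ^ p) :=
        ENNReal.tsum_le_tsum fun k => lintegral_mono fun x =>
          (ENNReal.rpow_le_rpow (hpt k x) hp0.le).trans
            (ENNReal.rpow_add_le_mul_rpow_add_rpow _ _ hp.le)
    _ = 2 ^ (p - 1) * ((∑' k, ∫⁻ x, (∑ i ∈ I, e i k x) ^ p) + ∑' k, ∫⁻ x, Y k x ^ p) := by
        rw [← ENNReal.tsum_add, ← ENNReal.tsum_mul_left]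
        refine tsum_congr fun k => ?_
        rw [lintegral_const_mul' _ _ (by finiteness), lintegral_add_right _ ((hYm k).pow_const p)]
    _ ≤ 2 ^ (p - 1) * ((C₁ * 3) ^ p * (((N : ℝ≥0∞) + 1) ^ (1 - p / 2) *
          ∫⁻ x, (∑ i ∈ I, g i x) ^ p) + (C₂ * C₃ : ℝ≥0∞) ^ p * (∑' n, w n) ^ p *
          (((N : ℝ≥0∞) + 1) ^ (1 - p / 2) * ∫⁻ x, (∑ i ∈ I, g i x) ^ p)) := by
        refine mul_le_mul' le_rfl (add_le_add hX (hYs.trans (mul_le_mul' le_rfl ?_)))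
        exact le_mul_of_one_le_left bot_le hN
    _ = _ := by ring

end

section

variable {p ε lam A B : ℝ}

theorem Nice.finset_sum {ι : Type*} (I : Finset ι) {F : ι → 𝔼 → ℂ} (hF : ∀ i ∈ I, Nice (F i)) :
    Nice fun y => ∑ i ∈ I, F i y := by
  refine ⟨Finset.measurable_fun_sum _ fun i hi => (hF i hi).meas,
    integrable_finsetSum _ fun i hi => (hF i hi).int, ?_⟩
  choose! C hC using fun i hi => (hF i hi).bdd
  exact ⟨∑ i ∈ I, C i, fun x => (norm_sum_le _ _).trans (Finset.sum_le_sum fun i hi => hC i hi x)⟩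

theorem AdmPair.tsum_lintegral_sobMaj_L2_le {φ : SchwartzMap 𝔼 ℂ}
    {K L f : EuclideanSpace ℝ (Fin d) → ℂ}
    (H : AdmPair p ε lam A B φ K L) (hf : Nice f)
    (hsq : ∀ f : 𝔼 → ℂ, Nice f → ∑' k : ℤ, ∫⁻ x, ‖cv (dil ((2 : ℝ) ^ k) φ) f x‖ₑ ^ (2 : ℝ) ≤
      5 * ∫⁻ x, ‖f x‖ₑ ^ (2 : ℝ)) :
    ∑' k : ℤ, ∫⁻ x, sobMaj lam 2 (2 ^ k) K L f x ≤
      ENNReal.ofReal lam * 2 ^ (2 : ℝ) * (ENNReal.ofReal A ^ (2 : ℝ) *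
        (5 * ∫⁻ x, ‖f x‖ₑ ^ (2 : ℝ))) := by
  refine (ENNReal.tsum_le_tsum fun k =>
    H.lintegral_sobMaj_L2 φ.niceKer hf (S := (2 : ℝ) ^ k) (by positivity)).trans ?_
  rw [ENNReal.tsum_mul_left, ENNReal.tsum_mul_left]
  exact mul_le_mul' le_rfl (mul_le_mul' le_rfl (hsq f hf))

theorem exists_maximal_atoms_bound (hp : 1 < p) (hp2 : p < 2) (hε : 0 < ε) (Λ : NNReal)
    (φ : SchwartzMap 𝔼 ℂ)
    (hsq : ∀ f : 𝔼 → ℂ, Nice f → ∑' k : ℤ, ∫⁻ x, ‖cv (dil ((2 : ℝ) ^ k) φ) f x‖ₑ ^ (2 : ℝ) ≤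
      5 * ∫⁻ x, ‖f x‖ₑ ^ (2 : ℝ)) :
    ∃ C : NNReal, ∀ (K L : 𝔼 → ℂ) (lam A B : ℝ) (_ : AdmPair p ε lam A B φ K L) (_ : 0 < A)
      (N : ℕ) (_ : B ≤ A * 2 ^ (ε * N)) (ι : Type) (I : Finset ι) (W : ι → Set 𝔼) (z : ι → 𝔼)
      (j : ι → ℤ) (c : ι → NNReal) (a : ι → 𝔼 → ℂ)
      (_ : ∀ i, BallAtom Λ (W i) (z i) (j i) (c i) (a i)),
      ∃ G : 𝔼 → ℝ≥0∞, Measurable G ∧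
        ∫⁻ x, G x ^ p ≤ C * (ENNReal.ofReal lam * ENNReal.ofReal A ^ p *
          (((N : ℝ≥0∞) + 1) ^ (1 - p / 2) *
            ∫⁻ x, (∑ i ∈ I, (W i).indicator (fun _ => (c i : ℝ≥0∞)) x) ^ p)) ∧
        ∀ x t, 0 < t → ‖cv (dil t K) (fun y => ∑ i ∈ I, a i y) x‖ₑ ≤ G x := by
  have hp0 : 0 < p := by linarith
  obtain ⟨C₁, hC₁⟩ := lintegral_sum_indicator_rpow_le (d := d) hp hp2 Λ
  obtain ⟨C₂, hC₂⟩ := exists_near_bound hp hp2 Λ φ hsq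
  obtain ⟨C₃, hC₃⟩ := exists_far_majorant hp hε
  refine ⟨((2 : ℝ≥0∞) ^ (p - 1) * (2 ^ p * C₂ + 2 ^ (p - 1) *
    ((C₁ * 5 : ℝ≥0∞) ^ p + C₃))).toNNReal, ?_⟩
  rw [ENNReal.coe_toNNReal (by finiteness)]
  intro K L lam A B H hA N hN ι I W z j c a ha
  have hlam : 1 ≤ lam := H.one_le
  obtain ⟨G₃, hG₃m, hG₃i, hG₃⟩ := hC₃ d φ K L lam A B H hA N hN Λ ι I W z j c a ha
  set X : ℝ≥0∞ := ∫⁻ x, (∑ i ∈ I, (W i).indicator (fun _ => (c i : ℝ≥0∞)) x) ^ p with hX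
  set β : ℤ → 𝔼 → ℂ := fun k y => ∑ i ∈ I with j i ≤ k + N, a i y with hβ
  have hβn : ∀ k, Nice (β k) := fun k => Nice.finset_sum _ fun i _ => (ha i).nice
  set G₁ : 𝔼 → ℝ≥0∞ := fun x => ∑' k : ℤ, sobMaj lam p (2 ^ k) K L (β k) x with hG₁
  have hs1 : ∀ k : ℤ, Measurable (sobMaj lam p (2 ^ k) K L (β k)) := fun k =>
    measurable_sobMaj _ _ _ H.left.ker H.right.ker (hβn k).meas
  have hG₁m : Measurable G₁ := Measurable.tsum hs1
  have hG₁i : ∫⁻ x, G₁ x ≤ ENNReal.ofReal lam * 2 ^ p * (ENNReal.ofReal A ^ p *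
      (C₂ * (((N : ℝ≥0∞) + 1) ^ (1 - p / 2) * X))) := by
    rw [lintegral_tsum fun k => (hs1 k).aemeasurable]
    refine (ENNReal.tsum_le_tsum fun k =>
      H.lintegral_sobMaj_Lp φ.niceKer (hβn k) (S := (2 : ℝ) ^ k) (by positivity)).trans ?_
    rw [ENNReal.tsum_mul_left, ENNReal.tsum_mul_left]
    exact mul_le_mul' le_rfl (mul_le_mul' le_rfl (hC₂ N ι I W z j c a ha))
  set F : ι → 𝔼 → ℝ≥0∞ := fun i x =>
    (∑' k : ℤ, sobMaj lam 2 (2 ^ k) K L (a i) x) ^ (1 / (2 : ℝ)) with hF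
  have hs2 : ∀ i (k : ℤ), Measurable (sobMaj lam 2 (2 ^ k) K L (a i)) := fun i k =>
    measurable_sobMaj _ _ _ H.left.ker H.right.ker (ha i).meas
  have hFm : ∀ i, Measurable (F i) := fun i => (Measurable.tsum (hs2 i)).pow_const _
  set G₂ : 𝔼 → ℝ≥0∞ := fun x =>
    ∑ i ∈ I, (Metric.closedBall (z i) (2 * 2 ^ (j i))).indicator (F i) x with hG₂
  have hG₂m : Measurable G₂ := Finset.measurable_sum _ fun i _ =>
    (hFm i).indicator measurableSet_closedBall
  have hG₂i : ∫⁻ x, G₂ x ^ p ≤ (C₁ * 5 : ℝ≥0∞) ^ p *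
      (ENNReal.ofReal lam * ENNReal.ofReal A ^ p * X) := by
    refine (hC₁ I z (fun i => 2 * 2 ^ (j i)) (fun i => by positivity) W
      (fun i => (ha i).measSet)
      (fun i => (ha i).sub.trans (Metric.closedBall_subset_closedBall (by
        have : (0 : ℝ) < 2 ^ j i := by positivity
        linarith))) (fun i => (ha i).vol) c F hFm
      (5 * lam.toNNReal ^ (1 / (2 : ℝ)) * A.toNNReal) fun i => ?_).trans ?_
    · have h1 : ∫⁻ x, F i x ^ (2 : ℝ) = ∑' k : ℤ, ∫⁻ x, sobMaj lam 2 (2 ^ k) K L (a i) x := by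
        rw [← lintegral_tsum fun k => (hs2 i k).aemeasurable]
        refine lintegral_congr fun x => ?_
        rw [← ENNReal.rpow_mul]
        norm_num
      rw [h1]
      refine (H.tsum_lintegral_sobMaj_L2_le (ha i).nice hsq).trans ?_
      refine (mul_le_mul' le_rfl (mul_le_mul' le_rfl
        (mul_le_mul' le_rfl (ha i).lintegral_sq_le))).trans ?_
      push_cast [ENNReal.coe_rpow_of_nonneg]
      rw [ENNReal.mul_rpow_of_nonneg _ _ (by norm_num), ENNReal.mul_rpow_of_nonneg _ _ (by norm_num),
        ENNReal.mul_rpow_of_nonneg _ _ (by norm_num), ENNReal.coe_rpow_of_nonneg _ (by norm_num),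
        ← ENNReal.rpow_mul _ (1 / 2)]
      norm_num only [one_div, inv_mul_cancel₀, ENNReal.rpow_one]
      rw [ENNReal.rpow_ofNat 2, ENNReal.rpow_ofNat 5]
      have h9 : (2 : ℝ≥0∞) ^ 2 * 5 ≤ 5 ^ 2 := by norm_num
      change ENNReal.ofReal lam * 2 ^ 2 * (ENNReal.ofReal A ^ (2 : ℝ) *
        (5 * ((c i : ℝ≥0∞) ^ (2 : ℝ) * volume (W i)))) ≤
        5 ^ 2 * ENNReal.ofReal lam * ENNReal.ofReal A ^ (2 : ℝ) *
          (c i : ℝ≥0∞) ^ (2 : ℝ) * volume (W i)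
      calc _ = (2 ^ 2 * 5) * (ENNReal.ofReal lam * ENNReal.ofReal A ^ (2 : ℝ) *
          (c i : ℝ≥0∞) ^ (2 : ℝ) * volume (W i)) := by ring
        _ ≤ 5 ^ 2 * (ENNReal.ofReal lam * ENNReal.ofReal A ^ (2 : ℝ) *
          (c i : ℝ≥0∞) ^ (2 : ℝ) * volume (W i)) := mul_le_mul' h9 le_rfl
        _ = _ := by ring
    · rw [← mul_assoc ((C₁ * 5 : ℝ≥0∞) ^ p)]
      refine mul_le_mul' ?_ le_rfl
      have h1 : ENNReal.ofReal lam ^ (p / 2) ≤ ENNReal.ofReal lam := by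
        refine (ENNReal.rpow_le_rpow_of_exponent_le (by simpa using hlam)
          (by linarith : p / 2 ≤ 1)).trans (le_of_eq (ENNReal.rpow_one _))
      rw [ENNReal.coe_mul, ENNReal.coe_mul, ENNReal.coe_rpow_of_nonneg _ (by norm_num)]
      change (C₁ * (5 * ENNReal.ofReal lam ^ (1 / (2 : ℝ)) * ENNReal.ofReal A)) ^ p ≤ _
      rw [← mul_assoc, ← mul_assoc, ENNReal.mul_rpow_of_nonneg _ _ hp0.le,
        ENNReal.mul_rpow_of_nonneg _ _ hp0.le, ← ENNReal.rpow_mul, mul_assoc]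
      rw [show 1 / 2 * p = p / 2 by ring]
      exact mul_le_mul' le_rfl (mul_le_mul' h1 le_rfl)
  refine ⟨fun x => G₁ x ^ (1 / p) + (G₂ x + G₃ x ^ (1 / p)),
    (hG₁m.pow_const _).add (hG₂m.add (hG₃m.pow_const _)), ?_, ?_⟩
  · have hpp : ∀ y : ℝ≥0∞, (y ^ (1 / p)) ^ p = y := fun y => by
      rw [← ENNReal.rpow_mul, one_div_mul_cancel hp0.ne', ENNReal.rpow_one]
    have hpt : ∀ x, (G₁ x ^ (1 / p) + (G₂ x + G₃ x ^ (1 / p))) ^ p ≤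
        2 ^ (p - 1) * (G₁ x + 2 ^ (p - 1) * (G₂ x ^ p + G₃ x)) := by
      intro x
      refine (ENNReal.rpow_add_le_mul_rpow_add_rpow _ _ hp.le).trans ?_
      refine mul_le_mul' le_rfl (add_le_add (hpp _).le ?_)
      refine (ENNReal.rpow_add_le_mul_rpow_add_rpow _ _ hp.le).trans ?_
      rw [hpp]
    have hN1 : (1 : ℝ≥0∞) ≤ ((N : ℝ≥0∞) + 1) ^ (1 - p / 2) :=
      ENNReal.one_le_rpow (by simp) (by linarith)
    have hXN : X ≤ ((N : ℝ≥0∞) + 1) ^ (1 - p / 2) * X := le_mul_of_one_le_left bot_le hN1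
    refine (lintegral_mono hpt).trans ?_
    rw [lintegral_const_mul' _ _ (by finiteness), lintegral_add_left hG₁m,
      lintegral_const_mul' _ _ (by finiteness), lintegral_add_left (hG₂m.pow_const _)]
    calc _ ≤ 2 ^ (p - 1) * (ENNReal.ofReal lam * 2 ^ p * (ENNReal.ofReal A ^ p *
          (C₂ * (((N : ℝ≥0∞) + 1) ^ (1 - p / 2) * X))) + 2 ^ (p - 1) *
          ((C₁ * 5 : ℝ≥0∞) ^ p * (ENNReal.ofReal lam * ENNReal.ofReal A ^ p *
            (((N : ℝ≥0∞) + 1) ^ (1 - p / 2) * X)) + C₃ * (ENNReal.ofReal lam * ENNReal.ofReal A ^ p *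
            (((N : ℝ≥0∞) + 1) ^ (1 - p / 2) * X)))) := by
          refine mul_le_mul' le_rfl (add_le_add hG₁i (mul_le_mul' le_rfl (add_le_add
            (hG₂i.trans ?_) (hG₃i.trans ?_))))
          · exact mul_le_mul' le_rfl (mul_le_mul' le_rfl hXN)
          · exact mul_le_mul' le_rfl (mul_le_mul' le_rfl hXN)
      _ = _ := by ring
  · intro x t ht
    classical
    obtain ⟨k, hk1, hk2⟩ := exists_mem_Ico_zpow ht (one_lt_two : (1 : ℝ) < 2)
    have hk2' : t ≤ 2 * 2 ^ k := by
      rw [zpow_add_one₀ (by norm_num)] at hk2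
      linarith
    have htk : t ∈ Set.Icc ((2 : ℝ) ^ k) (2 * 2 ^ k) := ⟨hk1, hk2'⟩
    have hroot : ∀ {u v : ℝ≥0∞}, u ^ p ≤ v → u ≤ v ^ (1 / p) := fun {u v} h => by
      rwa [one_div, ENNReal.le_rpow_inv_iff hp0]
    set J := I.filter fun i => ¬ j i ≤ k + N with hJ
    set J₁ := J.filter fun i => x ∈ Metric.closedBall (z i) (2 * 2 ^ (j i)) with hJ₁
    set J₂ := J.filter fun i => ¬ x ∈ Metric.closedBall (z i) (2 * 2 ^ (j i)) with hJ₂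
    have hKd : NiceKer (dil t K) := H.left.ker.dil ht
    have hJI : J ⊆ I := Finset.filter_subset _ _
    have hcs : ∀ J' : Finset ι, cv (dil t K) (fun y => ∑ i ∈ J', a i y) x =
        ∑ i ∈ J', cv (dil t K) (a i) x := fun J' => by
      rw [hKd.cv_finset_sum J' fun i _ => (ha i).nice.int]
    have hsplit : cv (dil t K) (fun y => ∑ i ∈ I, a i y) x = cv (dil t K) (β k) x +
        (∑ i ∈ J₁, cv (dil t K) (a i) x + cv (dil t K) (fun y => ∑ i ∈ J₂, a i y) x) := by
      rw [hcs, hcs J₂, hβ]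
      simp only
      rw [hcs, Finset.sum_filter_add_sum_filter_not, Finset.sum_filter_add_sum_filter_not]
    rw [hsplit]
    refine (enorm_add_le _ _).trans (add_le_add ?_ ((enorm_add_le _ _).trans (add_le_add ?_ ?_)))
    · refine hroot ((H.enorm_rpow_le_sobMaj hp (hβn k).int x (by positivity) htk).trans ?_)
      exact ENNReal.le_tsum (f := fun k : ℤ => sobMaj lam p (2 ^ k) K L (β k) x) k
    · refine (enorm_sum_le _ _).trans ?_
      refine le_trans ?_ (Finset.sum_le_sum_of_subset
        ((Finset.filter_subset _ _).trans hJI : J₁ ⊆ I))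
      refine Finset.sum_le_sum fun i hi => ?_
      rw [Set.indicator_of_mem (Finset.mem_filter.1 hi).2]
      have h2 := (H.enorm_rpow_le_sobMaj one_lt_two (ha i).nice.int x (by positivity) htk).trans
        (ENNReal.le_tsum (f := fun k : ℤ => sobMaj lam 2 (2 ^ k) K L (a i) x) k)
      simp only [hF]
      rwa [one_div, ENNReal.le_rpow_inv_iff (by norm_num)]
    · refine hroot (hG₃ x k t htk J₂ ((Finset.filter_subset _ _).trans hJI) fun i hi => ?_)
      rw [hJ₂, Finset.mem_filter, hJ, Finset.mem_filter] at hi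
      exact ⟨not_le.1 hi.1.2, hi.2⟩

end

section

variable {X T : Type} [MeasurableSpace X] {μ : Measure X} {q : ℕ → X → T} {V : ℕ → ℝ} {D : ℝ}
  {f : X → ℂ}

/-- The average over the cell of generation `j`. -/
def gridAvg (μ : Measure X) (q : ℕ → X → T) (V : ℕ → ℝ) (f : X → ℂ) (j : ℕ) (x : X) : ℂ :=
  ((V j)⁻¹ : ℝ) * ∫ y in q j ⁻¹' {q j x}, f y ∂μ

/-- The average of the absolute value over the cell of generation `j`. -/
def gridAbsAvg (μ : Measure X) (q : ℕ → X → T) (V : ℕ → ℝ) (f : X → ℂ) (j : ℕ) (x : X) : ℝ :=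
  (V j)⁻¹ * ∫ y in q j ⁻¹' {q j x}, ‖f y‖ ∂μ

open Classical in
/-- The average over the largest cell of generation at most `j` on which the average of the
absolute value exceeds `s`, or over the smallest cell if there is none. -/
def gridStop (μ : Measure X) (q : ℕ → X → T) (V : ℕ → ℝ) (f : X → ℂ) (s : ℝ) : ℕ → X → ℂ
  | 0, x => gridAvg μ q V f 0 x
  | j + 1, x => if s < gridAbsAvg μ q V f (j + 1) x then gridAvg μ q V f (j + 1) x
      else gridStop μ q V f s j x

theorem norm_gridAvg_le (hV : ∀ j, 0 < V j) (j : ℕ) (x : X) :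
    ‖gridAvg μ q V f j x‖ ≤ gridAbsAvg μ q V f j x := by
  rw [gridAvg, gridAbsAvg, norm_mul, Complex.norm_real, Real.norm_of_nonneg (by
    have := hV j; positivity)]
  exact mul_le_mul_of_nonneg_left (norm_integral_le_integral_norm _) (by
    have := hV j; positivity)

theorem gridAvg_congr (j : ℕ) {x y : X} (h : q j x = q j y) :
    gridAvg μ q V f j x = gridAvg μ q V f j y := by
  rw [gridAvg, gridAvg, h]

theorem gridAbsAvg_congr (j : ℕ) {x y : X} (h : q j x = q j y) :
    gridAbsAvg μ q V f j x = gridAbsAvg μ q V f j y := by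
  rw [gridAbsAvg, gridAbsAvg, h]

theorem gridStop_eq_of_forall_le {s : ℝ} {j M : ℕ} (hjM : j ≤ M) {x : X}
    (h : ∀ i, j < i → i ≤ M → gridAbsAvg μ q V f i x ≤ s) :
    gridStop μ q V f s M x = gridStop μ q V f s j x := by
  induction M, hjM using Nat.le_induction with
  | base => rfl
  | succ M hM ih =>
    rw [gridStop, if_neg (not_lt.2 (h _ (by omega) le_rfl))]
    exact ih fun i h1 h2 => h i h1 (by omega)

theorem norm_gridStop_le_of_lt (hV : ∀ j, 0 < V j) {s : ℝ} {j : ℕ} {x : X}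
    (h : s < gridAbsAvg μ q V f j x) :
    ‖gridStop μ q V f s j x‖ ≤ gridAbsAvg μ q V f j x := by
  cases j with
  | zero => exact norm_gridAvg_le hV 0 x
  | succ j =>
    rw [gridStop, if_pos h]
    exact norm_gridAvg_le hV _ x

variable [MeasurableSpace T]

/-- A decreasing sequence of countable partitions into sets whose measure only depends on the
generation; `q j x` is the label of the set of generation `j` containing `x`. -/
structure GridSeq {X T : Type} [MeasurableSpace X] [MeasurableSpace T] (μ : Measure X)
    (q : ℕ → X → T) (V : ℕ → ℝ) (D : ℝ) : Prop where
  meas : ∀ j, Measurable (q j)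
  parent : ∃ r : T → T, ∀ j x, q (j + 1) x = r (q j x)
  pos : ∀ j, 0 < V j
  vol : ∀ j x, μ (q j ⁻¹' {q j x}) = ENNReal.ofReal (V j)
  growth : ∀ j, V (j + 1) ≤ D * V j

theorem GridSeq.eq_of_le (H : GridSeq μ q V D) {j i : ℕ} (hji : j ≤ i) {x y : X}
    (h : q j x = q j y) : q i x = q i y := by
  obtain ⟨r, hr⟩ := H.parent
  induction i, hji using Nat.le_induction with
  | base => exact h
  | succ i _ ih => rw [hr, hr, ih]

theorem GridSeq.gridAbsAvg_le_succ (H : GridSeq μ q V D) (hf : Integrable f μ) (j : ℕ) (x : X) :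
    gridAbsAvg μ q V f j x ≤ D * gridAbsAvg μ q V f (j + 1) x := by
  have h1 : ∫ y in q j ⁻¹' {q j x}, ‖f y‖ ∂μ ≤ ∫ y in q (j + 1) ⁻¹' {q (j + 1) x}, ‖f y‖ ∂μ := by
    refine setIntegral_mono_set hf.norm.integrableOn (Filter.Eventually.of_forall fun _ =>
      norm_nonneg _) (LE.le.eventuallyLE fun y hy => ?_)
    exact H.eq_of_le (Nat.le_succ j) hy
  have hV := H.pos j
  have hV1 := H.pos (j + 1)
  have h2 : (V j)⁻¹ ≤ D * (V (j + 1))⁻¹ := by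
    rw [inv_le_iff_one_le_mul₀ hV, mul_assoc, inv_mul_eq_div, mul_div_assoc', le_div_iff₀ hV1,
      one_mul]
    exact H.growth j
  rw [gridAbsAvg, gridAbsAvg, ← mul_assoc]
  exact mul_le_mul h2 h1 (integral_nonneg fun _ => norm_nonneg _)
    ((inv_pos.2 hV).le.trans h2)

theorem GridSeq.gridAbsAvg_le (H : GridSeq μ q V D) {b : ℝ} (hb : ∀ x, ‖f x‖ ≤ b) (j : ℕ) (x : X) :
    gridAbsAvg μ q V f j x ≤ b := by
  have hV := H.pos j
  have h1 : ∫ y in q j ⁻¹' {q j x}, ‖f y‖ ∂μ ≤ b * V j := by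
    have h2 := norm_setIntegral_le_of_norm_le_const (μ := μ) (s := q j ⁻¹' {q j x})
      (f := fun y => ‖f y‖) (C := b) (by rw [H.vol]; exact ENNReal.ofReal_lt_top)
      (fun y _ => by rw [norm_norm]; exact hb y)
    rw [measureReal_def, H.vol, ENNReal.toReal_ofReal hV.le] at h2
    exact (le_abs_self _).trans h2
  rw [gridAbsAvg, inv_mul_le_iff₀ hV]
  linarith

theorem GridSeq.gridAbsAvg_le_integral (H : GridSeq μ q V D) (hf : Integrable f μ) (j : ℕ) (x : X) :
    gridAbsAvg μ q V f j x ≤ (V j)⁻¹ * ∫ y, ‖f y‖ ∂μ := by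
  have hV := H.pos j
  exact mul_le_mul_of_nonneg_left (setIntegral_le_integral hf.norm
    (Filter.Eventually.of_forall fun _ => norm_nonneg _)) (by positivity)

theorem GridSeq.norm_gridStop_le (H : GridSeq μ q V D) (hD : 1 ≤ D) (hf : Integrable f μ) {s : ℝ}
    (hs : 0 ≤ s) {j : ℕ} {x : X} (h : gridAbsAvg μ q V f j x ≤ s) :
    ‖gridStop μ q V f s j x‖ ≤ D * s := by
  induction j with
  | zero =>
    refine (norm_gridAvg_le H.pos 0 x).trans (h.trans ?_)
    nlinarith
  | succ j ih =>
    rw [gridStop, if_neg (not_lt.2 h)]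
    by_cases h1 : gridAbsAvg μ q V f j x ≤ s
    · exact ih h1
    · refine (norm_gridStop_le_of_lt H.pos (not_le.1 h1)).trans
        ((H.gridAbsAvg_le_succ hf j x).trans ?_)
      exact mul_le_mul_of_nonneg_left h (by linarith)

theorem GridSeq.norm_gridStop_le_bound (H : GridSeq μ q V D) {b : ℝ} (hb : ∀ x, ‖f x‖ ≤ b) (s : ℝ)
    (j : ℕ) (x : X) : ‖gridStop μ q V f s j x‖ ≤ b := by
  have h1 : ∀ j, ‖gridAvg μ q V f j x‖ ≤ b := fun j =>
    (norm_gridAvg_le H.pos j x).trans (H.gridAbsAvg_le hb j x)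
  induction j with
  | zero => exact h1 0
  | succ j ih =>
    rw [gridStop]
    split_ifs
    · exact h1 _
    · exact ih

theorem GridSeq.integrableOn_cell (H : GridSeq μ q V D) {F : X → ℂ} (hF : Measurable F) {b : ℝ}
    (hb : ∀ x, ‖F x‖ ≤ b) (j : ℕ) (x : X) : IntegrableOn F (q j ⁻¹' {q j x}) μ :=
  IntegrableOn.of_bound (by rw [H.vol]; exact ENNReal.ofReal_lt_top) hF.aestronglyMeasurable b
    (Filter.Eventually.of_forall hb)

variable [MeasurableSingletonClass T]

theorem GridSeq.measurableSet_cell (H : GridSeq μ q V D) (j : ℕ) (n : T) :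
    MeasurableSet (q j ⁻¹' {n}) := H.meas j (measurableSet_singleton n)

theorem GridSeq.setIntegral_gridAvg (H : GridSeq μ q V D) (f : X → ℂ) (j : ℕ) (x : X) :
    ∫ y in q j ⁻¹' {q j x}, gridAvg μ q V f j y ∂μ = ∫ y in q j ⁻¹' {q j x}, f y ∂μ := by
  have hV := H.pos j
  rw [setIntegral_congr_fun (H.measurableSet_cell j (q j x))
    (fun y (hy : q j y = q j x) => gridAvg_congr j hy), setIntegral_const, measureReal_def, H.vol,
    ENNReal.toReal_ofReal hV.le, gridAvg, Complex.real_smul, ← mul_assoc, ← Complex.ofReal_mul,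
    mul_inv_cancel₀ hV.ne', Complex.ofReal_one, one_mul]

variable [Countable T]

theorem GridSeq.measurable_gridAvg (H : GridSeq μ q V D) (f : X → ℂ) (j : ℕ) :
    Measurable (gridAvg μ q V f j) :=
  (measurable_of_countable fun n : T => ((V j)⁻¹ : ℝ) * ∫ y in q j ⁻¹' {n}, f y ∂μ).comp (H.meas j)

theorem GridSeq.measurable_gridAbsAvg (H : GridSeq μ q V D) (f : X → ℂ) (j : ℕ) :
    Measurable (gridAbsAvg μ q V f j) :=
  (measurable_of_countable fun n : T => (V j)⁻¹ * ∫ y in q j ⁻¹' {n}, ‖f y‖ ∂μ).comp (H.meas j)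

theorem GridSeq.measurable_gridStop (H : GridSeq μ q V D) (f : X → ℂ) (s : ℝ) (j : ℕ) :
    Measurable (gridStop μ q V f s j) := by
  induction j with
  | zero => exact H.measurable_gridAvg f 0
  | succ j ih =>
    exact Measurable.ite (measurableSet_lt measurable_const (H.measurable_gridAbsAvg f _))
      (H.measurable_gridAvg f _) ih

theorem GridSeq.setIntegral_eq_succ (H : GridSeq μ q V D) {F G : X → ℂ} (hF : Measurable F)
    (hG : Measurable G) {b : ℝ} (hFb : ∀ x, ‖F x‖ ≤ b) (hGb : ∀ x, ‖G x‖ ≤ b) (j : ℕ)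
    (h : ∀ x, ∫ y in q j ⁻¹' {q j x}, F y ∂μ = ∫ y in q j ⁻¹' {q j x}, G y ∂μ) (x : X) :
    ∫ y in q (j + 1) ⁻¹' {q (j + 1) x}, F y ∂μ = ∫ y in q (j + 1) ⁻¹' {q (j + 1) x}, G y ∂μ := by
  obtain ⟨r, hr⟩ := H.parent
  have hU : q (j + 1) ⁻¹' {q (j + 1) x} = ⋃ n : {n : T // r n = q (j + 1) x}, q j ⁻¹' {n.1} := by
    ext y
    simp only [Set.mem_preimage, Set.mem_singleton_iff, Set.mem_iUnion]
    rw [hr j y]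
    exact ⟨fun hy => ⟨⟨q j y, hy⟩, rfl⟩, fun ⟨n, hn⟩ => by rw [hn]; exact n.2⟩
  have hd : Pairwise fun n n' : {n : T // r n = q (j + 1) x} =>
      Disjoint (q j ⁻¹' {n.1}) (q j ⁻¹' {n'.1}) := fun n n' hn =>
    Disjoint.preimage _ (Set.disjoint_singleton.2 fun h => hn (Subtype.ext h))
  have key : ∀ E : X → ℂ, IntegrableOn E (q (j + 1) ⁻¹' {q (j + 1) x}) μ →
      ∫ y in q (j + 1) ⁻¹' {q (j + 1) x}, E y ∂μ =
        ∑' n : {n : T // r n = q (j + 1) x}, ∫ y in q j ⁻¹' {n.1}, E y ∂μ := by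
    intro E hE
    rw [hU] at hE ⊢
    exact integral_iUnion (fun n => H.measurableSet_cell j n.1) hd hE
  rw [key F (H.integrableOn_cell hF hFb (j + 1) x), key G (H.integrableOn_cell hG hGb (j + 1) x)]
  refine tsum_congr fun n => ?_
  rcases (q j ⁻¹' {n.1}).eq_empty_or_nonempty with h0 | ⟨y, hy⟩
  · rw [h0]; simp
  · rw [Set.mem_preimage, Set.mem_singleton_iff] at hy
    rw [← hy]
    exact h y

theorem GridSeq.setIntegral_gridStop (H : GridSeq μ q V D) (hf : Measurable f) {b : ℝ}
    (hb : ∀ x, ‖f x‖ ≤ b) (s : ℝ) (j : ℕ) (x : X) :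
    ∫ y in q j ⁻¹' {q j x}, gridStop μ q V f s j y ∂μ = ∫ y in q j ⁻¹' {q j x}, f y ∂μ := by
  induction j generalizing x with
  | zero => exact H.setIntegral_gridAvg f 0 x
  | succ j ih =>
    by_cases h : s < gridAbsAvg μ q V f (j + 1) x
    · rw [← H.setIntegral_gridAvg f (j + 1) x]
      refine setIntegral_congr_fun (H.measurableSet_cell _ _) fun y (hy : q (j + 1) y = _) => ?_
      simp only [gridStop]
      rw [if_pos (by rwa [gridAbsAvg_congr (j + 1) hy])]
    · rw [← H.setIntegral_eq_succ (H.measurable_gridStop f s j) hf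
        (H.norm_gridStop_le_bound hb s j) hb j ih x]
      refine setIntegral_congr_fun (H.measurableSet_cell _ _) fun y (hy : q (j + 1) y = _) => ?_
      simp only [gridStop]
      rw [if_neg (by rwa [gridAbsAvg_congr (j + 1) hy])]

end

section

variable {X T : Type} [MeasurableSpace X] {μ : Measure X} {q : ℕ → X → T} {V : ℕ → ℝ} {D : ℝ}
  {f : X → ℂ} [MeasurableSpace T] [MeasurableSingletonClass T]

theorem GridSeq.finite_lt_gridAbsAvg (H : GridSeq μ q V D) (hf : Integrable f μ)
    {s : ℝ} (hs : 0 < s) (j : ℕ) : {n | ∃ y, q j y = n ∧ s < gridAbsAvg μ q V f j y}.Finite := by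
  have hV := H.pos j
  have hfin : (μ.withDensity fun x => ‖f x‖ₑ) Set.univ ≠ ∞ := by
    rw [withDensity_apply _ MeasurableSet.univ, Measure.restrict_univ]
    exact hf.2.ne
  refine (Measure.finite_const_le_meas_of_disjoint_iUnion (μ.withDensity fun x => ‖f x‖ₑ)
    (ε := ENNReal.ofReal (s * V j)) (by simpa using mul_pos hs hV)
    (As := fun n : T => q j ⁻¹' {n}) (fun n => H.measurableSet_cell j n)
    (fun n n' hn => Disjoint.preimage _ (Set.disjoint_singleton.2 hn))
    (ne_top_of_le_ne_top hfin (measure_mono (Set.subset_univ _)))).subset ?_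
  rintro n ⟨y, rfl, hy⟩
  change ENNReal.ofReal (s * V j) ≤ (μ.withDensity fun x => ‖f x‖ₑ) (q j ⁻¹' {q j y})
  rw [withDensity_apply _ (H.measurableSet_cell j _),
    ← ofReal_integral_norm_eq_lintegral_enorm hf.integrableOn]
  refine ENNReal.ofReal_le_ofReal ?_
  rw [gridAbsAvg, lt_inv_mul_iff₀ hV] at hy
  linarith

theorem sum_two_pow_le {S : Finset ℕ} {m : ℕ} (h : ∀ k ∈ S, k ≤ m) :
    ∑ k ∈ S, (2 : ℝ) ^ k ≤ 2 * 2 ^ m := by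
  have h1 : ∑ k ∈ S, (2 : ℝ) ^ k ≤ ∑ k ∈ Finset.range (m + 1), (2 : ℝ) ^ k :=
    Finset.sum_le_sum_of_subset_of_nonneg (fun k hk => by
      rw [Finset.mem_range]; exact Nat.lt_succ_of_le (h k hk)) fun _ _ _ => by positivity
  refine h1.trans ?_
  rw [geom_sum_eq (by norm_num), pow_succ]
  norm_num
  linarith

variable [Countable T]

/-- The Calderón–Zygmund decomposition of a function at all heights `σ 2^k`. -/
theorem GridSeq.exists_decomposition (H : GridSeq μ q V D) (hD : 1 ≤ D)
    (hV : Filter.Tendsto V Filter.atTop Filter.atTop) (hf : Measurable f) (hfi : Integrable f μ)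
    {b : ℝ} (hb : ∀ x, ‖f x‖ ≤ b) {σ : ℝ} (hσ : 0 < σ) :
    ∃ (ι : Type) (_ : Fintype ι) (ν j : ι → ℕ) (y : ι → X) (a : ι → X → ℂ),
      (∀ i, Measurable (a i)) ∧
      (∀ i x, ‖a i x‖ ≤ (q (j i) ⁻¹' {q (j i) (y i)}).indicator
        (fun _ => 3 * D * (σ * 2 ^ ν i)) x) ∧
      (∀ i, ∫ x, a i x ∂μ = 0) ∧
      (∀ i, σ * 2 ^ ν i ≤ gridAbsAvg μ q V f (j i) (y i)) ∧
      (∀ x, ‖∑ i, a i x - gridAvg μ q V f 0 x‖ ≤ D * σ) ∧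
      ∀ x i i', q (j i) x = q (j i) (y i) → q (j i') x = q (j i') (y i') → ν i = ν i' → i = i' := by
  classical
  set U := gridAbsAvg μ q V f with hU
  set G := gridStop μ q V f with hG
  obtain ⟨K, hK⟩ : ∃ K : ℕ, b ≤ σ * 2 ^ K := by
    obtain ⟨K, hK⟩ := pow_unbounded_of_one_lt (b / σ) (one_lt_two : (1 : ℝ) < 2)
    exact ⟨K, by rw [div_lt_iff₀ hσ] at hK; linarith⟩
  obtain ⟨M, hM⟩ : ∃ M : ℕ, ∀ x, U M x ≤ σ := by
    obtain ⟨M, hM⟩ := (hV.eventually_ge_atTop ((∫ y, ‖f y‖ ∂μ) / σ)).exists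
    refine ⟨M, fun x => (H.gridAbsAvg_le_integral hfi M x).trans ?_⟩
    rw [inv_mul_le_iff₀ (H.pos M)]
    rwa [div_le_iff₀ hσ] at hM
  have hUc : ∀ {j i x y}, j ≤ i → q j x = q j y → U i x = U i y := fun hji h =>
    gridAbsAvg_congr _ (H.eq_of_le hji h)
  set P : ℕ → ℕ → X → Prop := fun k j y => σ * 2 ^ k < U j y ∧
    ∀ l, j < l → l ≤ M → U l y ≤ σ * 2 ^ k with hP
  have hPc : ∀ {k j x y}, q j x = q j y → P k j x → P k j y := fun {k j x y} h hx =>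
    ⟨by rw [← hUc le_rfl h]; exact hx.1, fun l hl hlM => by
      rw [← hUc hl.le h]; exact hx.2 l hl hlM⟩
  have hPu : ∀ {k j j' x}, j ≤ M → j' ≤ M → P k j x → P k j' x → j = j' := by
    intro k j j' x hj hj' h h'
    by_contra hne
    rcases lt_or_gt_of_ne hne with h1 | h1
    · exact absurd (h.2 j' h1 hj') (not_le.2 h'.1)
    · exact absurd (h'.2 j h1 hj) (not_le.2 h.1)
  set S : Set (ℕ × ℕ × T) := {i | i.1 < K ∧ i.2.1 ≤ M ∧ ∃ y, q i.2.1 y = i.2.2 ∧ P i.1 i.2.1 y}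
    with hS
  have hσk : ∀ k : ℕ, σ ≤ σ * 2 ^ k := fun k =>
    le_mul_of_one_le_right hσ.le (one_le_pow₀ one_le_two)
  have hSf : S.Finite := by
    have h1 : (⋃ j ∈ Set.Iic M, {n | ∃ y, q j y = n ∧ σ < U j y}).Finite :=
      (Set.finite_Iic M).biUnion fun j _ => H.finite_lt_gridAbsAvg hfi hσ j
    refine ((Set.finite_Iio K).prod ((Set.finite_Iic M).prod h1)).subset ?_
    rintro ⟨k, j, n⟩ ⟨hk, hj, y, hy, hPy⟩
    refine ⟨hk, hj, Set.mem_biUnion hj ⟨y, hy, (hσk k).trans_lt hPy.1⟩⟩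
  choose Y hY using fun i : S => i.2.2.2
  have : Fintype S := hSf.fintype
  -- the difference of two consecutive stopped averages
  set g : ℕ → X → ℂ := fun k x => G (σ * 2 ^ (k + 1)) M x - G (σ * 2 ^ k) M x with hg
  have h2k : ∀ k : ℕ, σ * 2 ^ k ≤ σ * 2 ^ (k + 1) := fun k =>
    mul_le_mul_of_nonneg_left (pow_le_pow_right₀ one_le_two (Nat.le_succ k)) hσ.le
  have hgm : ∀ k, Measurable (g k) := fun k =>
    (H.measurable_gridStop f _ M).sub (H.measurable_gridStop f _ M)
  have hgb : ∀ k x, ‖g k x‖ ≤ 3 * D * (σ * 2 ^ k) := by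
    intro k x
    have h1 := H.norm_gridStop_le hD hfi (s := σ * 2 ^ (k + 1)) (by positivity) (j := M) (x := x)
      ((hM x).trans (hσk _))
    have h2 := H.norm_gridStop_le hD hfi (s := σ * 2 ^ k) (by positivity) (j := M) (x := x)
      ((hM x).trans (hσk _))
    refine (norm_sub_le _ _).trans ((add_le_add h1 h2).trans (le_of_eq ?_))
    rw [pow_succ]; ring
  have hgP : ∀ k j x, j ≤ M → P k j x → g k x = G (σ * 2 ^ (k + 1)) j x - G (σ * 2 ^ k) j x := by
    intro k j x hj h
    simp only [hg, hG]
    rw [gridStop_eq_of_forall_le hj h.2,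
      gridStop_eq_of_forall_le hj fun l hl hlM => (h.2 l hl hlM).trans (h2k k)]
  have hg0 : ∀ k x, (∀ j ≤ M, ¬ P k j x) → g k x = 0 := by
    intro k x h
    have h1 : ∀ l ≤ M, U l x ≤ σ * 2 ^ k := by
      by_contra! hcon
      obtain ⟨l, hl, hlU⟩ := hcon
      refine h (Nat.findGreatest (fun l => σ * 2 ^ k < U l x) M) (Nat.findGreatest_le M)
        ⟨Nat.findGreatest_spec (P := fun l => σ * 2 ^ k < U l x) hl hlU, fun i hi hiM => ?_⟩
      exact not_lt.1 (Nat.findGreatest_is_greatest (P := fun l => σ * 2 ^ k < U l x) hi hiM)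
    simp only [hg, hG]
    rw [gridStop_eq_of_forall_le (Nat.zero_le M) fun l _ hlM => h1 l hlM,
      gridStop_eq_of_forall_le (Nat.zero_le M) fun l _ hlM => (h1 l hlM).trans (h2k k)]
    exact sub_self _
  have hinj : ∀ x (i i' : S), q i.1.2.1 x = q i.1.2.1 (Y i) → q i'.1.2.1 x = q i'.1.2.1 (Y i') →
      i.1.1 = i'.1.1 → i = i' := by
    rintro x ⟨⟨k, j, n⟩, hi⟩ ⟨⟨k', j', n'⟩, hi'⟩ h h' hk
    have e1 := hY ⟨⟨k, j, n⟩, hi⟩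
    have e2 := hY ⟨⟨k', j', n'⟩, hi'⟩
    dsimp only at h h' hk e1 e2
    subst hk
    have p1 := hPc h.symm e1.2
    have p2 := hPc h'.symm e2.2
    have hj := hPu hi.2.1 hi'.2.1 p1 p2
    subst hj
    rw [e1.1] at h
    rw [e2.1] at h'
    subst h h'
    rfl
  set a : S → X → ℂ := fun i => (q i.1.2.1 ⁻¹' {q i.1.2.1 (Y i)}).indicator (g i.1.1) with ha
  refine ⟨S, this, fun i => i.1.1, fun i => i.1.2.1, Y, a, fun i =>
    (hgm _).indicator (H.measurableSet_cell _ _), fun i x => ?_, fun i => ?_,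
    fun i => (hY i).2.1.le, fun x => ?_, hinj⟩
  · simp only [ha, norm_indicator_eq_indicator_norm]
    exact Set.indicator_le_indicator (hgb _ x)
  · simp only [ha]
    rw [integral_indicator (H.measurableSet_cell _ _),
      setIntegral_congr_fun (H.measurableSet_cell _ _) (fun x (hx : q i.1.2.1 x = _) =>
        hgP i.1.1 i.1.2.1 x i.2.2.1 (hPc hx.symm (hY i).2)), integral_sub,
      H.setIntegral_gridStop hf hb, H.setIntegral_gridStop hf hb, sub_self]
    · exact H.integrableOn_cell (H.measurable_gridStop f _ _) (H.norm_gridStop_le_bound hb _ _) _ _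
    · exact H.integrableOn_cell (H.measurable_gridStop f _ _) (H.norm_gridStop_le_bound hb _ _) _ _
  · have h1 : ∑ i, a i x = ∑ k ∈ Finset.range K, g k x := by
      rw [← Finset.sum_fiberwise_of_maps_to (s := Finset.univ) (t := Finset.range K)
        (g := fun i : S => i.1.1) fun i _ => Finset.mem_range.2 i.2.1]
      refine Finset.sum_congr rfl fun k hk => ?_
      by_cases hex : ∃ j ≤ M, P k j x
      · obtain ⟨j, hj, hPx⟩ := hex
        have hiS : (k, j, q j x) ∈ S := ⟨Finset.mem_range.1 hk, hj, x, rfl, hPx⟩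
        have hYi : q j x = q j (Y ⟨(k, j, q j x), hiS⟩) := (hY ⟨(k, j, q j x), hiS⟩).1.symm
        rw [Finset.sum_eq_single_of_mem (⟨(k, j, q j x), hiS⟩ : S) (by simp)]
        · exact Set.indicator_of_mem (s := q j ⁻¹' {q j (Y ⟨(k, j, q j x), hiS⟩)}) hYi _
        · intro i hi hne
          refine Set.indicator_of_notMem (fun hx => hne ?_) _
          exact hinj x i ⟨(k, j, q j x), hiS⟩ hx hYi (Finset.mem_filter.1 hi).2
      · push Not at hex
        rw [hg0 k x hex]
        refine Finset.sum_eq_zero fun i hi => Set.indicator_of_notMem (fun hx => ?_) _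
        have := hPc (Eq.symm hx) (hY i).2
        rw [(Finset.mem_filter.1 hi).2] at this
        exact hex _ i.2.2.1 this
    have h2 : G (σ * 2 ^ K) M x = gridAvg μ q V f 0 x := by
      simp only [hG]
      rw [gridStop_eq_of_forall_le (Nat.zero_le M) fun l _ _ => (H.gridAbsAvg_le hb l x).trans hK]
      rfl
    have h3 : ∑ k ∈ Finset.range K, g k x = G (σ * 2 ^ K) M x - G (σ * 2 ^ 0) M x :=
      Finset.sum_range_sub (fun k => G (σ * 2 ^ k) M x) K
    rw [h1, h3, h2, pow_zero, mul_one, sub_sub_cancel_left, norm_neg]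
    exact H.norm_gridStop_le hD hfi hσ.le (hM x)

end

section

/-- The label of the half-open dyadic cube of side `2 ^ (j - L)` containing `x`. -/
def dyadicLabel (L j : ℕ) (x : EuclideanSpace ℝ (Fin d)) : Fin d → ℤ :=
  fun i => ⌊x i / 2 ^ ((j : ℤ) - L)⌋

theorem measurable_dyadicLabel (L j : ℕ) : Measurable (dyadicLabel (d := d) L j) := by
  refine measurable_pi_lambda _ fun i => Int.measurable_floor.comp ?_
  exact Measurable.div_const (by fun_prop) _

theorem dyadicLabel_succ (L j : ℕ) (x : 𝔼) :
    dyadicLabel L (j + 1) x = fun i => dyadicLabel L j x i / 2 := by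
  funext i
  simp only [dyadicLabel]
  have h1 : x i / 2 ^ (((j + 1 : ℕ) : ℤ) - L) = x i / 2 ^ ((j : ℤ) - L) / (2 : ℕ) := by
    rw [show ((j + 1 : ℕ) : ℤ) - L = ((j : ℤ) - L) + 1 by push_cast; ring,
      zpow_add_one₀ (by norm_num), div_div]
    norm_num
  rw [h1, Int.floor_div_natCast]
  norm_num

theorem volume_dyadicLabel (L j : ℕ) (n : Fin d → ℤ) :
    volume (dyadicLabel (d := d) L j ⁻¹' {n}) = ENNReal.ofReal ((2 ^ ((j : ℤ) - L)) ^ d) := by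
  set s : ℝ := 2 ^ ((j : ℤ) - L) with hs
  have hs0 : 0 < s := by positivity
  have h1 : dyadicLabel (d := d) L j ⁻¹' {n} = (WithLp.ofLp : 𝔼 → (Fin d → ℝ)) ⁻¹'
      Set.pi Set.univ fun i => Set.Ico (n i * s) ((n i + 1) * s) := by
    ext x
    simp only [Set.mem_preimage, Set.mem_singleton_iff, funext_iff, dyadicLabel, Set.mem_pi,
      Set.mem_univ, forall_true_left, Set.mem_Ico, ← hs]
    refine forall_congr' fun i => ?_
    rw [Int.floor_eq_iff, le_div_iff₀ hs0, div_lt_iff₀ hs0]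
  rw [h1, (PiLp.volume_preserving_ofLp (Fin d)).measure_preimage
    (MeasurableSet.univ_pi fun i => measurableSet_Ico).nullMeasurableSet, Real.volume_pi_Ico]
  have h2 : ∀ i : Fin d, ((n i : ℝ) + 1) * s - n i * s = s := fun i => by ring
  simp only [h2]
  rw [Finset.prod_const, Finset.card_univ, Fintype.card_fin, ENNReal.ofReal_pow hs0.le]

theorem dist_le_of_dyadicLabel_eq {L j : ℕ} {x y : 𝔼}
    (h : dyadicLabel L j x = dyadicLabel L j y) : dist x y ≤ 2 ^ d * 2 ^ ((j : ℤ) - L) := by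
  set s : ℝ := 2 ^ ((j : ℤ) - L) with hs
  have hs0 : 0 < s := by positivity
  rw [EuclideanSpace.dist_eq]
  refine Real.sqrt_le_iff.2 ⟨by positivity, ?_⟩
  have h1 : ∀ i, dist (x i) (y i) ^ 2 ≤ s ^ 2 := fun i => by
    have h2 := Int.abs_sub_lt_one_of_floor_eq_floor (congrFun h i)
    rw [← hs, ← sub_div, abs_div, abs_of_pos hs0, div_lt_one hs0] at h2
    rw [Real.dist_eq]
    exact pow_le_pow_left₀ (abs_nonneg _) h2.le 2
  refine (Finset.sum_le_sum fun i _ => h1 i).trans ?_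
  rw [Finset.sum_const, Finset.card_univ, Fintype.card_fin, nsmul_eq_mul, mul_pow]
  refine mul_le_mul_of_nonneg_right ?_ (by positivity)
  have h3 : (d : ℝ) ≤ 2 ^ d := by exact_mod_cast Nat.lt_two_pow_self.le
  have h4 : (1 : ℝ) ≤ 2 ^ d := one_le_pow₀ one_le_two
  nlinarith

theorem gridSeq_dyadic (d L : ℕ) : GridSeq (volume : Measure (EuclideanSpace ℝ (Fin d)))
    (dyadicLabel L) (fun j => (2 ^ ((j : ℤ) - L)) ^ d) (2 ^ d) where
  meas := measurable_dyadicLabel L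
  parent := ⟨fun n i => n i / 2, dyadicLabel_succ L⟩
  pos j := by positivity
  vol j x := volume_dyadicLabel L j _
  growth j := by
    rw [← mul_pow, show ((j + 1 : ℕ) : ℤ) - L = ((j : ℤ) - L) + 1 by push_cast; ring,
      zpow_add_one₀ (by norm_num), mul_comm]

theorem tendsto_dyadic_volume (hd : 1 ≤ d) (L : ℕ) :
    Filter.Tendsto (fun j : ℕ => ((2 : ℝ) ^ ((j : ℤ) - L)) ^ d) Filter.atTop Filter.atTop := by
  have h1 : Filter.Tendsto (fun j : ℕ => (2 : ℝ) ^ ((j : ℤ) - L)) Filter.atTop Filter.atTop := by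
    have : (fun j : ℕ => (2 : ℝ) ^ ((j : ℤ) - L)) = fun j : ℕ => (2 : ℝ) ^ j * (2 ^ L)⁻¹ := by
      funext j
      rw [zpow_sub₀ (by norm_num), zpow_natCast, zpow_natCast, div_eq_mul_inv]
    rw [this]
    exact (tendsto_pow_atTop_atTop_of_one_lt one_lt_two).atTop_mul_const (by positivity)
  exact (Filter.tendsto_pow_atTop (by omega)).comp h1

theorem tendsto_gridAvg_dyadic {f : 𝔼 → ℂ} (hf : Integrable f) {x : 𝔼} (hc : ContinuousAt f x) :
    Filter.Tendsto (fun L : ℕ => gridAvg volume (dyadicLabel L)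
      (fun j => (2 ^ ((j : ℤ) - L)) ^ d) f 0 x) Filter.atTop (nhds (f x)) := by
  rw [Metric.tendsto_atTop]
  intro η hη
  obtain ⟨δ, hδ, hδf⟩ := Metric.continuousAt_iff.1 hc (η / 2) (by positivity)
  obtain ⟨L₀, hL₀⟩ := pow_unbounded_of_one_lt (2 ^ d / δ) (one_lt_two : (1 : ℝ) < 2)
  refine ⟨L₀, fun L hL => ?_⟩
  have H := gridSeq_dyadic d L
  have hV := H.pos 0
  have hvol := H.vol 0 x
  set V : ℝ := (2 ^ (((0 : ℕ) : ℤ) - L)) ^ d with hVdef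
  have hsmall : ∀ y, dyadicLabel L 0 y = dyadicLabel L 0 x → dist (f y) (f x) ≤ η / 2 := by
    intro y hy
    refine (hδf ((dist_le_of_dyadicLabel_eq hy).trans_lt ?_)).le
    rw [Nat.cast_zero, zero_sub, zpow_neg, zpow_natCast, ← div_eq_mul_inv, div_lt_iff₀ (by positivity)]
    rw [div_lt_iff₀ hδ] at hL₀
    have : (2 : ℝ) ^ L₀ ≤ 2 ^ L := pow_le_pow_right₀ one_le_two hL
    nlinarith
  have h1 : gridAvg volume (dyadicLabel L) (fun j => (2 ^ ((j : ℤ) - L)) ^ d) f 0 x - f x =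
      ((V)⁻¹ : ℝ) * ∫ y in dyadicLabel L 0 ⁻¹' {dyadicLabel L 0 x}, (f y - f x) := by
    rw [integral_sub hf.integrableOn (integrableOn_const (by rw [hvol]; exact ENNReal.ofReal_ne_top)),
      setIntegral_const, measureReal_def, hvol, ENNReal.toReal_ofReal hV.le, gridAvg, mul_sub,
      Complex.real_smul, ← mul_assoc _ (V : ℂ), ← Complex.ofReal_mul, inv_mul_cancel₀ hV.ne',
      Complex.ofReal_one, one_mul]
  rw [dist_eq_norm, h1, norm_mul, Complex.norm_real, Real.norm_of_nonneg (by positivity)]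
  have h2 := norm_setIntegral_le_of_norm_le_const (μ := volume)
    (s := dyadicLabel L 0 ⁻¹' {dyadicLabel L 0 x}) (f := fun y => f y - f x) (C := η / 2)
    (by rw [hvol]; exact ENNReal.ofReal_lt_top) fun y hy => by
      rw [← dist_eq_norm]; exact hsmall y hy
  rw [measureReal_def, hvol, ENNReal.toReal_ofReal hV.le] at h2
  calc _ ≤ V⁻¹ * (η / 2 * V) := mul_le_mul_of_nonneg_left h2 (by positivity)
    _ = η / 2 := by field_simp
    _ < η := by linarith

end

section

/-- The ratio of the volume of a doubled ball around a dyadic cube to that of the cube. -/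
def cubeRatio (d : ℕ) : NNReal :=
  (ENNReal.ofReal ((2 * 2 ^ d) ^ d) *
    volume (Metric.ball (0 : EuclideanSpace ℝ (Fin d)) 1)).toNNReal

theorem volume_closedBall_le_cube (L j : ℕ) (z : 𝔼) (n : Fin d → ℤ) :
    volume (Metric.closedBall z (2 * 2 ^ ((j : ℤ) - L + d))) ≤
      cubeRatio d * volume (dyadicLabel (d := d) L j ⁻¹' {n}) := by
  rw [volume_dyadicLabel, Measure.addHaar_closedBall _ _ (by positivity), cubeRatio,
    ENNReal.coe_toNNReal (ENNReal.mul_ne_top ENNReal.ofReal_ne_top measure_ball_lt_top.ne),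
    finrank_euclideanSpace_fin, zpow_add₀ (by norm_num), zpow_natCast,
    show (2 * ((2 : ℝ) ^ ((j : ℤ) - L) * 2 ^ d)) ^ d =
      (2 * 2 ^ d) ^ d * (2 ^ ((j : ℤ) - L)) ^ d by rw [← mul_pow]; ring,
    ENNReal.ofReal_mul (by positivity)]
  exact le_of_eq (by ring)

theorem cube_subset_closedBall (L j : ℕ) (y : 𝔼) :
    dyadicLabel L j ⁻¹' {dyadicLabel L j y} ⊆
      Metric.closedBall y (2 ^ ((j : ℤ) - L + d)) := fun x hx => by
  rw [Metric.mem_closedBall, zpow_add₀ (by norm_num), zpow_natCast, mul_comm]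
  exact dist_le_of_dyadicLabel_eq hx

theorem gridAbsAvg_dyadic_le {f : 𝔼 → ℂ} (hf : Integrable f) (L j : ℕ) (y : 𝔼) {av : NNReal}
    (hav : av * volume (Metric.closedBall y (2 ^ ((j : ℤ) - L + d))) =
      ∫⁻ x in Metric.closedBall y (2 ^ ((j : ℤ) - L + d)), ENNReal.ofReal ‖f x‖) :
    gridAbsAvg volume (dyadicLabel L) (fun j => (2 ^ ((j : ℤ) - L)) ^ d) f j y ≤
      cubeRatio d * av := by
  have hV : (0 : ℝ) < (2 ^ ((j : ℤ) - L)) ^ d := by positivity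
  rw [gridAbsAvg, inv_mul_le_iff₀ hV,
    ← ENNReal.ofReal_le_ofReal_iff (by positivity),
    ofReal_integral_eq_lintegral_ofReal hf.norm.integrableOn
      (Filter.Eventually.of_forall fun _ => norm_nonneg _)]
  refine (lintegral_mono_set (cube_subset_closedBall L j y)).trans ?_
  rw [← hav, ENNReal.ofReal_mul hV.le, ENNReal.ofReal_mul (by positivity),
    ENNReal.ofReal_coe_nnreal, ENNReal.ofReal_coe_nnreal,
    ← volume_dyadicLabel L j (dyadicLabel L j y)]
  have h1 : volume (Metric.closedBall y (2 ^ ((j : ℤ) - L + d))) ≤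
      cubeRatio d * volume (dyadicLabel (d := d) L j ⁻¹' {dyadicLabel L j y}) :=
    (measure_mono (Metric.closedBall_subset_closedBall (by
      have : (0 : ℝ) < 2 ^ ((j : ℤ) - L + d) := by positivity
      linarith))).trans (volume_closedBall_le_cube L j y _)
  calc _ ≤ (av : ℝ≥0∞) * (cubeRatio d *
        volume (dyadicLabel (d := d) L j ⁻¹' {dyadicLabel L j y})) := mul_le_mul' le_rfl h1
    _ = _ := by ring

theorem sum_indicator_two_pow_le {X ι : Type*} [Fintype ι] (W : ι → Set X) (ν : ι → ℕ)
    (av : ι → NNReal) {σ Λ E : ℝ} (hE : 0 ≤ E) (hΛ : 0 ≤ Λ) (hσ : 0 ≤ σ)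
    (hav : ∀ i, σ * 2 ^ ν i ≤ Λ * av i) (x : X)
    (hinj : ∀ i i', x ∈ W i → x ∈ W i' → ν i = ν i' → i = i') :
    ∑ i, (W i).indicator (fun _ => (((E * (σ * 2 ^ ν i)).toNNReal : NNReal) : ℝ≥0∞)) x ≤
      ENNReal.ofReal (2 * E * Λ) *
        ((Finset.univ.sup fun i => (W i).indicator (fun _ => av i) x : NNReal) : ℝ≥0∞) := by
  classical
  set S : Finset ι := Finset.univ.filter fun i => x ∈ W i with hS
  have h1 : ∑ i, (W i).indicator (fun _ => (((E * (σ * 2 ^ ν i)).toNNReal : NNReal) : ℝ≥0∞)) x =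
      ENNReal.ofReal (∑ i ∈ S, E * (σ * 2 ^ ν i)) := by
    rw [ENNReal.ofReal_sum_of_nonneg fun i _ => by positivity, hS, Finset.sum_filter]
    refine Finset.sum_congr rfl fun i _ => ?_
    rw [Set.indicator_apply]
    rfl
  rw [h1]
  rcases S.eq_empty_or_nonempty with h0 | hne
  · simp [h0]
  obtain ⟨i, hiS, hi⟩ := S.exists_max_image ν hne
  have hiW : x ∈ W i := (Finset.mem_filter.1 hiS).2
  have h2 : ∑ i ∈ S, E * (σ * 2 ^ ν i) ≤ 2 * E * Λ * av i := by
    have h3 : ∑ i ∈ S, (2 : ℝ) ^ ν i = ∑ k ∈ S.image ν, (2 : ℝ) ^ k :=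
      (Finset.sum_image fun a ha b hb hab =>
        hinj a b (Finset.mem_filter.1 ha).2 (Finset.mem_filter.1 hb).2 hab).symm
    have h4 : ∑ k ∈ S.image ν, (2 : ℝ) ^ k ≤ 2 * 2 ^ ν i :=
      sum_two_pow_le fun k hk => by
        obtain ⟨i', hi', rfl⟩ := Finset.mem_image.1 hk
        exact hi i' hi'
    rw [← Finset.mul_sum, ← Finset.mul_sum, h3]
    calc E * (σ * ∑ k ∈ S.image ν, (2 : ℝ) ^ k) ≤ E * (σ * (2 * 2 ^ ν i)) := by gcongr
      _ = 2 * E * (σ * 2 ^ ν i) := by ring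
      _ ≤ 2 * E * (Λ * av i) := mul_le_mul_of_nonneg_left (hav i) (by positivity)
      _ = _ := by ring
  refine (ENNReal.ofReal_le_ofReal h2).trans ?_
  rw [ENNReal.ofReal_mul (by positivity), ENNReal.ofReal_coe_nnreal]
  gcongr
  have := Finset.le_sup (f := fun i => (W i).indicator (fun _ => av i) x) (Finset.mem_univ i)
  simpa [Set.indicator_of_mem hiW] using this

theorem exists_atomic_approximation (hd : 1 ≤ d) {p : ℝ} (hp : 1 < p) :
    ∃ Λ C : NNReal, ∀ f : 𝔼 → ℂ, Nice f → Continuous f → ∃ h : ℕ → 𝔼 → ℂ,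
      (∀ x, Filter.Tendsto (fun L => h L x) Filter.atTop (nhds (f x))) ∧
      (∃ b : ℝ, ∀ L x, ‖h L x‖ ≤ b) ∧
      ∀ L, ∃ (ι : Type) (_ : Fintype ι) (W : ι → Set 𝔼) (z : ι → 𝔼) (j : ι → ℤ)
        (c : ι → NNReal) (a : ι → 𝔼 → ℂ),
        (∀ i, BallAtom Λ (W i) (z i) (j i) (c i) (a i)) ∧ (h L = fun y => ∑ i, a i y) ∧
        ∫⁻ x, (∑ i, (W i).indicator (fun _ => (c i : ℝ≥0∞)) x) ^ p ≤ C * ∫⁻ x, ‖f x‖ₑ ^ p := by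
  set D : ℝ := 2 ^ d with hD
  have hD1 : 1 ≤ D := one_le_pow₀ one_le_two
  set E : ℝ := 3 * D with hE
  set C₀ : ℝ≥0∞ := ENNReal.ofReal (2 * E * cubeRatio d) ^ p *
    (ENNReal.ofReal (4 ^ d * 2) * ENNReal.ofReal (p / (p - 1) * (1 / 2) ^ (1 - p))) with hC₀
  have hC₀t : C₀ ≠ ⊤ := ENNReal.mul_ne_top
    (ENNReal.rpow_ne_top_of_nonneg (by linarith) ENNReal.ofReal_ne_top)
    (ENNReal.mul_ne_top ENNReal.ofReal_ne_top ENNReal.ofReal_ne_top)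
  refine ⟨cubeRatio d, C₀.toNNReal, fun f hf hfc => ?_⟩
  rw [ENNReal.coe_toNNReal hC₀t]
  obtain ⟨b, hb⟩ := hf.bdd
  have hdec := fun L : ℕ => (gridSeq_dyadic d L).exists_decomposition hD1
    (tendsto_dyadic_volume hd L) hf.meas hf.int hb (σ := (1 / 2) ^ L) (by positivity)
  choose ι hι ν j y a hmeas hbd hzero hlow happ hinj using hdec
  refine ⟨fun L x => ∑ i, a L i x, fun x => ?_, ⟨D + b, fun L x => ?_⟩, fun L => ?_⟩
  · have h1 := tendsto_gridAvg_dyadic hf.int (hfc.continuousAt (x := x))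
    have h2 : Filter.Tendsto (fun L => ∑ i, a L i x - gridAvg volume (dyadicLabel L)
        (fun j => (2 ^ ((j : ℤ) - L)) ^ d) f 0 x) Filter.atTop (nhds 0) := by
      refine squeeze_zero_norm (fun L => happ L x) ?_
      rw [← mul_zero D]
      exact (tendsto_pow_atTop_nhds_zero_of_lt_one (by norm_num) (by norm_num)).const_mul D
    simpa using h2.add h1
  · have h1 := happ L x
    have h2 := (norm_gridAvg_le (gridSeq_dyadic d L).pos 0 x).trans
      ((gridSeq_dyadic d L).gridAbsAvg_le hb 0 x)
    have h3 : D * (1 / 2 : ℝ) ^ L ≤ D :=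
      mul_le_of_le_one_right (by linarith) (pow_le_one₀ (by norm_num) (by norm_num))
    have h4 := norm_sub_norm_le (∑ i, a L i x) (gridAvg volume (dyadicLabel L)
        (fun j => (2 ^ ((j : ℤ) - L)) ^ d) f 0 x)
    linarith
  · set W : ι L → Set 𝔼 := fun i => dyadicLabel L (j L i) ⁻¹' {dyadicLabel L (j L i) (y L i)}
      with hW
    have hWm : ∀ i, MeasurableSet (W i) := fun i => by
      exact measurable_dyadicLabel L (j L i) (measurableSet_singleton _)
    have hbpos : ∀ i, (0 : ℝ) < 2 ^ ((j L i : ℤ) - L + d) := fun i => by positivity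
    set av : ι L → ℝ≥0∞ := fun i =>
      (∫⁻ x in Metric.closedBall (y L i) (2 ^ ((j L i : ℤ) - L + d)), ENNReal.ofReal ‖f x‖) /
        volume (Metric.closedBall (y L i) (2 ^ ((j L i : ℤ) - L + d))) with hav
    have hv0 : ∀ i, volume (Metric.closedBall (y L i) (2 ^ ((j L i : ℤ) - L + d))) ≠ 0 :=
      fun i => (Metric.measure_closedBall_pos volume _ (hbpos i)).ne'
    have hvt : ∀ i, volume (Metric.closedBall (y L i) (2 ^ ((j L i : ℤ) - L + d))) ≠ ⊤ :=
      fun i => measure_closedBall_lt_top.ne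
    have hfin : ∫⁻ x, ENNReal.ofReal ‖f x‖ ≠ ⊤ := by
      simpa only [ofReal_norm] using hf.int.2.ne
    have havt : ∀ i, av i ≠ ⊤ := fun i => (ENNReal.div_lt_top
      ((setLIntegral_le_lintegral _ _).trans_lt hfin.lt_top).ne (hv0 i)).ne
    have hav' : ∀ i, ((av i).toNNReal : ℝ≥0∞) *
        volume (Metric.closedBall (y L i) (2 ^ ((j L i : ℤ) - L + d))) =
        ∫⁻ x in Metric.closedBall (y L i) (2 ^ ((j L i : ℤ) - L + d)), ENNReal.ofReal ‖f x‖ :=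
      fun i => by rw [ENNReal.coe_toNNReal (havt i), ENNReal.div_mul_cancel (hv0 i) (hvt i)]
    refine ⟨ι L, hι L, W, y L, fun i => (j L i : ℤ) - L + d,
      fun i => (E * ((1 / 2) ^ L * 2 ^ ν L i)).toNNReal, a L, fun i => ?_, rfl, ?_⟩
    · refine ⟨hWm i, cube_subset_closedBall L _ _, volume_closedBall_le_cube L _ _ _, hmeas L i,
        fun x => ?_, hzero L i⟩
      rw [← ofReal_norm]
      refine (ENNReal.ofReal_le_ofReal (hbd L i x)).trans (le_of_eq ?_)
      by_cases hx : x ∈ W i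
      · rw [Set.indicator_of_mem hx, Set.indicator_of_mem hx]
        rfl
      · rw [Set.indicator_of_notMem hx, Set.indicator_of_notMem hx, ENNReal.ofReal_zero]
    · have hmax := lintegral_sup_average_rpow_le hp Finset.univ (y L)
        (fun i => 2 ^ ((j L i : ℤ) - L + d)) W hWm (fun i => cube_subset_closedBall L _ _)
        hf.meas.norm (fun x => norm_nonneg _) (fun i => (av i).toNNReal) hav'
      have hfp : ∫⁻ x, ENNReal.ofReal (‖f x‖ ^ p) = ∫⁻ x, ‖f x‖ₑ ^ p := by
        refine lintegral_congr fun x => ?_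
        rw [← ENNReal.ofReal_rpow_of_nonneg (norm_nonneg _) (by linarith), ofReal_norm]
      rw [hfp] at hmax
      rw [hC₀, mul_assoc]
      refine le_trans ?_ (mul_le_mul' le_rfl hmax)
      rw [← lintegral_const_mul' _ _
        (ENNReal.rpow_ne_top_of_nonneg (by linarith) ENNReal.ofReal_ne_top)]
      refine lintegral_mono fun x => ?_
      simp only
      rw [← ENNReal.mul_rpow_of_nonneg _ _ (by linarith)]
      refine ENNReal.rpow_le_rpow ?_ (by linarith)
      exact sum_indicator_two_pow_le W (ν L) (fun i => (av i).toNNReal) (by positivity)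
        (by positivity) (by positivity)
        (fun i => (hlow L i).trans (gridAbsAvg_dyadic_le hf.int L _ _ (hav' i))) x
        fun i i' hi hi' => hinj L x i i' hi hi'

end

section

theorem NiceKer.enorm_cv_dil_le {K f : EuclideanSpace ℝ (Fin d) → ℂ} (hK : NiceKer K) {b : ℝ≥0∞}
    (hb : ∀ x, ‖f x‖ₑ ≤ b) {s : ℝ} (hs : 0 < s) (x : 𝔼) :
    ‖_root_.cv (_root_.dil s K) f x‖ₑ ≤ (∫⁻ z, ‖K z‖ₑ) * b := by
  refine (enorm_cv_le _ _ _).trans ?_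
  calc ∫⁻ y, ‖_root_.dil s K (x - y)‖ₑ * ‖f y‖ₑ ≤ ∫⁻ y, ‖_root_.dil s K (x - y)‖ₑ * b :=
        lintegral_mono fun y => mul_le_mul' le_rfl (hb y)
    _ = (∫⁻ y, ‖_root_.dil s K (x - y)‖ₑ) * b := lintegral_mul_const _ (by
        have := (hK.dil hs).cont
        exact (this.comp (continuous_const.sub continuous_id)).measurable.enorm)
    _ = _ := by
        rw [lintegral_sub_left_eq_self (fun y => ‖_root_.dil s K y‖ₑ) x, lintegral_enorm_dil hs]

theorem Nice.indicator {f : EuclideanSpace ℝ (Fin d) → ℂ} (hf : Nice f) {S : Set 𝔼}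
    (hS : MeasurableSet S) : Nice (S.indicator f) := by
  obtain ⟨C, hC⟩ := hf.bdd
  exact ⟨hf.meas.indicator hS, hf.int.indicator hS, C,
    fun x => (norm_indicator_le_norm_self f x).trans (hC x)⟩

/-- The Littlewood–Paley estimate for exponents at least two. -/
theorem exists_sum_lintegral_cv_rpow_le {p : ℝ} (hp : 2 ≤ p) (φ : SchwartzMap 𝔼 ℂ)
    (hsq : ∀ f : 𝔼 → ℂ, Nice f → ∑' k : ℤ, ∫⁻ x, ‖cv (dil ((2 : ℝ) ^ k) φ) f x‖ₑ ^ (2 : ℝ) ≤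
      5 * ∫⁻ x, ‖f x‖ₑ ^ (2 : ℝ)) :
    ∃ C : NNReal, ∀ f : 𝔼 → ℂ, Nice f →
      ∑' k : ℤ, ∫⁻ x, ‖cv (dil ((2 : ℝ) ^ k) φ) f x‖ₑ ^ p ≤ C * ∫⁻ x, ‖f x‖ₑ ^ p := by
  rcases hp.eq_or_lt with rfl | hp2
  · exact ⟨5, fun f hf => hsq f hf⟩
  have hp0 : 0 < p := by linarith
  have h2k : ∀ k : ℤ, (0 : ℝ) < 2 ^ k := fun k => by positivity
  set M : ℝ := (∫⁻ z, ‖(φ : 𝔼 → ℂ) z‖ₑ).toReal with hM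
  have hMt : ∫⁻ z, ‖(φ : 𝔼 → ℂ) z‖ₑ ≠ ⊤ := φ.integrable.2.ne
  have hM0 : 0 ≤ M := ENNReal.toReal_nonneg
  set c : ℝ := (2 * (M + 1))⁻¹ with hc
  have hc0 : 0 < c := by positivity
  refine ⟨(20 * ENNReal.ofReal (p / (p - 2) * c ^ (2 - p))).toNNReal, fun f hf => ?_⟩
  rw [ENNReal.coe_toNNReal (by finiteness)]
  have hcvm : ∀ k : ℤ, ∀ g, Nice g → Measurable (cv (dil ((2 : ℝ) ^ k) φ) g) := fun k g hg =>
    ((φ.niceKer.dil (h2k k)).continuous_cv hg.int).measurable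
  set F : ℤ × 𝔼 → ℝ := fun y => ‖cv (dil ((2 : ℝ) ^ y.1) φ) f y.2‖ with hF
  have hFm : Measurable F :=
    measurable_from_prod_countable_right fun k => (hcvm k f hf).norm
  have hconv : ∀ (u : ℂ) (r : ℝ), 0 < r → ENNReal.ofReal (‖u‖ ^ r) = ‖u‖ₑ ^ r := fun u r hr => by
    rw [← ENNReal.ofReal_rpow_of_nonneg (norm_nonneg _) hr.le, ofReal_norm]
  have hweak : ∀ s : ℝ, 0 < s → (Measure.count.prod volume) {y | s < F y} ≤
      20 * ENNReal.ofReal (s ^ (-(2 : ℝ))) *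
        ∫⁻ x in {x | c * s < ‖f x‖}, ENNReal.ofReal (‖f x‖ ^ (2 : ℝ)) := by
    intro s hs
    set S : Set 𝔼 := {x | c * s < ‖f x‖} with hS
    have hSm : MeasurableSet S := measurableSet_lt measurable_const hf.meas.norm
    rw [Measure.prod_apply (measurableSet_lt measurable_const hFm), lintegral_count]
    have h1 : ∀ k : ℤ, volume (Prod.mk k ⁻¹' {y | s < F y}) ≤
        4 * ENNReal.ofReal (s ^ (-(2 : ℝ))) *
          ∫⁻ x, ‖cv (dil ((2 : ℝ) ^ k) φ) (S.indicator f) x‖ₑ ^ (2 : ℝ) := by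
      intro k
      have h3 : Prod.mk k ⁻¹' {y | s < F y} ⊆ {x | ENNReal.ofReal ((s / 2) ^ (2 : ℝ)) ≤
          ‖cv (dil ((2 : ℝ) ^ k) φ) (S.indicator f) x‖ₑ ^ (2 : ℝ)} := by
        intro x hx
        have hx' : s < ‖cv (dil ((2 : ℝ) ^ k) φ) f x‖ := hx
        have h4 : cv (dil ((2 : ℝ) ^ k) φ) f x = cv (dil ((2 : ℝ) ^ k) φ) (S.indicator f) x +
            cv (dil ((2 : ℝ) ^ k) φ) (Sᶜ.indicator f) x := by
          rw [cv, cv, cv, ← integral_add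
            ((φ.niceKer.dil (h2k k)).integrable_mul (hf.indicator hSm).int x)
            ((φ.niceKer.dil (h2k k)).integrable_mul (hf.indicator hSm.compl).int x)]
          refine integral_congr_ae (Filter.Eventually.of_forall fun y => ?_)
          simp only
          rw [← mul_add, Set.indicator_self_add_compl_apply]
        have h5 : ‖cv (dil ((2 : ℝ) ^ k) φ) (Sᶜ.indicator f) x‖ ≤ s / 2 := by
          have h6 := φ.niceKer.enorm_cv_dil_le (f := Sᶜ.indicator f)
            (b := ENNReal.ofReal (c * s)) (fun y => ?_) (h2k k) x
          · rw [← ENNReal.ofReal_toReal hMt, ← ENNReal.ofReal_mul ENNReal.toReal_nonneg, ← hM,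
              ← ofReal_norm, ENNReal.ofReal_le_ofReal_iff (by positivity)] at h6
            refine h6.trans ?_
            rw [hc, ← mul_assoc, div_eq_inv_mul]
            refine mul_le_mul_of_nonneg_right ?_ hs.le
            rw [mul_inv, mul_left_comm]
            refine mul_le_of_le_one_right (by norm_num) ?_
            rw [← div_eq_mul_inv, div_le_one (by positivity)]
            linarith
          · by_cases hy : y ∈ S
            · rw [Set.indicator_of_notMem (by simpa using hy)]
              simp
            · rw [Set.indicator_of_mem (by simpa using hy), ← ofReal_norm]
              exact ENNReal.ofReal_le_ofReal (not_lt.1 hy)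
        have h7 : s / 2 ≤ ‖cv (dil ((2 : ℝ) ^ k) φ) (S.indicator f) x‖ := by
          have := norm_add_le (cv (dil ((2 : ℝ) ^ k) φ) (S.indicator f) x)
            (cv (dil ((2 : ℝ) ^ k) φ) (Sᶜ.indicator f) x)
          rw [← h4] at this
          linarith
        rw [Set.mem_ofPred_eq, ← hconv _ 2 two_pos]
        exact ENNReal.ofReal_le_ofReal (Real.rpow_le_rpow (by positivity) h7 (by norm_num))
      have h8 := mul_meas_ge_le_lintegral (μ := (volume : Measure 𝔼))
        ((hcvm k _ (hf.indicator hSm)).enorm.pow_const (2 : ℝ))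
        (ENNReal.ofReal ((s / 2) ^ (2 : ℝ)))
      have h9 : 4 * ENNReal.ofReal (s ^ (-(2 : ℝ))) * ENNReal.ofReal ((s / 2) ^ (2 : ℝ)) = 1 := by
        rw [show (4 : ℝ≥0∞) = ENNReal.ofReal 4 by norm_num, ← ENNReal.ofReal_mul (by norm_num),
          ← ENNReal.ofReal_mul (by positivity), ← ENNReal.ofReal_one]
        congr 1
        rw [Real.rpow_neg hs.le, Real.rpow_two, Real.rpow_two]
        field_simp
        norm_num
      calc _ ≤ _ := measure_mono h3
        _ = 4 * ENNReal.ofReal (s ^ (-(2 : ℝ))) * (ENNReal.ofReal ((s / 2) ^ (2 : ℝ)) * _) := by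
            rw [← mul_assoc, h9, one_mul]
        _ ≤ _ := mul_le_mul' le_rfl h8
    refine (ENNReal.tsum_le_tsum h1).trans ?_
    rw [ENNReal.tsum_mul_left]
    refine (mul_le_mul' le_rfl (hsq _ (hf.indicator hSm))).trans (le_of_eq ?_)
    have h10 : ∫⁻ x, ‖S.indicator f x‖ₑ ^ (2 : ℝ) =
        ∫⁻ x in S, ENNReal.ofReal (‖f x‖ ^ (2 : ℝ)) := by
      rw [← lintegral_indicator hSm]
      refine lintegral_congr fun x => ?_
      by_cases hx : x ∈ S
      · rw [Set.indicator_of_mem hx, Set.indicator_of_mem hx, hconv _ 2 two_pos]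
      · simp [Set.indicator_of_notMem hx]
    rw [h10]
    ring
  have hmain := lintegral_rpow_le_of_weak_type (volume : Measure 𝔼)
    (Measure.count.prod (volume : Measure 𝔼)) hp2 two_pos hc0 20 hf.meas.norm
    (fun x => norm_nonneg _) hFm.aemeasurable (fun y => norm_nonneg _) hweak
  rw [lintegral_prod _ (by fun_prop), lintegral_count] at hmain
  simp only [hF, hconv _ p hp0] at hmain
  exact hmain

theorem AdmPair.enorm_cv_dil_rpow_le_tsum {p ε lam A B : ℝ}
    {φ K L f : EuclideanSpace ℝ (Fin d) → ℂ} (H : AdmPair p ε lam A B φ K L) {q : ℝ} (hq : 1 < q)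
    (hf : Integrable f) (x : 𝔼) {t : ℝ} (ht : 0 < t) :
    ‖cv (dil t K) f x‖ₑ ^ q ≤ ∑' k : ℤ, sobMaj lam q (2 ^ k) K L f x := by
  obtain ⟨k, hk⟩ := exists_mem_Ico_zpow ht one_lt_two
  refine le_trans (H.enorm_rpow_le_sobMaj hq hf x (S := 2 ^ k) (by positivity) ⟨hk.1, ?_⟩)
    (ENNReal.le_tsum k)
  rw [← zpow_one_add₀ (by norm_num), add_comm]
  exact hk.2.le

theorem exists_maximal_bound_of_two_le {p ε : ℝ} (hp : 2 ≤ p) (φ : SchwartzMap 𝔼 ℂ)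
    (hsq : ∀ f : 𝔼 → ℂ, Nice f → ∑' k : ℤ, ∫⁻ x, ‖cv (dil ((2 : ℝ) ^ k) φ) f x‖ₑ ^ (2 : ℝ) ≤
      5 * ∫⁻ x, ‖f x‖ₑ ^ (2 : ℝ)) :
    ∃ C : NNReal, ∀ (K L : 𝔼 → ℂ) (lam A B : ℝ), AdmPair p ε lam A B φ K L →
      ∀ f, Nice f → ∫⁻ x, (⨆ (t : ℝ) (_ : 0 < t), ‖cv (dil t K) f x‖ₑ) ^ p ≤
        C * (ENNReal.ofReal lam * ENNReal.ofReal A ^ p * ∫⁻ x, ‖f x‖ₑ ^ p) := by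
  have hp0 : 0 < p := by linarith
  obtain ⟨C, hC⟩ := exists_sum_lintegral_cv_rpow_le hp φ hsq
  refine ⟨((2 : ℝ≥0∞) ^ p * C).toNNReal, fun K L lam A B H f hf => ?_⟩
  rw [ENNReal.coe_toNNReal (by finiteness)]
  calc ∫⁻ x, (⨆ (t : ℝ) (_ : 0 < t), ‖cv (dil t K) f x‖ₑ) ^ p
      ≤ ∫⁻ x, ∑' k : ℤ, sobMaj lam p (2 ^ k) K L f x := lintegral_mono fun x => by
        rw [← ENNReal.le_rpow_inv_iff hp0]
        exact iSup₂_le fun t ht => (ENNReal.le_rpow_inv_iff hp0).2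
          (H.enorm_cv_dil_rpow_le_tsum (by linarith) hf.int x ht)
    _ = ∑' k : ℤ, ∫⁻ x, sobMaj lam p (2 ^ k) K L f x := lintegral_tsum fun k =>
        (measurable_sobMaj _ _ _ H.left.ker H.right.ker hf.meas).aemeasurable
    _ ≤ ∑' k : ℤ, ENNReal.ofReal lam * 2 ^ p * (ENNReal.ofReal A ^ p *
          ∫⁻ x, ‖cv (dil ((2 : ℝ) ^ k) φ) f x‖ₑ ^ p) := ENNReal.tsum_le_tsum fun k =>
        H.lintegral_sobMaj_Lp φ.niceKer hf (by positivity)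
    _ ≤ ENNReal.ofReal lam * 2 ^ p * (ENNReal.ofReal A ^ p * (C * ∫⁻ x, ‖f x‖ₑ ^ p)) := by
        rw [ENNReal.tsum_mul_left, ENNReal.tsum_mul_left]
        exact mul_le_mul' le_rfl (mul_le_mul' le_rfl (hC f hf))
    _ = _ := by ring

end

section

theorem dil_one (K : EuclideanSpace ℝ (Fin d) → ℂ) : dil 1 K = K := by
  funext z
  simp [dil]

theorem NiceKer.tendsto_cv {K f : EuclideanSpace ℝ (Fin d) → ℂ} (hK : NiceKer K)
    {h : ℕ → EuclideanSpace ℝ (Fin d) → ℂ} (hm : ∀ n, Measurable (h n)) {b : ℝ}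
    (hb : ∀ n x, ‖h n x‖ ≤ b)
    (hlim : ∀ x, Filter.Tendsto (fun n => h n x) Filter.atTop (nhds (f x))) (x : 𝔼) :
    Filter.Tendsto (fun n => _root_.cv K (h n) x) Filter.atTop (nhds (_root_.cv K f x)) := by
  have hc : Continuous fun y => K (x - y) := hK.cont.comp (continuous_const.sub continuous_id)
  refine tendsto_integral_of_dominated_convergence (fun y => ‖K (x - y)‖ * b)
    (fun n => (hc.measurable.mul (hm n)).aestronglyMeasurable)
    ((hK.int.comp_sub_left x).norm.mul_const b)
    (fun n => Filter.Eventually.of_forall fun y => ?_)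
    (Filter.Eventually.of_forall fun y => (hlim y).const_mul _)
  rw [norm_mul]
  exact mul_le_mul_of_nonneg_left (hb n y) (norm_nonneg _)

theorem exists_maximal_bound_of_lt_two (hd : 1 ≤ d) {p ε : ℝ} (hp : 1 < p) (hp2 : p < 2)
    (hε : 0 < ε) (φ : SchwartzMap 𝔼 ℂ)
    (hsq : ∀ f : 𝔼 → ℂ, Nice f → ∑' k : ℤ, ∫⁻ x, ‖cv (dil ((2 : ℝ) ^ k) φ) f x‖ₑ ^ (2 : ℝ) ≤
      5 * ∫⁻ x, ‖f x‖ₑ ^ (2 : ℝ)) :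
    ∃ C : NNReal, ∀ (K L : 𝔼 → ℂ) (lam A B : ℝ), AdmPair p ε lam A B φ K L → 0 < A →
      ∀ N : ℕ, B ≤ A * 2 ^ (ε * N) → ∀ f, Nice f → Continuous f →
        ∫⁻ x, (⨆ (t : ℝ) (_ : 0 < t), ‖cv (dil t K) f x‖ₑ) ^ p ≤
          C * (ENNReal.ofReal lam * ENNReal.ofReal A ^ p *
            (((N : ℝ≥0∞) + 1) ^ (1 - p / 2) * ∫⁻ x, ‖f x‖ₑ ^ p)) := by
  have hp0 : 0 < p := by linarith
  obtain ⟨Λ, C₁, hC₁⟩ := exists_atomic_approximation hd hp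
  obtain ⟨C₂, hC₂⟩ := exists_maximal_atoms_bound hp hp2 hε Λ φ hsq
  refine ⟨C₂ * C₁, fun K L lam A B H hA N hN f hf hfc => ?_⟩
  obtain ⟨h, hlim, ⟨b, hb⟩, hat⟩ := hC₁ f hf hfc
  set R : ℝ≥0∞ := ((C₂ * C₁ : NNReal) : ℝ≥0∞) * (ENNReal.ofReal lam * ENNReal.ofReal A ^ p *
    (((N : ℝ≥0∞) + 1) ^ (1 - p / 2) * ∫⁻ x, ‖f x‖ₑ ^ p)) with hR
  have hG : ∀ n, ∃ G : 𝔼 → ℝ≥0∞, Measurable G ∧ ∫⁻ x, G x ^ p ≤ R ∧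
      ∀ x t, 0 < t → ‖cv (dil t K) (h n) x‖ₑ ≤ G x := by
    intro n
    obtain ⟨ι, _, W, z, j, c, a, ha, hha, hH⟩ := hat n
    obtain ⟨G, hGm, hGi, hG⟩ := hC₂ K L lam A B H hA N hN ι Finset.univ W z j c a ha
    refine ⟨G, hGm, hGi.trans ?_, by rwa [hha]⟩
    refine (mul_le_mul' le_rfl (mul_le_mul' le_rfl (mul_le_mul' le_rfl hH))).trans (le_of_eq ?_)
    rw [hR]
    push_cast
    ring
  choose G hGm hGi hGb using hG
  have hm : ∀ n, Measurable (h n) := fun n => by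
    obtain ⟨ι, _, W, z, j, c, a, ha, hha, -⟩ := hat n
    rw [hha]
    exact Finset.measurable_fun_sum _ fun i _ => (ha i).meas
  have hpt : ∀ x, (⨆ (t : ℝ) (_ : 0 < t), ‖cv (dil t K) f x‖ₑ) ^ p ≤
      Filter.liminf (fun n => G n x ^ p) Filter.atTop := by
    intro x
    rw [← ENNReal.le_rpow_inv_iff hp0]
    refine iSup₂_le fun t ht => (ENNReal.le_rpow_inv_iff hp0).2 ?_
    have h1 := ((ENNReal.continuous_rpow_const (y := p)).tendsto _).comp
      ((H.left.ker.dil ht).tendsto_cv hm hb hlim x).enorm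
    rw [← h1.liminf_eq]
    exact Filter.liminf_le_liminf (Filter.Eventually.of_forall fun n =>
      ENNReal.rpow_le_rpow (hGb n x t ht) hp0.le)
  calc _ ≤ ∫⁻ x, Filter.liminf (fun n => G n x ^ p) Filter.atTop := lintegral_mono hpt
    _ ≤ Filter.liminf (fun n => ∫⁻ x, G n x ^ p) Filter.atTop :=
        lintegral_liminf_le fun n => (hGm n).pow_const p
    _ ≤ Filter.liminf (fun _ : ℕ => R) Filter.atTop :=
        Filter.liminf_le_liminf (Filter.Eventually.of_forall hGi)
    _ = R := Filter.liminf_const R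

theorem exists_admKer {p ε A B : ℝ} (hp : 1 < p) (hA : 0 < A) {φ : SchwartzMap 𝔼 ℂ}
    (hφ : ∀ η, 1 / 2 ≤ 2 * π * ‖η‖ → 2 * π * ‖η‖ ≤ 2 → FourierTransform.fourier φ η = 1)
    {m : EuclideanSpace ℝ (Fin d) → ℂ} (hm : ContDiff ℝ (⊤ : ℕ∞) m)
    (hms : Function.support m ⊆ {ξ : 𝔼 | 1 ≤ ‖ξ‖ ∧ ‖ξ‖ ≤ 2})
    (hLp : ∀ f : SchwartzMap 𝔼 ℂ, eLpNorm (Tmultd m ⇑f) (ENNReal.ofReal p) volume ≤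
      ENNReal.ofReal A * eLpNorm (⇑f) (ENNReal.ofReal p) volume)
    (htail : ∀ r : ℝ, 0 < r → ∫⁻ x in {x : 𝔼 | r < ‖x‖}, ‖invFourierTd m x‖₊ ≤
      ENNReal.ofReal (B * (1 + r) ^ (-ε))) :
    AdmKer p ε A B φ (invFourierTd m) ∧ ∀ (f : SchwartzMap 𝔼 ℂ) (s : ℝ), 0 < s →
      Tmultd (fun ξ => m (s • ξ)) ⇑f = cv (dil s (invFourierTd m)) ⇑f := by
  obtain ⟨K, hK, hKf, hKT⟩ := exists_schwartz_kernel hm (hasCompactSupport_of_annulus hms)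
  rw [hK] at hKT
  refine ⟨?_, hKT⟩
  have hLp' : ∀ f : 𝔼 → ℂ, Nice f →
      ∫⁻ x, ‖cv K f x‖ₑ ^ p ≤ ENNReal.ofReal A ^ p * ∫⁻ x, ‖f x‖ₑ ^ p := fun f hf => by
    refine hf.lintegral_cv_rpow_le_of_schwartz hp fun g => ?_
    have h1 := hKT g 1 one_pos
    rw [dil_one, ← hK] at h1
    simp only [one_smul] at h1
    rw [← h1]
    exact hLp g
  have hsupp : ∀ η, FourierTransform.fourier K η ≠ 0 →
      1 ≤ 2 * π * ‖η‖ ∧ 2 * π * ‖η‖ ≤ 2 := fun η hη => by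
    rw [hKf] at hη
    have h2 := hms hη
    rwa [Set.mem_ofPred_eq, norm_smul, Real.norm_of_nonneg (by positivity)] at h2
  rw [← hK]
  refine ⟨K.niceKer, hLp', fun f hf => lintegral_cv_sq_le
    (fun η => ?_) hf, fun r hr => ?_, fun t s ht hts hst f hf =>
      cv_dil_cutoff hsupp hφ ht hts hst hf⟩
  · have := norm_fourier_le_of_lintegral_cv_rpow_le K.niceKer hp hA.le hLp' η
    rwa [← SchwartzMap.fourier_coe] at this
  · rw [hK]
    exact htail r hr

theorem exists_nat_two_rpow_ge {ε x : ℝ} (hε : 0 < ε) (hx : 0 < x) : ∃ N : ℕ,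
    x ≤ 2 ^ (ε * N) ∧ (N : ℝ) + 1 ≤ (1 / ε + 2) / Real.log 2 * Real.log (2 + x) := by
  have hl2 : 0 < Real.log 2 := Real.log_pos one_lt_two
  have hl : Real.log 2 ≤ Real.log (2 + x) := Real.log_le_log two_pos (by linarith)
  set y : ℝ := Real.log (2 + x) / Real.log 2 / ε with hy
  have hl0 : 0 < Real.log (2 + x) := hl2.trans_le hl
  have hy0 : 0 ≤ y := by positivity
  refine ⟨⌈y⌉₊, ?_, ?_⟩
  · have h1 : Real.log (2 + x) / Real.log 2 ≤ ε * ⌈y⌉₊ := by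
      have := mul_le_mul_of_nonneg_left (Nat.le_ceil y) hε.le
      rwa [hy, mul_div_cancel₀ _ hε.ne'] at this
    refine le_trans ?_ (Real.rpow_le_rpow_of_exponent_le one_le_two h1)
    rw [← Real.logb, Real.rpow_logb two_pos (by norm_num) (by linarith)]
    linarith
  · have h1 := (Nat.ceil_lt_add_one hy0).le
    have h2 : 1 ≤ Real.log (2 + x) / Real.log 2 := (one_le_div hl2).2 hl
    have h3 : (1 / ε + 2) / Real.log 2 * Real.log (2 + x) =
        y + 2 * (Real.log (2 + x) / Real.log 2) := by
      rw [hy]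
      field_simp
    linarith

theorem rpow_one_div_le_of_le_mul {p C lam A w θ : ℝ} (hp : 1 < p) (hC : 0 ≤ C) (hlam : 0 ≤ lam)
    (hA : 0 ≤ A) (hw : 0 ≤ w) (hθ : 0 ≤ θ) {X F : ℝ≥0∞}
    (h : X ≤ ENNReal.ofReal C * (ENNReal.ofReal lam * ENNReal.ofReal A ^ p *
      (ENNReal.ofReal w ^ (p * θ) * F ^ p))) :
    X ^ (1 / p) ≤ ENNReal.ofReal (C ^ (1 / p) * lam ^ (1 / p) * A * w ^ θ) * F := by
  have hp0 : 0 < p := by linarith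
  have hp1 : 0 ≤ 1 / p := by positivity
  refine (ENNReal.rpow_le_rpow h hp1).trans (le_of_eq ?_)
  rw [ENNReal.mul_rpow_of_nonneg _ _ hp1, ENNReal.mul_rpow_of_nonneg _ _ hp1,
    ENNReal.mul_rpow_of_nonneg _ _ hp1, ENNReal.mul_rpow_of_nonneg _ _ hp1,
    ← ENNReal.rpow_mul, ← ENNReal.rpow_mul, ← ENNReal.rpow_mul, mul_one_div_cancel hp0.ne',
    show p * θ * (1 / p) = θ by field_simp, ENNReal.rpow_one, ENNReal.rpow_one,
    ENNReal.ofReal_mul (by positivity), ENNReal.ofReal_mul (by positivity),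
    ENNReal.ofReal_mul (by positivity), ENNReal.ofReal_rpow_of_nonneg hC hp1,
    ENNReal.ofReal_rpow_of_nonneg hlam hp1, ENNReal.ofReal_rpow_of_nonneg hw hθ]
  ring

/-- The maximal estimate for admissible pairs in integrated form. -/
theorem exists_maximal_bound (hd : 1 ≤ d) {p ε : ℝ} (hp : 1 < p) (hε : 0 < ε)
    (φ : SchwartzMap 𝔼 ℂ)
    (hsq : ∀ f : 𝔼 → ℂ, Nice f → ∑' k : ℤ, ∫⁻ x, ‖cv (dil ((2 : ℝ) ^ k) φ) f x‖ₑ ^ (2 : ℝ) ≤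
      5 * ∫⁻ x, ‖f x‖ₑ ^ (2 : ℝ)) :
    ∃ C M : ℝ, 0 ≤ C ∧ 0 < M ∧ ∀ (K L : 𝔼 → ℂ) (lam A B : ℝ), AdmPair p ε lam A B φ K L → 0 < A →
      0 < B → ∀ f, Nice f → Continuous f →
        ∫⁻ x, (⨆ (t : ℝ) (_ : 0 < t), ‖cv (dil t K) f x‖ₑ) ^ p ≤
          ENNReal.ofReal C * (ENNReal.ofReal lam * ENNReal.ofReal A ^ p *
            (ENNReal.ofReal (M * Real.log (2 + B / A)) ^ (p * |1 / p - 1 / 2|) *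
              ∫⁻ x, ‖f x‖ₑ ^ p)) := by
  have hl2 : 0 < Real.log 2 := Real.log_pos one_lt_two
  have hp0 : 0 < p := by linarith
  rcases le_or_gt 2 p with hp2 | hp2
  · obtain ⟨C, hC⟩ := exists_maximal_bound_of_two_le (ε := ε) hp2 φ hsq
    refine ⟨C, 1 / Real.log 2, C.2, by positivity, fun K L lam A B H hA hB f hf hfc => ?_⟩
    rw [ENNReal.ofReal_coe_nnreal]
    refine (hC K L lam A B H f hf).trans ?_
    refine mul_le_mul' le_rfl (mul_le_mul' le_rfl (le_mul_of_one_le_left bot_le ?_))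
    rw [← ENNReal.one_rpow (p * |1 / p - 1 / 2|)]
    refine ENNReal.rpow_le_rpow ?_ (by positivity)
    rw [ENNReal.one_le_ofReal, one_div_mul_eq_div, one_le_div hl2]
    exact Real.log_le_log two_pos (by have := div_pos hB hA; linarith)
  · obtain ⟨C, hC⟩ := exists_maximal_bound_of_lt_two hd hp hp2 hε φ hsq
    refine ⟨C, (1 / ε + 2) / Real.log 2, C.2, by positivity, fun K L lam A B H hA hB f hf hfc => ?_⟩
    rw [ENNReal.ofReal_coe_nnreal]
    obtain ⟨N, hN, hN'⟩ := exists_nat_two_rpow_ge hε (div_pos hB hA)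
    rw [div_le_iff₀ hA, mul_comm] at hN
    refine (hC K L lam A B H hA N hN f hf hfc).trans ?_
    refine mul_le_mul' le_rfl (mul_le_mul' le_rfl (mul_le_mul' ?_ le_rfl))
    have h1 : p * |1 / p - 1 / 2| = 1 - p / 2 := by
      rw [abs_of_nonneg (sub_nonneg.2 (one_div_le_one_div_of_le hp0 hp2.le)), mul_sub,
        mul_one_div_cancel hp0.ne']
      ring
    rw [h1]
    refine ENNReal.rpow_le_rpow ?_ (by linarith)
    rw [← ENNReal.ofReal_natCast, ← ENNReal.ofReal_one, ← ENNReal.ofReal_add (by positivity)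
      zero_le_one]
    exact ENNReal.ofReal_le_ofReal hN'

end

theorem maximal_from_multiplier
    (d : ℕ) (hd : 1 ≤ d) (p : ℝ) (hp : 1 < p) (ε : ℝ) (hε : 0 < ε) :
    ∃ Cc : ℝ, 0 < Cc ∧
      ∀ lam : ℝ, 2 ≤ lam →
      ∀ m : EuclideanSpace ℝ (Fin d) → ℂ, ContDiff ℝ (⊤ : ℕ∞) m →
        Function.support m ⊆ {ξ : EuclideanSpace ℝ (Fin d) | 1 ≤ ‖ξ‖ ∧ ‖ξ‖ ≤ 2} →
      ∀ A B : ℝ, 0 < A → 0 < B →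
      (∀ f : SchwartzMap (EuclideanSpace ℝ (Fin d)) ℂ,
        eLpNorm (Tmultd m ⇑f) (ENNReal.ofReal p) volume ≤
          ENNReal.ofReal A * eLpNorm (⇑f) (ENNReal.ofReal p) volume) →
      (∀ f : SchwartzMap (EuclideanSpace ℝ (Fin d)) ℂ,
        eLpNorm (Tmultd (fun ξ => (lam : ℂ)⁻¹ * radialDeriv m ξ) ⇑f)
            (ENNReal.ofReal p) volume ≤
          ENNReal.ofReal A * eLpNorm (⇑f) (ENNReal.ofReal p) volume) →
      (∀ r : ℝ, 0 < r →
        ∫⁻ x in {x : EuclideanSpace ℝ (Fin d) | r < ‖x‖},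
            ‖invFourierTd m x‖₊ ∂volume ≤
          ENNReal.ofReal (B * (1 + r) ^ (-ε))) →
      (∀ r : ℝ, 0 < r →
        ∫⁻ x in {x : EuclideanSpace ℝ (Fin d) | r < ‖x‖},
            ‖invFourierTd (fun ξ => (lam : ℂ)⁻¹ * radialDeriv m ξ) x‖₊ ∂volume ≤
          ENNReal.ofReal (B * (1 + r) ^ (-ε))) →
      ∀ f : SchwartzMap (EuclideanSpace ℝ (Fin d)) ℂ,
        (∫⁻ x, (⨆ (t : ℝ) (_ : 0 < t),
            (‖Tmultd (fun ξ => m (t • ξ)) (⇑f) x‖₊ : ℝ≥0∞)) ^ p ∂volume) ^ (1 / p) ≤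
          ENNReal.ofReal
              (Cc * lam ^ (1 / p) * A * Real.log (2 + B / A) ^ |1 / p - 1 / 2|) *
            eLpNorm (⇑f) (ENNReal.ofReal p) volume := by
  obtain ⟨φ, hφ1, hφ2, hφ3⟩ := exists_cutoff_kernel (d := d)
  have hsq : ∀ f : EuclideanSpace ℝ (Fin d) → ℂ, Nice f →
      ∑' k : ℤ, ∫⁻ x, ‖cv (dil ((2 : ℝ) ^ k) φ) f x‖ₑ ^ (2 : ℝ) ≤
        5 * ∫⁻ x, ‖f x‖ₑ ^ (2 : ℝ) := fun f hf => by
    rw [ENNReal.tsum_eq_iSup_sum]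
    exact iSup_le fun I => sum_lintegral_cutoff_sq_le hφ2 hφ3 I hf
  obtain ⟨C, M, hC0, hM, hC⟩ := exists_maximal_bound hd hp hε φ hsq
  refine ⟨(C + 1) ^ (1 / p) * M ^ |1 / p - 1 / 2|, by positivity,
    fun lam hlam m hm hms A B hA hB hLp hLp' ht ht' f => ?_⟩
  have hlam0 : 0 < lam := by linarith
  obtain ⟨H₁, hT⟩ := exists_admKer hp hA hφ1 hm hms hLp ht
  obtain ⟨H₂, -⟩ := exists_admKer hp hA hφ1 (contDiff_radialDeriv hm _)
    (support_radialDeriv_subset hms _) hLp' ht'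
  have hmain := hC _ _ lam A B ⟨H₁, H₂, by linarith, fun z s hs =>
    hasDerivAt_dil_invFourierTd hm (hasCompactSupport_of_annulus hms) hlam0 z hs⟩ hA hB f
      f.niceKer.nice f.continuous
  have hlog : 0 ≤ Real.log (2 + B / A) := Real.log_nonneg (by
    have := div_pos hB hA
    linarith)
  have hX : ∫⁻ x, (⨆ (t : ℝ) (_ : 0 < t), (‖Tmultd (fun ξ => m (t • ξ)) (⇑f) x‖₊ : ℝ≥0∞)) ^ p =
      ∫⁻ x, (⨆ (t : ℝ) (_ : 0 < t), ‖cv (dil t (invFourierTd m)) f x‖ₑ) ^ p := by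
    refine lintegral_congr fun x => ?_
    congr 1
    refine iSup_congr fun t => iSup_congr fun ht => ?_
    rw [hT f t ht]
    rfl
  rw [hX]
  rw [← eLpNorm_ofReal_rpow volume (by linarith)] at hmain
  refine (rpow_one_div_le_of_le_mul (C := C + 1) hp (by positivity) hlam0.le hA.le
    (mul_nonneg hM.le hlog) (abs_nonneg (1 / p - 1 / 2)) (hmain.trans (mul_le_mul'
      (ENNReal.ofReal_le_ofReal (by linarith)) le_rfl))).trans (le_of_eq ?_)
  rw [Real.mul_rpow hM.le hlog]
  congr 2
  ring
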